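/- Main cavity estimate: with A_{n,ε} = E[log⟨Σ_{σ∈S} P0(σ)·exp(σ̄·z(x) + σ̄²·s(x))⟩_{n,ε}] − E[log⟨exp(y(x))⟩_{n,ε}] and 𝓕_ε(λ,q) = −(λ/4)q² + ε·E_{P0}[X²]·(λq/2) + (1−ε)·E[log Σ_{x∈S} P0(x)·exp(√(λq)·Z·x + λq·x·X − (λ/2)·q·x²)] (X ~ P0, Z ~ N(0,1) independent), one has ∫_0^{ε₀} (A_{n,ε} − E[𝓕_ε(λ,Q)]) dε → 0 as n → ∞. -/

import Mathlib

open MeasureTheory ProbabilityTheory Filter Finset Real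

noncomputable section

/-- The standard Gaussian measure on `ℝ`. -/
def stdGauss : Measure ℝ := gaussianReal 0 1

/-- The Bernoulli(ε) measure on `Bool`. -/
def bern (ε : ℝ) : Measure Bool :=
  ENNReal.ofReal ε • Measure.dirac true + ENNReal.ofReal (1 - ε) • Measure.dirac false

instance (ε : ℝ) : IsFiniteMeasure (bern ε) := by
  constructor
  rw [bern, Measure.add_apply, Measure.smul_apply, Measure.smul_apply, smul_eq_mul,
    smul_eq_mul, measure_univ, measure_univ, mul_one, mul_one]
  exact ENNReal.add_lt_top.2 ⟨ENNReal.ofReal_lt_top, ENNReal.ofReal_lt_top⟩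

/-- The set of pairs `(i, j)` with `i < j`. -/
def pairs (n : ℕ) : Finset (Fin n × Fin n) :=
  Finset.univ.filter fun p => p.1 < p.2

/-- The ambient sample space of the cavity computation:
`(X, Z, L, Z″, Z̃)` where `X : Fin (n+1) → ℝ` is the signal, `Z` the Gaussian noise,
`L` the Bernoulli revelation variables, and `Z″, Z̃` the auxiliary Gaussians used in `y`. -/
abbrev CavΩ (n : ℕ) :=
  (Fin (n + 1) → ℝ) × ((Fin (n + 1) × Fin (n + 1)) → ℝ) × (Fin (n + 1) → Bool) ×
    (Fin (n + 1) → ℝ) × ((Fin (n + 1) × Fin (n + 1)) → ℝ)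

/-- The law of `(X, Z, L, Z″, Z̃)`: all coordinates independent, `X_i` i.i.d. `P0`,
`Z, Z″, Z̃` i.i.d. standard Gaussian, `L_i` i.i.d. Bernoulli(ε). -/
def cavMeas (P0 : Measure ℝ) [IsProbabilityMeasure P0] (n : ℕ) (ε : ℝ) :
    Measure (CavΩ n) :=
  (Measure.pi fun _ : Fin (n + 1) => P0).prod
    ((Measure.pi fun _ : Fin (n + 1) × Fin (n + 1) => stdGauss).prod
      ((Measure.pi fun _ : Fin (n + 1) => bern ε).prod
        ((Measure.pi fun _ : Fin (n + 1) => stdGauss).prod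
          (Measure.pi fun _ : Fin (n + 1) × Fin (n + 1) => stdGauss))))

/-- `x̄_i = L_i X_i + (1 − L_i) x_i`. -/
def xbar (n : ℕ) (ω : CavΩ n) (x : Fin n → ℝ) : Fin n → ℝ :=
  fun i => if ω.2.2.1 i.castSucc then ω.1 i.castSucc else x i

/-- `σ̄ = (1 − L_{n+1}) σ + L_{n+1} X′`. -/
def sigbar (n : ℕ) (ω : CavΩ n) (σ : ℝ) : ℝ :=
  if ω.2.2.1 (Fin.last n) then ω.1 (Fin.last n) else σ

/-- The cavity Hamiltonian `H′_n(x)`. -/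
def Hcav (n : ℕ) (lam : ℝ) (ω : CavΩ n) (x : Fin n → ℝ) : ℝ :=
  ∑ p ∈ pairs n,
    (Real.sqrt (lam / (n + 1)) * ω.2.1 (p.1.castSucc, p.2.castSucc) * x p.1 * x p.2
      + lam / (n + 1) * ω.1 p.1.castSucc * ω.1 p.2.castSucc * x p.1 * x p.2
      - lam / (2 * (n + 1)) * (x p.1) ^ 2 * (x p.2) ^ 2)

/-- The configurations `x ∈ Sⁿ`. -/
def confs (S : Finset ℝ) (n : ℕ) : Finset (Fin n → ℝ) :=
  Fintype.piFinset fun _ => S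

/-- The weight `P0⊗n(x) = Π_i P0({x_i})`. -/
def weight (P0 : Measure ℝ) (n : ℕ) (x : Fin n → ℝ) : ℝ :=
  ∏ i, (P0 {x i}).toReal

/-- The Gibbs average
`⟨f(x)⟩_{n,ε} = Σ_x P0⊗n(x) f(x̄) exp(H′_n(x̄)) / Σ_x P0⊗n(x) exp(H′_n(x̄))`. -/
def gibbs (P0 : Measure ℝ) (S : Finset ℝ) (n : ℕ) (lam : ℝ) (ω : CavΩ n)
    (f : (Fin n → ℝ) → ℝ) : ℝ :=
  (∑ x ∈ confs S n, weight P0 n x * f (xbar n ω x) * Real.exp (Hcav n lam ω (xbar n ω x)))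
    / (∑ x ∈ confs S n, weight P0 n x * Real.exp (Hcav n lam ω (xbar n ω x)))

/-- The normalized dot product `u · v = (1/n) Σ_i u_i v_i`. -/
def ndot (n : ℕ) (u v : Fin n → ℝ) : ℝ := (1 / n : ℝ) * ∑ i, u i * v i

/-- The cavity field `z(x) = √(λ/n) Σ_i x_i Z′_i + λ (x·X) X′`. -/
def zfield (n : ℕ) (lam : ℝ) (ω : CavΩ n) (x : Fin n → ℝ) : ℝ :=
  Real.sqrt (lam / n) * ∑ i : Fin n, x i * ω.2.1 (i.castSucc, Fin.last n)
    + lam * ndot n x (fun i => ω.1 i.castSucc) * ω.1 (Fin.last n)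

/-- The cavity field `s(x) = −(λ/2) (x·x)`. -/
def sfield (n : ℕ) (lam : ℝ) (x : Fin n → ℝ) : ℝ := -(lam / 2) * ndot n x x

/-- `b_i = ⟨x_i⟩_{n,ε}`. -/
def bcoef (P0 : Measure ℝ) (S : Finset ℝ) (n : ℕ) (lam : ℝ) (ω : CavΩ n)
    (i : Fin n) : ℝ :=
  gibbs P0 S n lam ω (fun x => x i)

/-- `Q = (1/n) Σ_i b_i²`. -/
def Qoverlap (P0 : Measure ℝ) (S : Finset ℝ) (n : ℕ) (lam : ℝ) (ω : CavΩ n) : ℝ :=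
  (1 / n : ℝ) * ∑ i : Fin n, (bcoef P0 S n lam ω i) ^ 2

/-- The cavity field
`y(x) = (√λ/(√2 n)) Σ_i Z″_i x_i² + (√λ/n) Σ_{i<j} x_i x_j Z̃_{ij}
  + (λ/2)((x·X)² − (1/2)(x·x)²)`. -/
def yfield (n : ℕ) (lam : ℝ) (ω : CavΩ n) (x : Fin n → ℝ) : ℝ :=
  Real.sqrt lam / (Real.sqrt 2 * n) * ∑ i : Fin n, ω.2.2.2.1 i.castSucc * (x i) ^ 2
    + Real.sqrt lam / n *
        ∑ p ∈ pairs n, x p.1 * x p.2 * ω.2.2.2.2 (p.1.castSucc, p.2.castSucc)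
    + lam / 2 * ((ndot n x (fun i => ω.1 i.castSucc)) ^ 2 - 1 / 2 * (ndot n x x) ^ 2)

/-- The function `x ↦ Σ_{σ∈S} P0(σ) exp(σ̄ z(x) + σ̄² s(x))`. -/
def fzs (P0 : Measure ℝ) (S : Finset ℝ) (n : ℕ) (lam : ℝ) (ω : CavΩ n)
    (x : Fin n → ℝ) : ℝ :=
  ∑ σ ∈ S, (P0 {σ}).toReal *
    Real.exp (sigbar n ω σ * zfield n lam ω x + (sigbar n ω σ) ^ 2 * sfield n lam x)

/-- `U = ⟨Σ_{σ∈S} P0(σ) exp(σ̄ z(x) + σ̄² s(x))⟩_{n,ε}`. -/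
def Ucav (P0 : Measure ℝ) (S : Finset ℝ) (n : ℕ) (lam : ℝ) (ω : CavΩ n) : ℝ :=
  gibbs P0 S n lam ω (fzs P0 S n lam ω)

/-- `V = Σ_{σ∈S} P0(σ) exp(σ̄ √(λ/n) Σ_i b_i Z′_i + λQ X′ σ̄ − (λQ/2) σ̄²)`. -/
def Vcav (P0 : Measure ℝ) (S : Finset ℝ) (n : ℕ) (lam : ℝ) (ω : CavΩ n) : ℝ :=
  ∑ σ ∈ S, (P0 {σ}).toReal *
    Real.exp (sigbar n ω σ * Real.sqrt (lam / n) *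
        (∑ i : Fin n, bcoef P0 S n lam ω i * ω.2.1 (i.castSucc, Fin.last n))
      + lam * Qoverlap P0 S n lam ω * ω.1 (Fin.last n) * sigbar n ω σ
      - lam * Qoverlap P0 S n lam ω / 2 * (sigbar n ω σ) ^ 2)


/-- `A_{n,ε} = E[log⟨Σ_σ P0(σ) exp(σ̄ z(x) + σ̄² s(x))⟩] − E[log⟨exp(y(x))⟩]`. -/
def Acav (P0 : Measure ℝ) [IsProbabilityMeasure P0] (S : Finset ℝ) (n : ℕ)
    (lam ε : ℝ) : ℝ :=
  (∫ ω, Real.log (Ucav P0 S n lam ω) ∂cavMeas P0 n ε)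
    - ∫ ω, Real.log (gibbs P0 S n lam ω (fun x => Real.exp (yfield n lam ω x)))
        ∂cavMeas P0 n ε

/-- The perturbed RS potential
`𝓕_ε(λ,q) = −(λ/4)q² + ε E_{P0}[X²] (λq/2)
  + (1−ε) E[log Σ_{x∈S} P0(x) exp(√(λq) Z x + λq x X − (λ/2) q x²)]`. -/
def Fpert (P0 : Measure ℝ) (S : Finset ℝ) (lam ε q : ℝ) : ℝ :=
  -(lam / 4) * q ^ 2 + ε * (∫ x, x ^ 2 ∂P0) * (lam * q / 2)
    + (1 - ε) * ∫ x0, (∫ z,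
        Real.log (∑ x ∈ S, (P0 {x}).toReal *
          Real.exp (Real.sqrt (lam * q) * z * x + lam * q * x * x0
            - lam / 2 * q * x ^ 2))
      ∂stdGauss) ∂P0

namespace Cavity

section Merge

variable {α β : Type*} [MeasurableSpace α] [MeasurableSpace β]

/-- Combine two maps `α × α → α` and `β × β → β` into one on the product. -/
def prodMerge (f : α × α → α) (g : β × β → β) (p : (α × β) × (α × β)) : α × β :=
  (f (p.1.1, p.2.1), g (p.1.2, p.2.2))

lemma measurePreserving_prodMerge {μ : Measure α} {ν : Measure β} [SFinite μ] [SFinite ν]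
    {f : α × α → α} {g : β × β → β} (hf : MeasurePreserving f (μ.prod μ) μ)
    (hg : MeasurePreserving g (ν.prod ν) ν) :
    MeasurePreserving (prodMerge f g) ((μ.prod ν).prod (μ.prod ν)) (μ.prod ν) := by
  have h1 := measurePreserving_prodAssoc μ ν (μ.prod ν)
  have h2 := (MeasurePreserving.id μ).prod ((measurePreserving_prodAssoc ν μ ν).symm)
  have h3 := (MeasurePreserving.id μ).prod
    ((Measure.measurePreserving_swap (μ := ν) (ν := μ)).prod (MeasurePreserving.id ν))
  have h4 := (MeasurePreserving.id μ).prod (measurePreserving_prodAssoc μ ν ν)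
  have h5 := (measurePreserving_prodAssoc μ μ (ν.prod ν)).symm
  exact (hf.prod hg).comp (h5.comp (h4.comp (h3.comp (h2.comp h1))))

variable {ι : Type*} [Fintype ι]

/-- Take the coordinates in `J` from the second point, the others from the first. -/
def piMerge (J : ι → Prop) [DecidablePred J] (p : (ι → α) × (ι → α)) : ι → α :=
  fun i => if J i then p.2 i else p.1 i

lemma measurePreserving_piMerge (J : ι → Prop) [DecidablePred J] (μ : ι → Measure α)
    [∀ i, IsProbabilityMeasure (μ i)] :
    MeasurePreserving (piMerge J) ((Measure.pi μ).prod (Measure.pi μ)) (Measure.pi μ) := by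
  have hm : Measurable (piMerge (α := α) J) := by
    refine measurable_pi_lambda _ fun i => ?_
    unfold piMerge
    by_cases h : J i <;> simp only [h, if_true, if_false] <;> fun_prop
  refine ⟨hm, (Measure.pi_eq fun s hs => ?_).symm⟩
  rw [Measure.map_apply hm (MeasurableSet.univ_pi hs)]
  have : piMerge J ⁻¹' (Set.univ.pi s)
      = (Set.univ.pi fun i => if J i then Set.univ else s i) ×ˢ
        (Set.univ.pi fun i => if J i then s i else Set.univ) := by
    ext p
    simp only [piMerge, Set.mem_preimage, Set.mem_pi, Set.mem_univ, true_imp_iff, Set.mem_prod,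
      ← forall_and]
    refine forall_congr' fun i => ?_
    by_cases h : J i <;> simp [h]
  rw [this, Measure.prod_prod, Measure.pi_pi, Measure.pi_pi, ← Finset.prod_mul_distrib]
  refine Finset.prod_congr rfl fun i _ => ?_
  by_cases h : J i <;> simp [h]

end Merge

instance : IsProbabilityMeasure stdGauss := by unfold stdGauss; infer_instance

lemma isProbabilityMeasure_bern {ε : ℝ} (h0 : 0 ≤ ε) (h1 : ε ≤ 1) :
    IsProbabilityMeasure (bern ε) := by
  constructor
  rw [bern, Measure.add_apply, Measure.smul_apply, Measure.smul_apply, smul_eq_mul,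
    smul_eq_mul, measure_univ, measure_univ, mul_one, mul_one,
    ← ENNReal.ofReal_add h0 (by linarith)]
  simp

section GaussFam

/-- The family `g` consists of i.i.d. standard Gaussians, expressed through Laplace transforms
of linear combinations. -/
structure IsStdGaussFam {E ι : Type*} [MeasurableSpace E] [Fintype ι] (γ : Measure E)
    (g : ι → E → ℝ) : Prop where
  measurable : ∀ i, Measurable (g i)
  integrable : ∀ t : ι → ℝ, Integrable (fun e => rexp (∑ i, t i * g i e)) γ
  integral : ∀ t : ι → ℝ, ∫ e, rexp (∑ i, t i * g i e) ∂γ = rexp ((∑ i, t i * t i) / 2)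

lemma isStdGaussFam_pi (ι : Type*) [Fintype ι] :
    IsStdGaussFam (Measure.pi fun _ : ι => stdGauss) (fun i x => x i) where
  measurable i := measurable_pi_apply i
  integrable t := by
    simp_rw [Real.exp_sum]
    exact Integrable.fintype_prod (f := fun i x => rexp (t i * x))
      fun i => integrable_exp_mul_gaussianReal (t i)
  integral t := by
    simp_rw [Real.exp_sum]
    rw [integral_fintype_prod_eq_prod (f := fun i x => rexp (t i * x)), Finset.sum_div,
      Real.exp_sum]
    refine Finset.prod_congr rfl fun i _ => ?_
    have := mgf_gaussianReal (p := stdGauss) (X := id) (μ := 0) (v := 1) (by simp [stdGauss]) (t i)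
    simp only [mgf, id] at this
    rw [this]
    congr 1
    simp
    ring

variable {E F ι κ : Type*} [MeasurableSpace E] [MeasurableSpace F] [Fintype ι] [Fintype κ]

lemma IsStdGaussFam.comp {γ : Measure E} {γ' : Measure F} {g : ι → F → ℝ}
    (hg : IsStdGaussFam γ' g) {f : E → F} (hf : MeasurePreserving f γ γ') :
    IsStdGaussFam γ (fun i e => g i (f e)) where
  measurable i := (hg.measurable i).comp hf.measurable
  integrable t := hf.integrable_comp_of_integrable (hg.integrable t)
  integral t := by
    have hm : Measurable fun e => rexp (∑ i, t i * g i e) := by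
      have := hg.measurable
      fun_prop
    rw [← hg.integral t, ← hf.map_eq, integral_map hf.aemeasurable hm.aestronglyMeasurable]

lemma IsStdGaussFam.prod {γ : Measure E} {γ' : Measure F} [SFinite γ] [SFinite γ']
    {g : ι → E → ℝ} {g' : κ → F → ℝ}
    (hg : IsStdGaussFam γ g) (hg' : IsStdGaussFam γ' g') :
    IsStdGaussFam (γ.prod γ')
      (Sum.elim (fun i p => g i p.1) (fun j p => g' j p.2)) where
  measurable i := by
    rcases i with i | j
    · exact (hg.measurable i).comp measurable_fst
    · exact (hg'.measurable j).comp measurable_snd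
  integrable t := by
    simp only [Fintype.sum_sum_type, Sum.elim_inl, Sum.elim_inr, Real.exp_add]
    exact (hg.integrable fun i => t (Sum.inl i)).mul_prod (hg'.integrable fun i => t (Sum.inr i))
  integral t := by
    simp only [Fintype.sum_sum_type, Sum.elim_inl, Sum.elim_inr, Real.exp_add, add_div]
    rw [← hg.integral fun i => t (Sum.inl i), ← hg'.integral fun i => t (Sum.inr i),
      ← integral_prod_mul (fun e => rexp (∑ i, t (Sum.inl i) * g i e))
        (fun e => rexp (∑ i, t (Sum.inr i) * g' i e))]

lemma IsStdGaussFam.map_eq {γ : Measure E} [IsProbabilityMeasure γ] {g : ι → E → ℝ}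
    (hg : IsStdGaussFam γ g) (t : ι → ℝ) :
    γ.map (fun e => ∑ i, t i * g i e) = gaussianReal 0 (∑ i, t i * t i).toNNReal := by
  set X : E → ℝ := fun e => ∑ i, t i * g i e with hX
  have hXm : Measurable X := by
    have := hg.measurable
    fun_prop
  set v := (∑ i, t i * t i).toNNReal with hv
  have hvv : (v : ℝ) = ∑ i, t i * t i :=
    Real.coe_toNNReal _ (Finset.sum_nonneg fun i _ => mul_self_nonneg _)
  have hlin : ∀ (s : ℝ) e, s * X e = ∑ i, (s * t i) * g i e := fun s e => by
    rw [hX, Finset.mul_sum]; simp only [mul_assoc]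
  have hmgf : mgf X γ = mgf id (gaussianReal 0 v) := by
    ext s
    rw [mgf_id_gaussianReal, mgf]
    simp_rw [hlin s]
    rw [hg.integral fun i => s * t i, zero_mul, zero_add, hvv, Finset.sum_mul]
    congr 2
    exact Finset.sum_congr rfl fun i _ => by ring
  have hset : integrableExpSet X γ = Set.univ := by
    ext s
    simp only [integrableExpSet, Set.mem_ofPred_eq, Set.mem_univ, iff_true]
    simp_rw [hlin s]
    exact hg.integrable fun i => s * t i
  have h := eqOn_complexMGF_of_mgf hmgf
  rw [hset] at h
  simp only [interior_univ, Set.mem_univ, Set.ofPred_true, Set.eqOn_univ] at h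
  have := Measure.ext_of_complexMGF_eq hXm.aemeasurable aemeasurable_id h
  simpa using this

end GaussFam

section Compare

lemma abs_exp_sub_exp_le {x y B : ℝ} (hx : x ≤ B) (hy : y ≤ B) :
    |rexp x - rexp y| ≤ rexp B * |x - y| := by
  have key : ∀ {x y : ℝ}, x ≤ B → y ≤ x → rexp x - rexp y ≤ rexp B * (x - y) := by
    intro x y hx hyx
    have h1 : rexp x - rexp y = rexp x * (1 - rexp (y - x)) := by
      rw [mul_sub, ← Real.exp_add]; ring_nf
    have h2 := Real.add_one_le_exp (y - x)
    rw [h1]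
    exact mul_le_mul (Real.exp_le_exp.2 hx) (by linarith)
      (by linarith [Real.exp_le_one_iff.2 (by linarith : y - x ≤ 0)]) (Real.exp_pos _).le
  rcases le_total y x with h | h
  · rw [abs_of_nonneg (sub_nonneg.2 (Real.exp_le_exp.2 h)), abs_of_nonneg (sub_nonneg.2 h)]
    exact key hx h
  · rw [abs_sub_comm, abs_sub_comm x, abs_of_nonneg (sub_nonneg.2 (Real.exp_le_exp.2 h)),
      abs_of_nonneg (sub_nonneg.2 h)]
    exact key hy h

lemma abs_log_sub_log_le {U V δ : ℝ} (hU : 0 < U) (hV : 0 < V) (hδ : 0 < δ) :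
    |Real.log U - Real.log V| ≤ (U - V) ^ 2 / (2 * δ) + δ * ((U ^ 2)⁻¹ + (V ^ 2)⁻¹) := by
  have key : ∀ {U V : ℝ}, 0 < U → 0 < V →
      Real.log U - Real.log V ≤ |U - V| * (U⁻¹ + V⁻¹) := by
    intro U V hU hV
    rw [← Real.log_div hU.ne' hV.ne']
    calc Real.log (U / V) ≤ U / V - 1 := Real.log_le_sub_one_of_pos (by positivity)
      _ = (U - V) * V⁻¹ := by field_simp
      _ ≤ |U - V| * V⁻¹ := by gcongr; exact le_abs_self _
      _ ≤ |U - V| * (U⁻¹ + V⁻¹) := by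
        gcongr
        have : 0 < U⁻¹ := by positivity
        linarith
  have h1 : |Real.log U - Real.log V| ≤ |U - V| * (U⁻¹ + V⁻¹) := by
    refine abs_le.2 ⟨?_, key hU hV⟩
    have := key hV hU
    rw [abs_sub_comm, add_comm] at this
    linarith
  refine h1.trans ?_
  have e1 : (U ^ 2)⁻¹ = U⁻¹ ^ 2 := by rw [inv_pow]
  have e2 : (V ^ 2)⁻¹ = V⁻¹ ^ 2 := by rw [inv_pow]
  rw [e1, e2]
  set a := U⁻¹
  set b := V⁻¹
  have e3 : (U - V) ^ 2 = |U - V| ^ 2 := (sq_abs _).symm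
  rw [e3]
  set d := |U - V|
  have h3 : d ^ 2 / (2 * δ) + δ * (a ^ 2 + b ^ 2) - d * (a + b)
      = (d - δ * (a + b)) ^ 2 / (2 * δ) + δ / 2 * (a - b) ^ 2 := by
    field_simp
    ring
  have h4 : 0 ≤ (d - δ * (a + b)) ^ 2 / (2 * δ) + δ / 2 * (a - b) ^ 2 := by positivity
  linarith

lemma abs_log_le {V : ℝ} (hV : 0 < V) : |Real.log V| ≤ V ^ 2 + (V ^ 2)⁻¹ := by
  have h1 := Real.log_le_sub_one_of_pos (pow_pos hV 2)
  have h2 := Real.log_le_sub_one_of_pos (inv_pos.2 (pow_pos hV 2))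
  rw [Real.log_inv] at h2
  rw [Real.log_pow] at h1 h2
  push_cast at h1 h2
  have : 0 < V ^ 2 := by positivity
  have : 0 < (V ^ 2)⁻¹ := by positivity
  rw [abs_le]
  constructor <;> nlinarith

lemma sum_sq_le_of_weights {α : Type*} {A : Finset α} {w f : α → ℝ} (hw : ∀ a ∈ A, 0 ≤ w a)
    (hw1 : ∑ a ∈ A, w a = 1) : (∑ a ∈ A, w a * f a) ^ 2 ≤ ∑ a ∈ A, w a * f a ^ 2 := by
  have := (Even.convexOn_pow (n := 2) even_two (𝕜 := ℝ)).map_sum_le hw hw1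
    (p := f) (fun _ _ => Set.mem_univ _)
  simpa using this

lemma inv_sum_sq_le_of_weights {α : Type*} {A : Finset α} {w f : α → ℝ}
    (hw : ∀ a ∈ A, 0 ≤ w a) (hw1 : ∑ a ∈ A, w a = 1) (hf : ∀ a ∈ A, 0 < f a) :
    ((∑ a ∈ A, w a * f a) ^ 2)⁻¹ ≤ ∑ a ∈ A, w a * (f a ^ 2)⁻¹ := by
  have := (convexOn_zpow (𝕜 := ℝ) (-2)).map_sum_le hw hw1 (p := f) hf
  simpa [zpow_neg] using this

lemma sum_pos_of_weights {α : Type*} {A : Finset α} {w f : α → ℝ}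
    (hw : ∀ a ∈ A, 0 ≤ w a) (hw1 : ∑ a ∈ A, w a = 1) (hf : ∀ a ∈ A, 0 < f a) :
    0 < ∑ a ∈ A, w a * f a := by
  obtain ⟨a, ha, hpos⟩ : ∃ a ∈ A, 0 < w a := by
    by_contra! h
    have := Finset.sum_nonpos h
    linarith
  exact Finset.sum_pos' (fun b hb => mul_nonneg (hw b hb) (hf b hb).le)
    ⟨a, ha, mul_pos hpos (hf a ha)⟩

variable {E ι α κ : Type*} [Fintype ι]

/-- The Euclidean inner product on `ι → ℝ`. -/
def dotp (s t : ι → ℝ) : ℝ := ∑ i, s i * t i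

lemma dotp_le {s t : ι → ℝ} {M : ℝ} (hs : dotp s s ≤ M) (ht : dotp t t ≤ M) :
    dotp s t ≤ M := by
  have : 2 * dotp s t ≤ dotp s s + dotp t t := by
    simp only [dotp, Finset.mul_sum, ← Finset.sum_add_distrib]
    exact Finset.sum_le_sum fun i _ => by nlinarith [sq_nonneg (s i - t i)]
  linarith

/-- The normalised Gaussian exponential with linear functional `t` and offset `h`. -/
def gexp (g : ι → E → ℝ) (t : ι → ℝ) (h : ℝ) (e : E) : ℝ :=
  rexp (∑ i, t i * g i e - dotp t t / 2 + h)

lemma gexp_pos (g : ι → E → ℝ) (t : ι → ℝ) (h : ℝ) (e : E) : 0 < gexp g t h e := Real.exp_pos _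

variable {g : ι → E → ℝ}

lemma gexp_mul (s t : ι → ℝ) (h k : ℝ) (e : E) :
    gexp g s h e * gexp g t k e
      = rexp (∑ i, (s + t) i * g i e + (h + k - dotp s s / 2 - dotp t t / 2)) := by
  rw [gexp, gexp, ← Real.exp_add]
  simp only [Pi.add_apply, add_mul, Finset.sum_add_distrib]
  congr 1
  ring

lemma dotp_add_self (s t : ι → ℝ) :
    dotp (s + t) (s + t) = dotp s s + 2 * dotp s t + dotp t t := by
  simp only [dotp, Pi.add_apply, Finset.mul_sum, ← Finset.sum_add_distrib]
  exact Finset.sum_congr rfl fun i _ => by ring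

lemma gexp_inv_sq (t : ι → ℝ) (h : ℝ) (e : E) :
    (gexp g t h e ^ 2)⁻¹ = rexp (∑ i, ((-2 : ℝ) • t) i * g i e + (dotp t t - 2 * h)) := by
  rw [gexp, ← Real.exp_nat_mul, ← Real.exp_neg]
  simp only [Pi.smul_apply, smul_eq_mul, mul_assoc, ← Finset.mul_sum]
  congr 1
  push_cast
  ring

lemma dotp_smul_self (c : ℝ) (t : ι → ℝ) : dotp (c • t) (c • t) = c ^ 2 * dotp t t := by
  simp only [dotp, Pi.smul_apply, smul_eq_mul, Finset.mul_sum]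
  exact Finset.sum_congr rfl fun i _ => by ring

variable [MeasurableSpace E] {γ : Measure E}

lemma IsStdGaussFam.integrable_exp_add (hg : IsStdGaussFam γ g) (t : ι → ℝ) (c : ℝ) :
    Integrable (fun e => rexp (∑ i, t i * g i e + c)) γ := by
  simp_rw [Real.exp_add]
  exact (hg.integrable t).mul_const _

lemma IsStdGaussFam.integral_exp_add (hg : IsStdGaussFam γ g) (t : ι → ℝ) (c : ℝ) :
    ∫ e, rexp (∑ i, t i * g i e + c) ∂γ = rexp (dotp t t / 2 + c) := by
  simp_rw [Real.exp_add]
  rw [integral_mul_const, hg.integral t, dotp]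

lemma IsStdGaussFam.integrable_gexp_mul (hg : IsStdGaussFam γ g) (s t : ι → ℝ) (h k : ℝ) :
    Integrable (fun e => gexp g s h e * gexp g t k e) γ := by
  simp_rw [gexp_mul]
  exact hg.integrable_exp_add _ _

lemma IsStdGaussFam.integral_gexp_mul (hg : IsStdGaussFam γ g) (s t : ι → ℝ) (h k : ℝ) :
    ∫ e, gexp g s h e * gexp g t k e ∂γ = rexp (dotp s t + h + k) := by
  simp_rw [gexp_mul]
  rw [hg.integral_exp_add, dotp_add_self]
  congr 1
  ring

lemma IsStdGaussFam.integrable_gexp_inv_sq (hg : IsStdGaussFam γ g) (t : ι → ℝ) (h : ℝ) :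
    Integrable (fun e => (gexp g t h e ^ 2)⁻¹) γ := by
  simp_rw [gexp_inv_sq]
  exact hg.integrable_exp_add _ _

lemma IsStdGaussFam.integral_gexp_inv_sq (hg : IsStdGaussFam γ g) (t : ι → ℝ) (h : ℝ) :
    ∫ e, (gexp g t h e ^ 2)⁻¹ ∂γ = rexp (3 * dotp t t - 2 * h) := by
  simp_rw [gexp_inv_sq]
  rw [hg.integral_exp_add, dotp_smul_self]
  congr 1
  ring

lemma IsStdGaussFam.measurable_gexp (hg : IsStdGaussFam γ g) (t : ι → ℝ) (h : ℝ) :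
    Measurable (gexp g t h) := by
  have := hg.measurable
  unfold gexp
  fun_prop

lemma IsStdGaussFam.moments_mixture (hg : IsStdGaussFam γ g) {A : Finset α} {w : α → ℝ}
    (hw : ∀ a ∈ A, 0 ≤ w a) (hw1 : ∑ a ∈ A, w a = 1) {t : α → ι → ℝ} {h : α → ℝ} {M : ℝ}
    (ht : ∀ a ∈ A, dotp (t a) (t a) ≤ M) (hh : ∀ a ∈ A, |h a| ≤ M) :
    (Integrable (fun e => (∑ a ∈ A, w a * gexp g (t a) (h a) e) ^ 2) γ ∧
      ∫ e, (∑ a ∈ A, w a * gexp g (t a) (h a) e) ^ 2 ∂γ ≤ rexp (3 * M)) ∧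
    (Integrable (fun e => ((∑ a ∈ A, w a * gexp g (t a) (h a) e) ^ 2)⁻¹) γ ∧
      ∫ e, ((∑ a ∈ A, w a * gexp g (t a) (h a) e) ^ 2)⁻¹ ∂γ ≤ rexp (5 * M)) := by
  have hm : Measurable fun e => ∑ a ∈ A, w a * gexp g (t a) (h a) e :=
    Finset.measurable_fun_sum _ fun a _ => (hg.measurable_gexp (t a) (h a)).const_mul _
  have avg : ∀ {x : α → ℝ} {B : ℝ}, (∀ a ∈ A, x a ≤ B) → ∑ a ∈ A, w a * x a ≤ B := by
    intro x B hx
    calc ∑ a ∈ A, w a * x a ≤ ∑ a ∈ A, w a * B :=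
          Finset.sum_le_sum fun a ha => mul_le_mul_of_nonneg_left (hx a ha) (hw a ha)
      _ = B := by rw [← Finset.sum_mul, hw1, one_mul]
  constructor
  · have hi : Integrable (fun e => ∑ a ∈ A, w a * gexp g (t a) (h a) e ^ 2) γ := by
      refine integrable_finsetSum _ fun a _ => Integrable.const_mul ?_ _
      simp_rw [pow_two]
      exact hg.integrable_gexp_mul _ _ _ _
    have hle : ∀ e, (∑ a ∈ A, w a * gexp g (t a) (h a) e) ^ 2
        ≤ ∑ a ∈ A, w a * gexp g (t a) (h a) e ^ 2 := fun e => sum_sq_le_of_weights hw hw1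
    have hi' : Integrable (fun e => (∑ a ∈ A, w a * gexp g (t a) (h a) e) ^ 2) γ := by
      refine hi.mono' (hm.pow_const 2).aestronglyMeasurable (ae_of_all _ fun e => ?_)
      rw [Real.norm_of_nonneg (sq_nonneg _)]
      exact hle e
    refine ⟨hi', (integral_mono hi' hi hle).trans ?_⟩
    rw [integral_finsetSum]
    · simp_rw [integral_const_mul]
      refine avg fun a ha => ?_
      simp_rw [pow_two]
      rw [hg.integral_gexp_mul]
      refine Real.exp_le_exp.2 ?_
      have := ht a ha
      have := (abs_le.1 (hh a ha)).2
      linarith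
    · intro a _
      refine Integrable.const_mul ?_ _
      simp_rw [pow_two]
      exact hg.integrable_gexp_mul _ _ _ _
  · have hi : Integrable (fun e => ∑ a ∈ A, w a * (gexp g (t a) (h a) e ^ 2)⁻¹) γ :=
      integrable_finsetSum _ fun a _ => (hg.integrable_gexp_inv_sq _ _).const_mul _
    have hle : ∀ e, ((∑ a ∈ A, w a * gexp g (t a) (h a) e) ^ 2)⁻¹
        ≤ ∑ a ∈ A, w a * (gexp g (t a) (h a) e ^ 2)⁻¹ :=
      fun e => inv_sum_sq_le_of_weights hw hw1 fun a _ => gexp_pos _ _ _ _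
    have hi' : Integrable (fun e => ((∑ a ∈ A, w a * gexp g (t a) (h a) e) ^ 2)⁻¹) γ := by
      refine hi.mono' (hm.pow_const 2).inv.aestronglyMeasurable (ae_of_all _ fun e => ?_)
      rw [Real.norm_of_nonneg (by positivity)]
      exact hle e
    refine ⟨hi', (integral_mono hi' hi hle).trans ?_⟩
    rw [integral_finsetSum]
    · simp_rw [integral_const_mul]
      refine avg fun a ha => ?_
      rw [hg.integral_gexp_inv_sq]
      refine Real.exp_le_exp.2 ?_
      have := ht a ha
      have := (abs_le.1 (hh a ha)).1
      linarith
    · exact fun a _ => (hg.integrable_gexp_inv_sq _ _).const_mul _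

/-- Distance between the Gaussian exponents indexed by `a, a'` and the one given by `u, h₀`. -/
def gdist (v : α → ι → ℝ) (h : α → ℝ) (u : ι → ℝ) (h₀ : ℝ) (a a' : α) : ℝ :=
  |dotp (v a) (v a') - dotp u u| + |dotp (v a) u - dotp u u| + |dotp (v a') u - dotp u u|
    + 2 * |h a - h₀| + 2 * |h a' - h₀|

lemma IsStdGaussFam.integral_sq_sub_le (hg : IsStdGaussFam γ g) {A : Finset α} {w : α → ℝ}
    (hw : ∀ a ∈ A, 0 ≤ w a) (hw1 : ∑ a ∈ A, w a = 1) {v : α → ι → ℝ} {h : α → ℝ}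
    {u : ι → ℝ} {h₀ M : ℝ} (hv : ∀ a ∈ A, dotp (v a) (v a) ≤ M) (hh : ∀ a ∈ A, |h a| ≤ M)
    (hu : dotp u u ≤ M) (hh₀ : |h₀| ≤ M) :
    Integrable (fun e => (∑ a ∈ A, w a * gexp g (v a) (h a) e - gexp g u h₀ e) ^ 2) γ ∧
    ∫ e, (∑ a ∈ A, w a * gexp g (v a) (h a) e - gexp g u h₀ e) ^ 2 ∂γ
      ≤ rexp (3 * M) * ∑ a ∈ A, ∑ a' ∈ A, w a * w a' * gdist v h u h₀ a a' := by
  have hexp : ∀ e, (∑ a ∈ A, w a * gexp g (v a) (h a) e - gexp g u h₀ e) ^ 2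
      = ∑ a ∈ A, ∑ a' ∈ A, w a * w a' * (gexp g (v a) (h a) e * gexp g (v a') (h a') e
        - gexp g (v a) (h a) e * gexp g u h₀ e - gexp g (v a') (h a') e * gexp g u h₀ e
        + gexp g u h₀ e * gexp g u h₀ e) := by
    intro e
    have h1 : ∑ a ∈ A, w a * gexp g (v a) (h a) e - gexp g u h₀ e
        = ∑ a ∈ A, w a * (gexp g (v a) (h a) e - gexp g u h₀ e) := by
      simp only [mul_sub, Finset.sum_sub_distrib, ← Finset.sum_mul, hw1, one_mul]
    rw [h1, pow_two, Finset.sum_mul_sum]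
    exact Finset.sum_congr rfl fun a _ => Finset.sum_congr rfl fun a' _ => by ring
  simp_rw [hexp]
  have hi : ∀ a a', Integrable (fun e => w a * w a' *
      (gexp g (v a) (h a) e * gexp g (v a') (h a') e
        - gexp g (v a) (h a) e * gexp g u h₀ e - gexp g (v a') (h a') e * gexp g u h₀ e
        + gexp g u h₀ e * gexp g u h₀ e)) γ := fun a a' =>
    ((((hg.integrable_gexp_mul _ _ _ _).sub (hg.integrable_gexp_mul _ _ _ _)).sub
      (hg.integrable_gexp_mul _ _ _ _)).add (hg.integrable_gexp_mul _ _ _ _)).const_mul _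
  refine ⟨integrable_finsetSum _ fun a _ => integrable_finsetSum _ fun a' _ => hi a a', ?_⟩
  rw [integral_finsetSum _ fun a _ => integrable_finsetSum _ fun a' _ => hi a a',
    Finset.mul_sum]
  refine Finset.sum_le_sum fun a ha => ?_
  rw [integral_finsetSum _ fun a' _ => hi a a', Finset.mul_sum]
  refine Finset.sum_le_sum fun a' ha' => ?_
  rw [integral_const_mul, integral_add, integral_sub, integral_sub, hg.integral_gexp_mul,
    hg.integral_gexp_mul, hg.integral_gexp_mul, hg.integral_gexp_mul, mul_left_comm]
  rotate_left
  · exact hg.integrable_gexp_mul _ _ _ _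
  · exact hg.integrable_gexp_mul _ _ _ _
  · exact (hg.integrable_gexp_mul _ _ _ _).sub (hg.integrable_gexp_mul _ _ _ _)
  · exact hg.integrable_gexp_mul _ _ _ _
  · exact ((hg.integrable_gexp_mul _ _ _ _).sub (hg.integrable_gexp_mul _ _ _ _)).sub
      (hg.integrable_gexp_mul _ _ _ _)
  · exact hg.integrable_gexp_mul _ _ _ _
  refine mul_le_mul_of_nonneg_left ?_ (mul_nonneg (hw a ha) (hw a' ha'))
  have b1 := (abs_le.1 (hh a ha)).2
  have b2 := (abs_le.1 (hh a' ha')).2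
  have b3 := (abs_le.1 hh₀).2
  have d1 := dotp_le (hv a ha) (hv a' ha')
  have d2 := dotp_le (hv a ha) hu
  have d3 := dotp_le (hv a' ha') hu
  have e1 := abs_exp_sub_exp_le (x := dotp (v a) (v a') + h a + h a')
    (y := dotp u u + h₀ + h₀) (B := 3 * M) (by linarith) (by linarith)
  have e2 := abs_exp_sub_exp_le (x := dotp (v a) u + h a + h₀)
    (y := dotp u u + h₀ + h₀) (B := 3 * M) (by linarith) (by linarith)
  have e3 := abs_exp_sub_exp_le (x := dotp (v a') u + h a' + h₀)
    (y := dotp u u + h₀ + h₀) (B := 3 * M) (by linarith) (by linarith)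
  have t1 : |dotp (v a) (v a') + h a + h a' - (dotp u u + h₀ + h₀)|
      ≤ |dotp (v a) (v a') - dotp u u| + |h a - h₀| + |h a' - h₀| := by
    refine le_trans (le_of_eq ?_) (abs_add_three _ _ _)
    congr 1; ring
  have t2 : |dotp (v a) u + h a + h₀ - (dotp u u + h₀ + h₀)|
      ≤ |dotp (v a) u - dotp u u| + |h a - h₀| := by
    refine le_trans (le_of_eq ?_) (abs_add_le _ _)
    congr 1; ring
  have t3 : |dotp (v a') u + h a' + h₀ - (dotp u u + h₀ + h₀)|
      ≤ |dotp (v a') u - dotp u u| + |h a' - h₀| := by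
    refine le_trans (le_of_eq ?_) (abs_add_le _ _)
    congr 1; ring
  have l1 := (le_abs_self _).trans (e1.trans (mul_le_mul_of_nonneg_left t1 (Real.exp_pos _).le))
  have l2 := (neg_abs_le _).trans' (neg_le_neg
    (e2.trans (mul_le_mul_of_nonneg_left t2 (Real.exp_pos _).le)))
  have l3 := (neg_abs_le _).trans' (neg_le_neg
    (e3.trans (mul_le_mul_of_nonneg_left t3 (Real.exp_pos _).le)))
  simp only [gdist]
  nlinarith

lemma IsStdGaussFam.log_compare (hg : IsStdGaussFam γ g)
    {C : Finset κ} {p : κ → ℝ} (hp : ∀ c ∈ C, 0 ≤ p c) (hp1 : ∑ c ∈ C, p c = 1)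
    {A : Finset α} {w : α → ℝ} (hw : ∀ a ∈ A, 0 ≤ w a) (hw1 : ∑ a ∈ A, w a = 1)
    {v : κ → α → ι → ℝ} {h : κ → α → ℝ} {u : κ → ι → ℝ} {h₀ : κ → ℝ} {M : ℝ}
    (hv : ∀ c ∈ C, ∀ a ∈ A, dotp (v c a) (v c a) ≤ M) (hh : ∀ c ∈ C, ∀ a ∈ A, |h c a| ≤ M)
    (hu : ∀ c ∈ C, dotp (u c) (u c) ≤ M) (hh₀ : ∀ c ∈ C, |h₀ c| ≤ M) {U V : E → ℝ}
    (hU : ∀ e, U e = ∑ c ∈ C, p c * ∑ a ∈ A, w a * gexp g (v c a) (h c a) e)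
    (hV : ∀ e, V e = ∑ c ∈ C, p c * gexp g (u c) (h₀ c) e) :
    (Integrable (fun e => |Real.log (U e)|) γ ∧
      ∫ e, |Real.log (U e)| ∂γ ≤ rexp (3 * M) + rexp (5 * M)) ∧
    (Integrable (fun e => |Real.log (V e)|) γ ∧
      ∫ e, |Real.log (V e)| ∂γ ≤ rexp (3 * M) + rexp (5 * M)) ∧
    ∀ D : ℝ, (∀ c ∈ C, ∑ a ∈ A, ∑ a' ∈ A, w a * w a' * gdist (v c) (h c) (u c) (h₀ c) a a' ≤ D) →
      ∀ δ : ℝ, 0 < δ → ∫ e, |Real.log (U e) - Real.log (V e)| ∂γ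
        ≤ rexp (3 * M) * D / (2 * δ) + 2 * δ * rexp (5 * M) := by
  have hU' : ∀ e, U e = ∑ x ∈ C ×ˢ A, p x.1 * w x.2 * gexp g (v x.1 x.2) (h x.1 x.2) e := by
    intro e
    rw [hU, Finset.sum_product]
    refine Finset.sum_congr rfl fun c _ => ?_
    rw [Finset.mul_sum]
    exact Finset.sum_congr rfl fun a _ => by ring
  have hpw : ∀ x ∈ C ×ˢ A, 0 ≤ p x.1 * w x.2 := fun x hx =>
    mul_nonneg (hp _ (Finset.mem_product.1 hx).1) (hw _ (Finset.mem_product.1 hx).2)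
  have hpw1 : ∑ x ∈ C ×ˢ A, p x.1 * w x.2 = 1 := by
    rw [Finset.sum_product]
    simp only [← Finset.mul_sum, hw1, mul_one, hp1]
  have hUpos : ∀ e, 0 < U e := fun e => by
    rw [hU']; exact sum_pos_of_weights hpw hpw1 fun _ _ => gexp_pos _ _ _ _
  have hVpos : ∀ e, 0 < V e := fun e => by
    rw [hV]; exact sum_pos_of_weights hp hp1 fun _ _ => gexp_pos _ _ _ _
  have hUm : Measurable U := by
    rw [funext hU']
    exact Finset.measurable_fun_sum _ fun a _ => (hg.measurable_gexp _ _).const_mul _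
  have hVm : Measurable V := by
    rw [funext hV]
    exact Finset.measurable_fun_sum _ fun a _ => (hg.measurable_gexp _ _).const_mul _
  obtain ⟨⟨iU, bU⟩, iU', bU'⟩ := hg.moments_mixture hpw hpw1 (M := M)
    (t := fun x => v x.1 x.2) (h := fun x => h x.1 x.2)
    (fun x hx => hv _ (Finset.mem_product.1 hx).1 _ (Finset.mem_product.1 hx).2)
    (fun x hx => hh _ (Finset.mem_product.1 hx).1 _ (Finset.mem_product.1 hx).2)
  simp_rw [← hU'] at iU bU iU' bU'
  obtain ⟨⟨iV, bV⟩, iV', bV'⟩ := hg.moments_mixture hp hp1 (M := M) hu hh₀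
  simp_rw [← hV] at iV bV iV' bV'
  have iLU : Integrable (fun e => |Real.log (U e)|) γ :=
    (iU.add iU').mono' hUm.log.abs.aestronglyMeasurable
      (ae_of_all _ fun e => by
        rw [Real.norm_of_nonneg (abs_nonneg _)]; exact abs_log_le (hUpos e))
  have iLV : Integrable (fun e => |Real.log (V e)|) γ :=
    (iV.add iV').mono' hVm.log.abs.aestronglyMeasurable
      (ae_of_all _ fun e => by
        rw [Real.norm_of_nonneg (abs_nonneg _)]; exact abs_log_le (hVpos e))
  refine ⟨⟨iLU, ?_⟩, ⟨iLV, ?_⟩, fun D hD δ hδ => ?_⟩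
  · refine (integral_mono iLU (iU.add iU') fun e => abs_log_le (hUpos e)).trans ?_
    simp only [Pi.add_apply]
    rw [integral_add iU iU']
    exact add_le_add bU bU'
  · refine (integral_mono iLV (iV.add iV') fun e => abs_log_le (hVpos e)).trans ?_
    simp only [Pi.add_apply]
    rw [integral_add iV iV']
    exact add_le_add bV bV'
  have hsq : ∀ e, (U e - V e) ^ 2
      ≤ ∑ c ∈ C, p c * (∑ a ∈ A, w a * gexp g (v c a) (h c a) e - gexp g (u c) (h₀ c) e) ^ 2 := by
    intro e
    have : U e - V e
        = ∑ c ∈ C, p c * (∑ a ∈ A, w a * gexp g (v c a) (h c a) e - gexp g (u c) (h₀ c) e) := by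
      simp only [mul_sub, Finset.sum_sub_distrib, hU, hV]
    rw [this]
    exact sum_sq_le_of_weights hp hp1
  have hc := fun c (hc : c ∈ C) =>
    hg.integral_sq_sub_le hw hw1 (hv c hc) (hh c hc) (hu c hc) (hh₀ c hc)
  have iS : Integrable (fun e => ∑ c ∈ C, p c *
      (∑ a ∈ A, w a * gexp g (v c a) (h c a) e - gexp g (u c) (h₀ c) e) ^ 2) γ :=
    integrable_finsetSum _ fun c h => (hc c h).1.const_mul _
  have bS : ∫ e, ∑ c ∈ C, p c *
      (∑ a ∈ A, w a * gexp g (v c a) (h c a) e - gexp g (u c) (h₀ c) e) ^ 2 ∂γ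
      ≤ rexp (3 * M) * D := by
    rw [integral_finsetSum _ fun c h => (hc c h).1.const_mul _]
    calc _ ≤ ∑ c ∈ C, p c * (rexp (3 * M) * D) := by
          refine Finset.sum_le_sum fun c h => ?_
          rw [integral_const_mul]
          exact mul_le_mul_of_nonneg_left ((hc c h).2.trans
            (mul_le_mul_of_nonneg_left (hD c h) (Real.exp_pos _).le)) (hp c h)
      _ = rexp (3 * M) * D := by rw [← Finset.sum_mul, hp1, one_mul]
  have iI : Integrable (fun e => (U e ^ 2)⁻¹ + (V e ^ 2)⁻¹) γ := iU'.add iV'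
  have iR : Integrable (fun e => (∑ c ∈ C, p c *
      (∑ a ∈ A, w a * gexp g (v c a) (h c a) e - gexp g (u c) (h₀ c) e) ^ 2) / (2 * δ)
      + δ * ((U e ^ 2)⁻¹ + (V e ^ 2)⁻¹)) γ := (iS.div_const _).add (iI.const_mul _)
  calc ∫ e, |Real.log (U e) - Real.log (V e)| ∂γ
      ≤ ∫ e, ((∑ c ∈ C, p c *
      (∑ a ∈ A, w a * gexp g (v c a) (h c a) e - gexp g (u c) (h₀ c) e) ^ 2) / (2 * δ)
      + δ * ((U e ^ 2)⁻¹ + (V e ^ 2)⁻¹)) ∂γ := by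
        refine integral_mono_of_nonneg (ae_of_all _ fun _ => abs_nonneg _) iR
          (ae_of_all _ fun e => (abs_log_sub_log_le (hUpos e) (hVpos e) hδ).trans ?_)
        dsimp only
        gcongr
        exact hsq e
    _ ≤ rexp (3 * M) * D / (2 * δ) + 2 * δ * rexp (5 * M) := by
        rw [integral_add (iS.div_const _) (iI.const_mul _), integral_div,
          integral_const_mul, integral_add iU' iV']
        have : δ * (∫ e, (U e ^ 2)⁻¹ ∂γ + ∫ e, (V e ^ 2)⁻¹ ∂γ)
            ≤ δ * (rexp (5 * M) + rexp (5 * M)) := by gcongr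
        have h2 : (∫ e, ∑ c ∈ C, p c *
          (∑ a ∈ A, w a * gexp g (v c a) (h c a) e - gexp g (u c) (h₀ c) e) ^ 2 ∂γ) / (2 * δ)
          ≤ rexp (3 * M) * D / (2 * δ) := by gcongr
        linarith

end Compare

section Laws

/-- The law of the auxiliary Gaussians `(Z″, Z̃)`. -/
def auxMeas (n : ℕ) : Measure ((Fin (n + 1) → ℝ) × ((Fin (n + 1) × Fin (n + 1)) → ℝ)) :=
  (Measure.pi fun _ : Fin (n + 1) => stdGauss).prod
    (Measure.pi fun _ : Fin (n + 1) × Fin (n + 1) => stdGauss)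

/-- The law of `(L, Z″, Z̃)`. -/
def labelMeas (n : ℕ) (ε : ℝ) : Measure ((Fin (n + 1) → Bool) × (Fin (n + 1) → ℝ) ×
    ((Fin (n + 1) × Fin (n + 1)) → ℝ)) :=
  (Measure.pi fun _ : Fin (n + 1) => bern ε).prod (auxMeas n)

/-- The law of `(Z, L, Z″, Z̃)`. -/
def noiseMeas (n : ℕ) (ε : ℝ) : Measure (((Fin (n + 1) × Fin (n + 1)) → ℝ) ×
    (Fin (n + 1) → Bool) × (Fin (n + 1) → ℝ) × ((Fin (n + 1) × Fin (n + 1)) → ℝ)) :=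
  (Measure.pi fun _ : Fin (n + 1) × Fin (n + 1) => stdGauss).prod (labelMeas n ε)

instance (n : ℕ) : IsProbabilityMeasure (auxMeas n) := by
  unfold auxMeas; infer_instance

instance (n : ℕ) (ε : ℝ) [IsProbabilityMeasure (bern ε)] :
    IsProbabilityMeasure (labelMeas n ε) := by
  unfold labelMeas; infer_instance

instance (n : ℕ) (ε : ℝ) [IsProbabilityMeasure (bern ε)] :
    IsProbabilityMeasure (noiseMeas n ε) := by
  unfold noiseMeas; infer_instance

lemma cavMeas_eq_prod (P0 : Measure ℝ) [IsProbabilityMeasure P0] (n : ℕ) (ε : ℝ) :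
    cavMeas P0 n ε = (Measure.pi fun _ : Fin (n + 1) => P0).prod (noiseMeas n ε) := rfl

instance (P0 : Measure ℝ) [IsProbabilityMeasure P0] (n : ℕ) (ε : ℝ)
    [IsProbabilityMeasure (bern ε)] : IsProbabilityMeasure (cavMeas P0 n ε) := by
  rw [cavMeas_eq_prod]; infer_instance

end Laws

section GibbsWeights

variable {P0 : Measure ℝ} {S : Finset ℝ} {n : ℕ} {lam : ℝ}

lemma weight_nonneg (m : ℕ) (x : Fin m → ℝ) : 0 ≤ weight P0 m x :=
  Finset.prod_nonneg fun _ _ => ENNReal.toReal_nonneg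

lemma mem_confs {m : ℕ} {x : Fin m → ℝ} : x ∈ confs S m ↔ ∀ i, x i ∈ S := Fintype.mem_piFinset

variable (P0 S n lam) in
/-- The partition function of the Gibbs average. -/
def gpart (ω : CavΩ n) : ℝ :=
  ∑ x ∈ confs S n, weight P0 n x * Real.exp (Hcav n lam ω (xbar n ω x))

variable (P0 S n lam) in
/-- The Gibbs weight of a configuration. -/
def gweight (ω : CavΩ n) (x : Fin n → ℝ) : ℝ :=
  weight P0 n x * Real.exp (Hcav n lam ω (xbar n ω x)) / gpart P0 S n lam ω

lemma gibbs_eq_sum (ω : CavΩ n) (f : (Fin n → ℝ) → ℝ) :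
    gibbs P0 S n lam ω f = ∑ x ∈ confs S n, gweight P0 S n lam ω x * f (xbar n ω x) := by
  unfold gibbs gweight gpart
  rw [Finset.sum_div]
  exact Finset.sum_congr rfl fun x _ => by ring

lemma xbar_mem {ω : CavΩ n} (hω : ω.1 ∈ confs S (n + 1)) {x : Fin n → ℝ} (hx : x ∈ confs S n) :
    xbar n ω x ∈ confs S n := by
  rw [mem_confs] at *
  intro i
  unfold xbar
  split_ifs
  · exact hω _
  · exact hx _

lemma measurable_xbar_apply (x : Fin n → ℝ) (i : Fin n) :
    Measurable fun ω : CavΩ n => xbar n ω x i := by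
  unfold xbar
  have : Measurable fun ω : CavΩ n => ω.2.2.1 i.castSucc := by fun_prop
  exact Measurable.ite (this (measurableSet_singleton true)) (by fun_prop) measurable_const

lemma measurable_xbar (x : Fin n → ℝ) : Measurable fun ω : CavΩ n => xbar n ω x :=
  measurable_pi_lambda _ fun i => measurable_xbar_apply x i

lemma measurable_Hcav_xbar (x : Fin n → ℝ) :
    Measurable fun ω : CavΩ n => Hcav n lam ω (xbar n ω x) := by
  have := fun i => measurable_xbar_apply x i
  unfold Hcav
  fun_prop

lemma measurable_gweight (x : Fin n → ℝ) : Measurable fun ω : CavΩ n => gweight P0 S n lam ω x := by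
  have := fun x => measurable_Hcav_xbar (n := n) (lam := lam) x
  unfold gweight gpart
  fun_prop

lemma measurable_gibbs {f : CavΩ n → (Fin n → ℝ) → ℝ}
    (hf : ∀ x, Measurable fun ω => f ω (xbar n ω x)) :
    Measurable fun ω : CavΩ n => gibbs P0 S n lam ω (f ω) := by
  have := fun x => measurable_gweight (P0 := P0) (S := S) (n := n) (lam := lam) x
  simp_rw [gibbs_eq_sum]
  exact Finset.measurable_fun_sum _ fun x _ => (this x).mul (hf x)

lemma measurable_gibbs_const {f : (Fin n → ℝ) → ℝ} (hf : Measurable f) :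
    Measurable fun ω : CavΩ n => gibbs P0 S n lam ω f :=
  measurable_gibbs fun x => hf.comp (measurable_xbar x)

lemma measurable_bcoef (i : Fin n) : Measurable fun ω : CavΩ n => bcoef P0 S n lam ω i :=
  measurable_gibbs_const (measurable_pi_apply i)

lemma measurable_Qoverlap : Measurable fun ω : CavΩ n => Qoverlap P0 S n lam ω := by
  have := fun i => measurable_bcoef (P0 := P0) (S := S) (n := n) (lam := lam) i
  unfold Qoverlap
  fun_prop

lemma Qoverlap_eq_ndot (ω : CavΩ n) :
    Qoverlap P0 S n lam ω = ndot n (bcoef P0 S n lam ω) (bcoef P0 S n lam ω) := by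
  simp [Qoverlap, ndot, sq]

lemma Qoverlap_nonneg (ω : CavΩ n) : 0 ≤ Qoverlap P0 S n lam ω := by
  unfold Qoverlap; positivity

lemma abs_ndot_le {u v : Fin n → ℝ} {K : ℝ} (hK : 0 ≤ K) (hu : ∀ i, |u i| ≤ K)
    (hv : ∀ i, |v i| ≤ K) : |ndot n u v| ≤ K ^ 2 := by
  unfold ndot
  have h1 : |∑ i, u i * v i| ≤ n * K ^ 2 := by
    calc _ ≤ ∑ i, |u i * v i| := Finset.abs_sum_le_sum_abs _ _
      _ ≤ ∑ _i : Fin n, K ^ 2 := Finset.sum_le_sum fun i _ => by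
          rw [abs_mul, sq]; exact mul_le_mul (hu i) (hv i) (abs_nonneg _) hK
      _ = n * K ^ 2 := by simp
  rw [abs_mul, abs_of_nonneg (by positivity)]
  rcases Nat.eq_zero_or_pos n with h | h
  · subst h; simp; positivity
  · calc _ ≤ (1 / n : ℝ) * (n * K ^ 2) := by gcongr
      _ = K ^ 2 := by field_simp

variable [IsProbabilityMeasure P0]

lemma sum_prob_singleton (hsupp : P0 ((↑S : Set ℝ)ᶜ) = 0) : ∑ x ∈ S, (P0 {x}).toReal = 1 := by
  have h1 : P0 (S : Set ℝ) = 1 := (prob_compl_eq_zero_iff S.measurableSet).1 hsupp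
  have h2 : P0.real (S : Set ℝ) = 1 := by simp [Measure.real, h1]
  rw [← h2, ← sum_measureReal_singleton]
  rfl

lemma sum_weight (hsupp : P0 ((↑S : Set ℝ)ᶜ) = 0) (m : ℕ) :
    ∑ x ∈ confs S m, weight P0 m x = 1 := by
  unfold confs weight
  rw [← Finset.prod_univ_sum (fun _ : Fin m => S) (fun _ x => (P0 {x}).toReal)]
  simp [sum_prob_singleton hsupp]

lemma gpart_pos (hsupp : P0 ((↑S : Set ℝ)ᶜ) = 0) (ω : CavΩ n) : 0 < gpart P0 S n lam ω :=
  sum_pos_of_weights (fun x _ => weight_nonneg n x) (sum_weight hsupp n) fun _ _ => Real.exp_pos _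

lemma gweight_nonneg (hsupp : P0 ((↑S : Set ℝ)ᶜ) = 0) (ω : CavΩ n) (x : Fin n → ℝ) :
    0 ≤ gweight P0 S n lam ω x :=
  div_nonneg (mul_nonneg (weight_nonneg n x) (Real.exp_pos _).le) (gpart_pos hsupp ω).le

lemma sum_gweight (hsupp : P0 ((↑S : Set ℝ)ᶜ) = 0) (ω : CavΩ n) :
    ∑ x ∈ confs S n, gweight P0 S n lam ω x = 1 := by
  unfold gweight
  rw [← Finset.sum_div]
  exact div_self (gpart_pos hsupp ω).ne'

lemma abs_gibbs_le (hsupp : P0 ((↑S : Set ℝ)ᶜ) = 0) {ω : CavΩ n} (hω : ω.1 ∈ confs S (n + 1))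
    {f : (Fin n → ℝ) → ℝ} {C : ℝ} (hf : ∀ c ∈ confs S n, |f c| ≤ C) :
    |gibbs P0 S n lam ω f| ≤ C := by
  rw [gibbs_eq_sum]
  calc _ ≤ ∑ x ∈ confs S n, |gweight P0 S n lam ω x * f (xbar n ω x)| :=
        Finset.abs_sum_le_sum_abs _ _
    _ ≤ ∑ x ∈ confs S n, gweight P0 S n lam ω x * C := by
        refine Finset.sum_le_sum fun x hx => ?_
        rw [abs_mul, abs_of_nonneg (gweight_nonneg hsupp ω x)]
        exact mul_le_mul_of_nonneg_left (hf _ (xbar_mem hω hx)) (gweight_nonneg hsupp ω x)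
    _ = C := by rw [← Finset.sum_mul, sum_gweight hsupp, one_mul]

lemma ae_mem_confs (hsupp : P0 ((↑S : Set ℝ)ᶜ) = 0) (m : ℕ) :
    ∀ᵐ X ∂Measure.pi fun _ : Fin m => P0, X ∈ confs S m := by
  have h : ∀ᵐ x ∂P0, x ∈ S := hsupp
  have : ∀ᵐ X ∂Measure.pi fun _ : Fin m => P0, ∀ i, X i ∈ S := by
    rw [ae_all_iff]
    exact fun i => (measurePreserving_eval (fun _ : Fin m => P0) i).quasiMeasurePreserving.ae h
  filter_upwards [this] with X hX using mem_confs.2 hX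

lemma ae_cavMeas_mem_confs (hsupp : P0 ((↑S : Set ℝ)ᶜ) = 0) {ε : ℝ}
    [IsProbabilityMeasure (bern ε)] : ∀ᵐ ω ∂cavMeas P0 n ε, ω.1 ∈ confs S (n + 1) := by
  rw [cavMeas_eq_prod]
  exact measurePreserving_fst.quasiMeasurePreserving.ae (ae_mem_confs hsupp (n + 1))

lemma abs_bcoef_le (hsupp : P0 ((↑S : Set ℝ)ᶜ) = 0) {K : ℝ} (hSK : ∀ x ∈ S, |x| ≤ K)
    {ω : CavΩ n} (hω : ω.1 ∈ confs S (n + 1)) (i : Fin n) : |bcoef P0 S n lam ω i| ≤ K :=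
  abs_gibbs_le hsupp hω fun _ hc => hSK _ (mem_confs.1 hc i)

lemma abs_Qoverlap_le (hsupp : P0 ((↑S : Set ℝ)ᶜ) = 0) {K : ℝ} (hK : 0 ≤ K)
    (hSK : ∀ x ∈ S, |x| ≤ K) {ω : CavΩ n} (hω : ω.1 ∈ confs S (n + 1)) :
    |Qoverlap P0 S n lam ω| ≤ K ^ 2 := by
  rw [Qoverlap_eq_ndot]
  exact abs_ndot_le hK (abs_bcoef_le hsupp hSK hω) (abs_bcoef_le hsupp hSK hω)

end GibbsWeights

section CameronMartin

lemma setIntegral_exp_stdGauss (a : ℝ) {s : Set ℝ} (hs : MeasurableSet s) :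
    ENNReal.ofReal (∫ x, s.indicator (fun x => rexp (a * x - a ^ 2 / 2)) x ∂stdGauss)
      = gaussianReal a 1 s := by
  rw [gaussianReal_apply_eq_integral a one_ne_zero, stdGauss,
    integral_gaussianReal_eq_integral_smul one_ne_zero, ← integral_indicator hs]
  congr 2
  ext x
  by_cases hx : x ∈ s
  · simp only [Set.indicator_of_mem hx, gaussianPDFReal_def, smul_eq_mul, mul_assoc]
    rw [← Real.exp_add]
    congr 2
    simp
    ring
  · simp [Set.indicator_of_notMem hx]

variable {ι : Type*} [Fintype ι]

lemma pi_stdGauss_withDensity (a : ι → ℝ) :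
    (Measure.pi fun _ : ι => stdGauss).withDensity
      (fun Y => ENNReal.ofReal (rexp (∑ i, (a i * Y i - a i ^ 2 / 2))))
      = Measure.pi fun i => gaussianReal (a i) 1 := by
  refine (Measure.pi_eq fun s hs => ?_).symm
  have hI : Integrable (fun Y : ι → ℝ => ∏ i, (s i).indicator
      (fun x => rexp (a i * x - a i ^ 2 / 2)) (Y i)) (Measure.pi fun _ : ι => stdGauss) := by
    refine Integrable.fintype_prod
      (f := fun i => (s i).indicator fun x => rexp (a i * x - a i ^ 2 / 2)) fun i => ?_
    refine Integrable.indicator ?_ (hs i)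
    simp_rw [sub_eq_add_neg, Real.exp_add]
    exact (integrable_exp_mul_gaussianReal (a i)).mul_const _
  rw [withDensity_apply _ (MeasurableSet.univ_pi hs),
    ← lintegral_indicator (MeasurableSet.univ_pi hs)]
  calc _ = ∫⁻ Y, ENNReal.ofReal (∏ i, (s i).indicator
      (fun x => rexp (a i * x - a i ^ 2 / 2)) (Y i)) ∂(Measure.pi fun _ : ι => stdGauss) := by
        refine lintegral_congr fun Y => ?_
        by_cases hY : Y ∈ Set.univ.pi s
        · rw [Set.indicator_of_mem hY, Real.exp_sum]
          congr 1
          refine Finset.prod_congr rfl fun i _ => ?_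
          rw [Set.indicator_of_mem (hY i (Set.mem_univ i))]
        · rw [Set.indicator_of_notMem hY]
          simp only [Set.mem_pi, Set.mem_univ, true_imp_iff, not_forall] at hY
          obtain ⟨i, hi⟩ := hY
          rw [Finset.prod_eq_zero (Finset.mem_univ i) (Set.indicator_of_notMem hi _)]
          simp
    _ = _ := by
        rw [← ofReal_integral_eq_lintegral_ofReal hI, integral_fintype_prod_eq_prod
          (f := fun i => (s i).indicator fun x => rexp (a i * x - a i ^ 2 / 2)),
          ENNReal.ofReal_prod_of_nonneg]
        · exact Finset.prod_congr rfl fun i _ => setIntegral_exp_stdGauss (a i) (hs i)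
        · exact fun i _ => integral_nonneg fun x =>
            Set.indicator_nonneg (fun _ _ => (Real.exp_pos _).le) _
        · exact ae_of_all _ fun Y => Finset.prod_nonneg fun i _ =>
            Set.indicator_nonneg (fun _ _ => (Real.exp_pos _).le) _

/-- The Cameron–Martin formula for a finite standard Gaussian vector. -/
lemma integral_stdGauss_shift (a : ι → ℝ) (F : (ι → ℝ) → ℝ) :
    ∫ Z, F Z ∂(Measure.pi fun _ : ι => stdGauss)
      = ∫ Y, rexp (∑ i, (a i * Y i - a i ^ 2 / 2)) * F (fun i => Y i - a i)
        ∂(Measure.pi fun _ : ι => stdGauss) := by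
  have h1 : (Measure.pi fun i => gaussianReal (a i) 1).map (fun Y i => Y i - a i)
      = Measure.pi fun _ : ι => stdGauss := by
    rw [Measure.pi_map_pi (f := fun i x => x - a i) (fun i => by fun_prop)]
    congr 1
    ext1 i
    rw [gaussianReal_map_sub_const, sub_self, stdGauss]
  have h2 : MeasurableEmbedding fun (Y : ι → ℝ) i => Y i - a i :=
    (MeasurableEquiv.subRight a).measurableEmbedding
  conv_lhs => rw [← h1, h2.integral_map, ← pi_stdGauss_withDensity,
    integral_withDensity_eq_integral_toReal_smul (by fun_prop) (by simp)]
  refine integral_congr_ae (ae_of_all _ fun Y => ?_)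
  simp [ENNReal.toReal_ofReal (Real.exp_pos _).le]

end CameronMartin

section Resampling

variable {P0 : Measure ℝ} {S : Finset ℝ} {n : ℕ}

/-- The configuration `x̄`, as a function of the labels and the signal. -/
def resample (L : Fin (n + 1) → Bool) (X : Fin (n + 1) → ℝ) (x : Fin n → ℝ) : Fin n → ℝ :=
  fun i => if L i.castSucc then X i.castSucc else x i

lemma xbar_eq_resample (ω : CavΩ n) (x : Fin n → ℝ) :
    xbar n ω x = resample ω.2.2.1 ω.1 x := rfl

lemma resample_congr {L : Fin (n + 1) → Bool} {X X' : Fin (n + 1) → ℝ}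
    (h : ∀ i, L i → X i = X' i) (x : Fin n → ℝ) : resample L X x = resample L X' x := by
  ext i
  unfold resample
  split_ifs with hi
  · exact h _ hi
  · rfl

/-- Exchange the unrevealed coordinates of the signal and of a configuration. -/
def exchange (L : Fin (n + 1) → Bool) (p : (Fin (n + 1) → ℝ) × (Fin n → ℝ)) :
    (Fin (n + 1) → ℝ) × (Fin n → ℝ) :=
  (Fin.snoc (α := fun _ => ℝ) (resample L p.1 p.2) (p.1 (Fin.last n)),
    fun i => if L i.castSucc then p.2 i else p.1 i.castSucc)

lemma exchange_exchange (L : Fin (n + 1) → Bool) (p : (Fin (n + 1) → ℝ) × (Fin n → ℝ)) :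
    exchange L (exchange L p) = p := by
  refine Prod.ext (funext fun i => ?_) (funext fun i => ?_)
  · induction i using Fin.lastCases with
    | last => simp [exchange]
    | cast i => by_cases h : L i.castSucc <;> simp [exchange, resample, h]
  · by_cases h : L i.castSucc <;> simp [exchange, resample, h]

lemma exchange_mem (L : Fin (n + 1) → Bool) {p : (Fin (n + 1) → ℝ) × (Fin n → ℝ)}
    (hp : p ∈ confs S (n + 1) ×ˢ confs S n) :
    exchange L p ∈ confs S (n + 1) ×ˢ confs S n := by
  simp only [Finset.mem_product, mem_confs] at hp ⊢
  refine ⟨fun i => ?_, fun i => ?_⟩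
  · induction i using Fin.lastCases with
    | last => simpa [exchange] using hp.1 _
    | cast i => by_cases h : L i.castSucc <;> simp [exchange, resample, h, hp.1, hp.2]
  · by_cases h : L i.castSucc <;> simp [exchange, h, hp.1, hp.2]

lemma resample_exchange (L : Fin (n + 1) → Bool) (p : (Fin (n + 1) → ℝ) × (Fin n → ℝ)) :
    resample L (exchange L p).1 (exchange L p).2 = fun i => p.1 i.castSucc := by
  ext i
  by_cases h : L i.castSucc <;> simp [exchange, resample, h]

lemma exchange_fst_castSucc (L : Fin (n + 1) → Bool) (p : (Fin (n + 1) → ℝ) × (Fin n → ℝ)) :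
    (fun i : Fin n => (exchange L p).1 i.castSucc) = resample L p.1 p.2 := by
  ext i
  simp [exchange]

lemma exchange_fst_revealed (L : Fin (n + 1) → Bool) (p : (Fin (n + 1) → ℝ) × (Fin n → ℝ)) :
    ∀ i, L i → (exchange L p).1 i = p.1 i := by
  intro i hi
  induction i using Fin.lastCases with
  | last => simp [exchange]
  | cast i => simp [exchange, resample, hi]

lemma weight_exchange (L : Fin (n + 1) → Bool) (p : (Fin (n + 1) → ℝ) × (Fin n → ℝ)) :
    weight P0 (n + 1) (exchange L p).1 * weight P0 n (exchange L p).2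
      = weight P0 (n + 1) p.1 * weight P0 n p.2 := by
  unfold weight
  rw [Fin.prod_univ_castSucc, Fin.prod_univ_castSucc, mul_right_comm,
    mul_right_comm _ _ (∏ i, (P0 {p.2 i}).toReal), ← Finset.prod_mul_distrib,
    ← Finset.prod_mul_distrib]
  congr 1
  · refine Finset.prod_congr rfl fun i _ => ?_
    by_cases h : L i.castSucc <;> simp [exchange, resample, h, mul_comm]
  · simp [exchange]

/-- The Bayes rule: resampling the unrevealed coordinates of the signal from the posterior
does not change the joint law. -/
lemma sum_posterior (L : Fin (n + 1) → Bool) {E : (Fin n → ℝ) → ℝ}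
    (hE : ∀ X, (∑ x ∈ confs S n, weight P0 n x * E (resample L X x)) ≠ 0)
    {Φ : (Fin n → ℝ) → (Fin (n + 1) → ℝ) → ℝ}
    (hΦ : ∀ c X X', (∀ i, L i → X i = X' i) → Φ c X = Φ c X') :
    ∑ X ∈ confs S (n + 1), weight P0 (n + 1) X * (E (fun i => X i.castSucc) *
        Φ (fun i => X i.castSucc) X)
      = ∑ X ∈ confs S (n + 1), weight P0 (n + 1) X * (E (fun i => X i.castSucc) *
        ((∑ x ∈ confs S n, weight P0 n x * Φ (resample L X x) X * E (resample L X x))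
          / ∑ x ∈ confs S n, weight P0 n x * E (resample L X x))) := by
  set D : (Fin (n + 1) → ℝ) → ℝ := fun X =>
    ∑ x ∈ confs S n, weight P0 n x * E (resample L X x) with hD
  set A : (Fin (n + 1) → ℝ) × (Fin n → ℝ) → ℝ := fun p =>
    (weight P0 (n + 1) p.1 * weight P0 n p.2) * (E (fun i => p.1 i.castSucc)
      * E (resample L p.1 p.2) * Φ (resample L p.1 p.2) p.1 / D p.1) with hA
  have hr : ∑ X ∈ confs S (n + 1), weight P0 (n + 1) X * (E (fun i => X i.castSucc) *
        ((∑ x ∈ confs S n, weight P0 n x * Φ (resample L X x) X * E (resample L X x))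
          / ∑ x ∈ confs S n, weight P0 n x * E (resample L X x)))
      = ∑ p ∈ confs S (n + 1) ×ˢ confs S n, A p := by
    rw [Finset.sum_product]
    refine Finset.sum_congr rfl fun X _ => ?_
    rw [Finset.sum_div, Finset.mul_sum, Finset.mul_sum]
    refine Finset.sum_congr rfl fun x _ => ?_
    simp only [hA, hD]
    ring
  rw [hr, Finset.sum_nbij' (exchange L) (exchange L) (fun p hp => exchange_mem L hp)
    (fun p hp => exchange_mem L hp) (fun p _ => exchange_exchange L p)
    (fun p _ => exchange_exchange L p) (g := fun p => A (exchange L p))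
    (fun p _ => by rw [exchange_exchange]), Finset.sum_product]
  refine Finset.sum_congr rfl fun X _ => ?_
  have hAe : ∀ x, A (exchange L (X, x)) = weight P0 (n + 1) X * (E (fun i => X i.castSucc) *
      Φ (fun i => X i.castSucc) X) / D X * (weight P0 n x * E (resample L X x)) := by
    intro x
    have hX := exchange_fst_revealed L (X, x)
    have hDX : D (exchange L (X, x)).1 = D X :=
      Finset.sum_congr rfl fun y _ => by rw [resample_congr hX]
    simp only [hA]
    rw [weight_exchange, resample_exchange, exchange_fst_castSucc, hΦ _ _ _ hX, hDX]
    ring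
  simp_rw [hAe]
  rw [← Finset.mul_sum]
  exact (div_mul_cancel₀ _ (hE X)).symm

end Resampling

section Shift

variable {n : ℕ} {lam : ℝ}

/-- The signal part of the noisy observations of the products `X_i X_j`. -/
def shift (lam : ℝ) (X : Fin (n + 1) → ℝ) (p : Fin (n + 1) × Fin (n + 1)) : ℝ :=
  if p.1 < p.2 ∧ p.2 ≠ Fin.last n then √(lam / (n + 1)) * X p.1 * X p.2 else 0

/-- The Hamiltonian in terms of the noisy observations `Y`. -/
def plantH (n : ℕ) (lam : ℝ) (Y : Fin (n + 1) × Fin (n + 1) → ℝ) (x : Fin n → ℝ) : ℝ :=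
  ∑ p ∈ pairs n, (√(lam / (n + 1)) * Y (p.1.castSucc, p.2.castSucc) * x p.1 * x p.2
    - lam / (2 * (n + 1)) * (x p.1) ^ 2 * (x p.2) ^ 2)

lemma sum_shift (hlam : 0 ≤ lam) (X : Fin (n + 1) → ℝ) (Y : Fin (n + 1) × Fin (n + 1) → ℝ) :
    ∑ p, (shift lam X p * Y p - shift lam X p ^ 2 / 2)
      = plantH n lam Y fun i => X i.castSucc := by
  unfold plantH pairs
  have hs : √(lam / (n + 1)) ^ 2 = lam / (n + 1) := Real.sq_sqrt (by positivity)
  rw [Finset.sum_filter, Fintype.sum_prod_type, Fintype.sum_prod_type, Fin.sum_univ_castSucc]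
  have h1 : ∀ i : Fin (n + 1), shift lam X (i, Fin.last n) = 0 := by simp [shift]
  have h2 : ∀ i : Fin (n + 1), shift lam X (Fin.last n, i) = 0 := by
    intro i; simp [shift, Fin.le_last]
  have h3 : ∀ i j : Fin n, shift lam X (i.castSucc, j.castSucc) =
      if i < j then √(lam / (n + 1)) * X i.castSucc * X j.castSucc else 0 := by
    intro i j
    simp [shift, (Fin.castSucc_lt_last j).ne]
  simp only [Fin.sum_univ_castSucc, h1, h2, h3]
  simp only [zero_mul, zero_pow two_ne_zero, zero_div, sub_zero, add_zero, Finset.sum_const_zero]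
  refine Finset.sum_congr rfl fun i _ => Finset.sum_congr rfl fun j _ => ?_
  split_ifs
  · rw [mul_pow, mul_pow, hs]
    field_simp
  · simp

lemma Hcav_shift (hlam : 0 ≤ lam) (X : Fin (n + 1) → ℝ) (Y : Fin (n + 1) × Fin (n + 1) → ℝ) (r)
    (x : Fin n → ℝ) : Hcav n lam (X, fun p => Y p - shift lam X p, r) x = plantH n lam Y x := by
  have hs : √(lam / (n + 1)) ^ 2 = lam / (n + 1) := Real.sq_sqrt (by positivity)
  unfold Hcav plantH
  refine Finset.sum_congr rfl fun p hp => ?_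
  have h : shift lam X (p.1.castSucc, p.2.castSucc)
      = √(lam / (n + 1)) * X p.1.castSucc * X p.2.castSucc := by
    have : p.1 < p.2 := by simpa [pairs] using hp
    simp [shift, this, (Fin.castSucc_lt_last p.2).ne]
  dsimp only
  rw [h]
  linear_combination (- X p.1.castSucc * X p.2.castSucc * x p.1 * x p.2) * hs

end Shift

section Quenched

/-- Functions of the signal and of the noise matrix. -/
abbrev SigNoiseFun (n : ℕ) := (Fin (n + 1) → ℝ) → ((Fin (n + 1) × Fin (n + 1)) → ℝ) → ℝ

/-- The expectation over signal and noise, as a finite sum of Gaussian integrals. -/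
def qexp (P0 : Measure ℝ) (S : Finset ℝ) (n : ℕ) (G : SigNoiseFun n) : ℝ :=
  ∑ X ∈ confs S (n + 1), weight P0 (n + 1) X *
    ∫ Z, G X Z ∂(Measure.pi fun _ : Fin (n + 1) × Fin (n + 1) => stdGauss)

/-- Measurable in the noise and bounded, for every signal with values in `S`. -/
def Nice (S : Finset ℝ) {n : ℕ} (G : SigNoiseFun n) : Prop :=
  ∀ X ∈ confs S (n + 1), Measurable (G X) ∧ ∃ C, ∀ Z, |G X Z| ≤ C

/-- `G` depends on the signal only through its revealed coordinates and the observations. -/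
def Adapted {n : ℕ} (lam : ℝ) (L : Fin (n + 1) → Bool) (G : SigNoiseFun n) : Prop :=
  ∀ (X X' : Fin (n + 1) → ℝ) (Y : Fin (n + 1) × Fin (n + 1) → ℝ), (∀ i, L i → X i = X' i) →
    G X (fun p => Y p - shift lam X p) = G X' (fun p => Y p - shift lam X' p)

variable {P0 : Measure ℝ} {S : Finset ℝ} {n : ℕ} {lam : ℝ} {G G' : SigNoiseFun n}

lemma Nice.add (hG : Nice S G) (hG' : Nice S G') : Nice S fun X Z => G X Z + G' X Z := by
  intro X hX
  obtain ⟨h1, C, hC⟩ := hG X hX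
  obtain ⟨h2, C', hC'⟩ := hG' X hX
  exact ⟨h1.add h2, C + C', fun Z => (abs_add_le _ _).trans (add_le_add (hC Z) (hC' Z))⟩

lemma Nice.mul (hG : Nice S G) (hG' : Nice S G') : Nice S fun X Z => G X Z * G' X Z := by
  intro X hX
  obtain ⟨h1, C, hC⟩ := hG X hX
  obtain ⟨h2, C', hC'⟩ := hG' X hX
  refine ⟨h1.mul h2, C * C', fun Z => ?_⟩
  rw [abs_mul]
  exact mul_le_mul (hC Z) (hC' Z) (abs_nonneg _) ((abs_nonneg _).trans (hC Z))

lemma nice_signal (f : (Fin (n + 1) → ℝ) → ℝ) : Nice S (n := n) fun X _ => f X :=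
  fun X _ => ⟨measurable_const, |f X|, fun _ => le_rfl⟩

lemma Nice.sub (hG : Nice S G) (hG' : Nice S G') : Nice S fun X Z => G X Z - G' X Z := by
  convert hG.add ((nice_signal fun _ => -1).mul hG') using 3
  ring

lemma Nice.pow (hG : Nice S G) (k : ℕ) : Nice S fun X Z => G X Z ^ k := by
  intro X hX
  obtain ⟨h1, C, hC⟩ := hG X hX
  refine ⟨h1.pow_const k, C ^ k, fun Z => ?_⟩
  rw [abs_pow]
  exact pow_le_pow_left₀ (abs_nonneg _) (hC Z) k

lemma nice_sum {ι : Type*} {s : Finset ι} {F : ι → SigNoiseFun n} (h : ∀ i ∈ s, Nice S (F i)) :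
    Nice S fun X Z => ∑ i ∈ s, F i X Z := by
  classical
  induction s using Finset.induction_on with
  | empty => simpa using nice_signal fun _ => 0
  | insert a s ha ih =>
    simp only [Finset.sum_insert ha]
    exact (h a (Finset.mem_insert_self a s)).add (ih fun i hi => h i (Finset.mem_insert_of_mem hi))

lemma Nice.integrable (hG : Nice S G) {X : Fin (n + 1) → ℝ} (hX : X ∈ confs S (n + 1)) :
    Integrable (G X) (Measure.pi fun _ : Fin (n + 1) × Fin (n + 1) => stdGauss) := by
  obtain ⟨h1, C, hC⟩ := hG X hX
  exact .of_bound h1.aestronglyMeasurable C (ae_of_all _ hC)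

lemma nice_gibbs [IsProbabilityMeasure P0] (hsupp : P0 ((↑S : Set ℝ)ᶜ) = 0)
    (L : Fin (n + 1) → Bool) {Ψ : (Fin n → ℝ) → SigNoiseFun n}
    (hΨ : ∀ c ∈ confs S n, Nice S (Ψ c)) :
    Nice S fun X Z => gibbs P0 S n lam (X, Z, L, 0) fun x => Ψ x X Z := by
  intro X hX
  have hm : Measurable fun Z : Fin (n + 1) × Fin (n + 1) → ℝ => ((X, Z, L, 0) : CavΩ n) := by
    fun_prop
  choose h1 C hC using fun c hc => hΨ c hc X hX
  refine ⟨?_, ∑ c ∈ (confs S n).attach, |C c.1 c.2|, fun Z => ?_⟩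
  · simp_rw [gibbs_eq_sum]
    refine Finset.measurable_fun_sum _ fun x hx => ((measurable_gweight x).comp hm).mul ?_
    exact h1 _ (xbar_mem (ω := (X, 0, L, 0)) hX hx)
  · refine abs_gibbs_le hsupp hX fun c hc => (hC c hc Z).trans ((le_abs_self _).trans ?_)
    exact Finset.single_le_sum (f := fun c : confs S n => |C c.1 c.2|)
      (fun _ _ => abs_nonneg _) (Finset.mem_attach _ ⟨c, hc⟩)

lemma Adapted.mul {L} (hG : Adapted lam L G) (hG' : Adapted lam L G') :
    Adapted lam L fun X Z => G X Z * G' X Z :=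
  fun X X' Y h => congrArg₂ (· * ·) (hG X X' Y h) (hG' X X' Y h)

lemma Adapted.sub {L} (hG : Adapted lam L G) (hG' : Adapted lam L G') :
    Adapted lam L fun X Z => G X Z - G' X Z :=
  fun X X' Y h => congrArg₂ (· - ·) (hG X X' Y h) (hG' X X' Y h)

lemma Adapted.comp {L} (hG : Adapted lam L G) (f : ℝ → ℝ) : Adapted lam L fun X Z => f (G X Z) :=
  fun X X' Y h => congrArg f (hG X X' Y h)

lemma adapted_const (L) (c : ℝ) : Adapted (n := n) lam L fun _ _ => c := fun _ _ _ _ => rfl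

lemma adapted_signal {L : Fin (n + 1) → Bool} {i} (hi : L i) :
    Adapted lam L fun X _ => X i := fun _ _ _ h => h i hi

lemma adapted_sum {ι : Type*} {s : Finset ι} {L} {F : ι → SigNoiseFun n}
    (h : ∀ i ∈ s, Adapted lam L (F i)) : Adapted lam L fun X Z => ∑ i ∈ s, F i X Z :=
  fun X X' Y hX => Finset.sum_congr rfl fun i hi => h i hi X X' Y hX

lemma Adapted.mono {L L' : Fin (n + 1) → Bool} (hL : ∀ i, L i → L' i) (hG : Adapted lam L G) :
    Adapted lam L' G := fun X X' Y h => hG X X' Y fun i hi => h i (hL i hi)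

lemma adapted_gibbs (hlam : 0 ≤ lam) (L : Fin (n + 1) → Bool) {Ψ : (Fin n → ℝ) → SigNoiseFun n}
    (hΨ : ∀ c, Adapted lam L (Ψ c)) :
    Adapted lam L fun X Z => gibbs P0 S n lam (X, Z, L, 0) fun x => Ψ x X Z := by
  intro X X' Y h
  unfold gibbs
  simp only [Hcav_shift hlam, xbar_eq_resample, resample_congr h, hΨ _ X X' Y h]

lemma qexp_add (hG : Nice S G) (hG' : Nice S G') :
    qexp P0 S n (fun X Z => G X Z + G' X Z) = qexp P0 S n G + qexp P0 S n G' := by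
  unfold qexp
  rw [← Finset.sum_add_distrib]
  exact Finset.sum_congr rfl fun X hX => by
    rw [integral_add (hG.integrable hX) (hG'.integrable hX), mul_add]

lemma qexp_const_mul (c : ℝ) : qexp P0 S n (fun X Z => c * G X Z) = c * qexp P0 S n G := by
  unfold qexp
  rw [Finset.mul_sum]
  exact Finset.sum_congr rfl fun X hX => by
    rw [integral_const_mul]; ring

lemma qexp_sub (hG : Nice S G) (hG' : Nice S G') :
    qexp P0 S n (fun X Z => G X Z - G' X Z) = qexp P0 S n G - qexp P0 S n G' := by
  unfold qexp
  rw [← Finset.sum_sub_distrib]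
  exact Finset.sum_congr rfl fun X hX => by
    rw [integral_sub (hG.integrable hX) (hG'.integrable hX), mul_sub]

lemma qexp_sum {ι : Type*} {s : Finset ι} {F : ι → SigNoiseFun n} (h : ∀ i ∈ s, Nice S (F i)) :
    qexp P0 S n (fun X Z => ∑ i ∈ s, F i X Z) = ∑ i ∈ s, qexp P0 S n (F i) := by
  unfold qexp
  rw [Finset.sum_comm]
  refine Finset.sum_congr rfl fun X hX => ?_
  rw [integral_finsetSum _ fun i hi => (h i hi).integrable hX, Finset.mul_sum]

lemma qexp_mono (hG : Nice S G) (hG' : Nice S G')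
    (h : ∀ X ∈ confs S (n + 1), ∀ Z, G X Z ≤ G' X Z) : qexp P0 S n G ≤ qexp P0 S n G' :=
  Finset.sum_le_sum fun X hX => mul_le_mul_of_nonneg_left
    (integral_mono (hG.integrable hX) (hG'.integrable hX) (h X hX)) (weight_nonneg _ X)

lemma qexp_congr (h : ∀ X ∈ confs S (n + 1), ∀ Z, G X Z = G' X Z) :
    qexp P0 S n G = qexp P0 S n G' :=
  Finset.sum_congr rfl fun X hX => by simp_rw [h X hX]

lemma qexp_const [IsProbabilityMeasure P0] (hsupp : P0 ((↑S : Set ℝ)ᶜ) = 0) (c : ℝ) :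
    qexp P0 S n (fun _ _ => c) = c := by
  unfold qexp
  simp [← Finset.sum_mul, sum_weight hsupp]

lemma qexp_shift (hlam : 0 ≤ lam) (hG : Nice S G) :
    (∀ X ∈ confs S (n + 1), Integrable (fun Y => rexp (plantH n lam Y fun i => X i.castSucc) *
      G X (fun p => Y p - shift lam X p))
        (Measure.pi fun _ : Fin (n + 1) × Fin (n + 1) => stdGauss)) ∧
    qexp P0 S n G = ∑ X ∈ confs S (n + 1), weight P0 (n + 1) X *
      ∫ Y, rexp (plantH n lam Y fun i => X i.castSucc) * G X (fun p => Y p - shift lam X p)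
        ∂(Measure.pi fun _ : Fin (n + 1) × Fin (n + 1) => stdGauss) := by
  constructor
  · intro X hX
    obtain ⟨h1, C, hC⟩ := hG X hX
    refine Integrable.mul_bdd (c := C) ?_ ?_ (ae_of_all _ fun Y => hC _)
    · simp_rw [← sum_shift hlam, Finset.sum_sub_distrib, sub_eq_add_neg]
      exact (isStdGaussFam_pi _).integrable_exp_add _ _
    · exact (h1.comp (by fun_prop)).aestronglyMeasurable
  · refine Finset.sum_congr rfl fun X _ => ?_
    rw [integral_stdGauss_shift (shift lam X)]
    simp_rw [sum_shift hlam]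

/-- The Nishimori identity, conditionally on the labels. -/
lemma nishimori [IsProbabilityMeasure P0] (hsupp : P0 ((↑S : Set ℝ)ᶜ) = 0) (hlam : 0 ≤ lam)
    (L : Fin (n + 1) → Bool) {Ψ : (Fin n → ℝ) → SigNoiseFun n}
    (hN : ∀ c ∈ confs S n, Nice S (Ψ c)) (hA : ∀ c, Adapted lam L (Ψ c)) :
    qexp P0 S n (fun X Z => Ψ (fun i => X i.castSucc) X Z)
      = qexp P0 S n (fun X Z => gibbs P0 S n lam (X, Z, L, 0) fun x => Ψ x X Z) := by
  have hN1 : Nice S fun X Z => Ψ (fun i => X i.castSucc) X Z := fun X hX =>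
    hN _ (mem_confs.2 fun i => mem_confs.1 hX _) X hX
  have hN2 := nice_gibbs (lam := lam) hsupp L hN
  obtain ⟨i1, e1⟩ := qexp_shift (P0 := P0) hlam hN1
  obtain ⟨i2, e2⟩ := qexp_shift (P0 := P0) hlam hN2
  rw [e1, e2]
  simp_rw [← integral_const_mul]
  rw [← integral_finsetSum _ fun X hX => (i1 X hX).const_mul _,
    ← integral_finsetSum _ fun X hX => (i2 X hX).const_mul _]
  congr 1 with Y
  have hD : ∀ X, ∑ x ∈ confs S n, weight P0 n x * rexp (plantH n lam Y (resample L X x)) ≠ 0 :=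
    fun X => (sum_pos_of_weights (fun x _ => weight_nonneg n x) (sum_weight hsupp n)
      fun _ _ => Real.exp_pos _).ne'
  have := sum_posterior (P0 := P0) (S := S) L (E := fun x => rexp (plantH n lam Y x)) hD
    (Φ := fun c X => Ψ c X fun p => Y p - shift lam X p) fun c X X' h => hA c X X' Y h
  refine this.trans (Finset.sum_congr rfl fun X _ => ?_)
  unfold gibbs
  simp only [Hcav_shift hlam, xbar_eq_resample]

end Quenched

section Pinning

variable (P0 : Measure ℝ) (S : Finset ℝ) (n : ℕ) (lam : ℝ)

/-- The Gibbs mean of the `i`-th coordinate given the labels `L`. -/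
def gmean (L : Fin (n + 1) → Bool) (i : Fin n) : SigNoiseFun n :=
  fun X Z => bcoef P0 S n lam (X, Z, L, 0) i

/-- The truncated two-point Gibbs correlation given the labels `L`. -/
def gcov (L : Fin (n + 1) → Bool) (i j : Fin n) : SigNoiseFun n :=
  fun X Z => gibbs P0 S n lam (X, Z, L, 0) (fun x => x i * x j)
    - gmean P0 S n lam L i X Z * gmean P0 S n lam L j X Z

/-- The expected squared Gibbs mean given the labels. -/
def secondMoment (j : Fin n) (L : Fin (n + 1) → Bool) : ℝ :=
  qexp P0 S n fun X Z => gmean P0 S n lam L j X Z ^ 2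

variable {P0 S n lam}

lemma gibbs_mul_const (ω : CavΩ n) (f : (Fin n → ℝ) → ℝ) (c : ℝ) :
    gibbs P0 S n lam ω (fun x => f x * c) = gibbs P0 S n lam ω f * c := by
  rw [gibbs_eq_sum, gibbs_eq_sum, Finset.sum_mul]
  exact Finset.sum_congr rfl fun x _ => by ring

variable [IsProbabilityMeasure P0] (hsupp : P0 ((↑S : Set ℝ)ᶜ) = 0)
include hsupp

lemma nice_gibbs_const (L : Fin (n + 1) → Bool) (f : (Fin n → ℝ) → ℝ) :
    Nice S fun X Z => gibbs P0 S n lam (X, Z, L, 0) f :=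
  nice_gibbs hsupp L (Ψ := fun c _ _ => f c) fun c _ => nice_signal fun _ => f c

lemma nice_gmean (L : Fin (n + 1) → Bool) (i : Fin n) : Nice S (gmean P0 S n lam L i) :=
  nice_gibbs_const hsupp L fun x => x i

lemma nice_gcov (L : Fin (n + 1) → Bool) (i j : Fin n) : Nice S (gcov P0 S n lam L i j) :=
  (nice_gibbs_const hsupp L _).sub ((nice_gmean hsupp L i).mul (nice_gmean hsupp L j))

omit [IsProbabilityMeasure P0] hsupp in
lemma adapted_gibbs_const (hlam : 0 ≤ lam) (L : Fin (n + 1) → Bool) (f : (Fin n → ℝ) → ℝ) :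
    Adapted lam L fun X Z => gibbs P0 S n lam (X, Z, L, 0) f :=
  adapted_gibbs hlam L (Ψ := fun c _ _ => f c) fun _ => adapted_const L _

omit [IsProbabilityMeasure P0] hsupp in
lemma adapted_gmean (hlam : 0 ≤ lam) (L : Fin (n + 1) → Bool) (i : Fin n) :
    Adapted lam L (gmean P0 S n lam L i) :=
  adapted_gibbs_const hlam L fun x => x i

omit [IsProbabilityMeasure P0] hsupp in
lemma adapted_gcov (hlam : 0 ≤ lam) (L : Fin (n + 1) → Bool) (i j : Fin n) :
    Adapted lam L (gcov P0 S n lam L i j) :=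
  (adapted_gibbs_const hlam L _).sub ((adapted_gmean hlam L i).mul (adapted_gmean hlam L j))

lemma nishimori_mul (hlam : 0 ≤ lam) (L : Fin (n + 1) → Bool) (f : (Fin n → ℝ) → ℝ)
    {G : SigNoiseFun n} (hN : Nice S G) (hA : Adapted lam L G) :
    qexp P0 S n (fun X Z => f (fun i => X i.castSucc) * G X Z)
      = qexp P0 S n (fun X Z => gibbs P0 S n lam (X, Z, L, 0) f * G X Z) := by
  rw [nishimori hsupp hlam L (Ψ := fun c X Z => f c * G X Z)
    (fun c _ => (nice_signal fun _ => f c).mul hN) fun c => (adapted_const L (f c)).mul hA]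
  simp_rw [gibbs_mul_const]

lemma abs_gmean_le {K : ℝ} (hSK : ∀ x ∈ S, |x| ≤ K) (L : Fin (n + 1) → Bool) (i : Fin n) {X}
    (hX : X ∈ confs S (n + 1)) (Z) : |gmean P0 S n lam L i X Z| ≤ K :=
  abs_bcoef_le (ω := (X, Z, L, 0)) hsupp hSK hX i

omit [IsProbabilityMeasure P0] hsupp in
lemma le_update_true (L : Fin (n + 1) → Bool) (i : Fin (n + 1)) :
    ∀ k, L k → Function.update L i true k := by
  intro k hk
  by_cases h : k = i
  · subst h; simp
  · simp [h, hk]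

lemma secondMoment_update_sub (hlam : 0 ≤ lam) (L : Fin (n + 1) → Bool) (i : Fin (n + 1))
    (j : Fin n) :
    secondMoment P0 S n lam j (Function.update L i true) - secondMoment P0 S n lam j L
      = qexp P0 S n fun X Z => (gmean P0 S n lam (Function.update L i true) j X Z
        - gmean P0 S n lam L j X Z) ^ 2 := by
  set L' := Function.update L i true
  have hL := le_update_true L i
  have n0 := nice_gmean (P0 := P0) (lam := lam) hsupp L j
  have n1 := nice_gmean (P0 := P0) (lam := lam) hsupp L' j
  have e1 := nishimori_mul hsupp hlam L (fun x => x j) n0 (adapted_gmean hlam L j)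
  have e2 := nishimori_mul hsupp hlam L' (fun x => x j) n0 ((adapted_gmean hlam L j).mono hL)
  have e3 : qexp P0 S n (fun X Z => gmean P0 S n lam L' j X Z * gmean P0 S n lam L j X Z)
      = secondMoment P0 S n lam j L := by
    simp only [secondMoment, sq]
    exact e2.symm.trans e1
  have : (fun X Z => (gmean P0 S n lam L' j X Z - gmean P0 S n lam L j X Z) ^ 2)
      = fun X Z => (gmean P0 S n lam L' j X Z ^ 2 + gmean P0 S n lam L j X Z ^ 2)
        - 2 * (gmean P0 S n lam L' j X Z * gmean P0 S n lam L j X Z) := by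
    funext X Z; ring
  rw [this, qexp_sub ((n1.pow 2).add (n0.pow 2)) ((nice_signal fun _ => 2).mul (n1.mul n0)),
    qexp_add (n1.pow 2) (n0.pow 2), qexp_const_mul, e3]
  unfold secondMoment
  ring

lemma secondMoment_le_update (hlam : 0 ≤ lam) (L : Fin (n + 1) → Bool) (i : Fin (n + 1))
    (j : Fin n) :
    secondMoment P0 S n lam j L ≤ secondMoment P0 S n lam j (Function.update L i true) := by
  have h := secondMoment_update_sub (P0 := P0) (S := S) hsupp hlam L i j
  have : (0 : ℝ) ≤ qexp P0 S n fun X Z => (gmean P0 S n lam (Function.update L i true) j X Z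
        - gmean P0 S n lam L j X Z) ^ 2 := by
    rw [← qexp_const (n := n) hsupp 0]
    exact qexp_mono (nice_signal fun _ => 0) (((nice_gmean hsupp _ j).sub (nice_gmean hsupp _ j)).pow 2)
      fun _ _ _ => sq_nonneg _
  linarith

lemma gcov_eq_zero {L : Fin (n + 1) → Bool} {i : Fin n} (hi : L i.castSucc = true) (j : Fin n)
    (X Z) : gcov P0 S n lam L i j X Z = 0 := by
  have h1 : ∀ f : (Fin n → ℝ) → ℝ, gibbs P0 S n lam (X, Z, L, 0) (fun x => x i * f x)
      = X i.castSucc * gibbs P0 S n lam (X, Z, L, 0) f := by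
    intro f
    rw [gibbs_eq_sum, gibbs_eq_sum, Finset.mul_sum]
    refine Finset.sum_congr rfl fun x _ => ?_
    simp only [xbar_eq_resample]
    have : resample L X x i = X i.castSucc := by simp [resample, hi]
    rw [this]
    ring
  have h2 : gibbs P0 S n lam (X, Z, L, 0) (fun _ => 1) = 1 := by
    rw [gibbs_eq_sum]
    simp [sum_gweight hsupp]
  have h3 := h1 fun _ => 1
  simp only [mul_one, h2] at h3
  unfold gcov gmean bcoef
  rw [h1, h3, sub_self]

/-- Revealing coordinate `i` increases the second moments by at least the squared correlation
with coordinate `i`. -/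
lemma qexp_gcov_sq_le (hlam : 0 ≤ lam) {K : ℝ} (hSK : ∀ x ∈ S, |x| ≤ K)
    {L : Fin (n + 1) → Bool} (i j : Fin n) :
    qexp P0 S n (fun X Z => gcov P0 S n lam L i j X Z ^ 2)
      ≤ K ^ 2 * (secondMoment P0 S n lam j (Function.update L i.castSucc true)
        - secondMoment P0 S n lam j L) := by
  rw [secondMoment_update_sub hsupp hlam]
  set L' := Function.update L i.castSucc true with hL'
  have hL : ∀ k, L k → L' k := le_update_true L i.castSucc
  have n0 := nice_gmean (P0 := P0) (lam := lam) hsupp L j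
  have n0i := nice_gmean (P0 := P0) (lam := lam) hsupp L i
  have n1 := nice_gmean (P0 := P0) (lam := lam) hsupp L' j
  have nT := nice_gcov (P0 := P0) (lam := lam) hsupp L i j
  have aT := adapted_gcov (P0 := P0) (S := S) hlam L i j
  have nX : Nice S (n := n) fun X _ => X i.castSucc := nice_signal _
  have e1 := nishimori_mul hsupp hlam L' (fun x => x j) (nX.mul nT)
    ((adapted_signal (by simp [hL'])).mul (aT.mono hL))
  have e2 := nishimori_mul hsupp hlam L (fun x => x i * x j) nT aT
  have e3 := nishimori_mul hsupp hlam L (fun x => x i) (n0.mul nT) ((adapted_gmean hlam L j).mul aT)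
  have nm := nice_gibbs_const (P0 := P0) (lam := lam) hsupp L fun x => x i * x j
  have key : qexp P0 S n (fun X Z => gcov P0 S n lam L i j X Z ^ 2)
      = qexp P0 S n fun X Z => (gmean P0 S n lam L' j X Z - gmean P0 S n lam L j X Z)
        * (X i.castSucc * gcov P0 S n lam L i j X Z) := by
    calc _ = qexp P0 S n (fun X Z => gibbs P0 S n lam (X, Z, L, 0) (fun x => x i * x j)
          * gcov P0 S n lam L i j X Z) - qexp P0 S n (fun X Z => gmean P0 S n lam L i X Z *
            (gmean P0 S n lam L j X Z * gcov P0 S n lam L i j X Z)) := by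
          rw [← qexp_sub (nm.mul nT) (n0i.mul (n0.mul nT))]
          refine qexp_congr fun X _ Z => ?_
          unfold gcov
          ring
      _ = qexp P0 S n (fun X Z => gmean P0 S n lam L' j X Z *
            (X i.castSucc * gcov P0 S n lam L i j X Z))
          - qexp P0 S n (fun X Z => X i.castSucc *
            (gmean P0 S n lam L j X Z * gcov P0 S n lam L i j X Z)) := by
          congr 1
          · refine Eq.trans (e2.symm.trans ?_) e1
            exact qexp_congr fun X _ Z => by ring
          · exact e3.symm
      _ = _ := by
          rw [← qexp_sub (n1.mul (nX.mul nT)) (nX.mul (n0.mul nT))]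
          exact qexp_congr fun X _ Z => by ring
  have hle : qexp P0 S n (fun X Z => gcov P0 S n lam L i j X Z ^ 2)
      ≤ qexp P0 S n fun X Z => (K ^ 2 / 2) * (gmean P0 S n lam L' j X Z
        - gmean P0 S n lam L j X Z) ^ 2 + (1 / 2) * gcov P0 S n lam L i j X Z ^ 2 := by
    rw [key]
    refine qexp_mono ((n1.sub n0).mul (nX.mul nT)) (((nice_signal fun _ => K ^ 2 / 2).mul
      ((n1.sub n0).pow 2)).add ((nice_signal fun _ => 1 / 2).mul (nT.pow 2))) fun X hX Z => ?_
    have hx : X i.castSucc ^ 2 ≤ K ^ 2 := by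
      have := hSK _ (mem_confs.1 hX i.castSucc)
      exact sq_le_sq' (by linarith [neg_abs_le (X i.castSucc)]) ((le_abs_self _).trans this)
    set d := gmean P0 S n lam L' j X Z - gmean P0 S n lam L j X Z
    set T := gcov P0 S n lam L i j X Z
    nlinarith [sq_nonneg (d * X i.castSucc - T), mul_le_mul_of_nonneg_left hx (sq_nonneg d)]
  rw [qexp_add ((nice_signal fun _ => K ^ 2 / 2).mul ((n1.sub n0).pow 2))
    ((nice_signal fun _ => 1 / 2).mul (nT.pow 2)), qexp_const_mul, qexp_const_mul] at hle
  linarith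

end Pinning

section Labels

/-- The probability of a label configuration under i.i.d. Bernoulli(ε) labels. -/
def labelProb {m : ℕ} (ε : ℝ) (L : Fin m → Bool) : ℝ := ∏ i, if L i then ε else 1 - ε

lemma labelProb_nonneg {m : ℕ} {ε : ℝ} (h0 : 0 ≤ ε) (h1 : ε ≤ 1) (L : Fin m → Bool) :
    0 ≤ labelProb ε L :=
  Finset.prod_nonneg fun i _ => by split_ifs <;> linarith

lemma sum_labelProb (m : ℕ) (ε : ℝ) : ∑ L : Fin m → Bool, labelProb ε L = 1 := by
  unfold labelProb
  have := Finset.prod_univ_sum (fun _ : Fin m => (Finset.univ : Finset Bool))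
    (fun _ l => if l then ε else 1 - ε)
  simp only [Fintype.piFinset_univ] at this
  rw [← this]
  simp

/-- Flip the `i`-th label. -/
def flipAt {m : ℕ} (i : Fin m) (L : Fin m → Bool) : Fin m → Bool :=
  Function.update L i (!(L i))

lemma flipAt_involutive {m : ℕ} (i : Fin m) : Function.Involutive (flipAt i) := by
  intro L
  simp [flipAt]

/-- The sign of the derivative of the probability of a label. -/
def labelSign (b : Bool) : ℝ := if b then 1 else -1

lemma sum_prod_erase_labelSign {m : ℕ} (ε : ℝ) (i : Fin m) (Φ : (Fin m → Bool) → ℝ) :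
    ∑ L : Fin m → Bool, (∏ k ∈ Finset.univ.erase i, if L k then ε else 1 - ε)
        * labelSign (L i) * Φ L
      = ∑ L : Fin m → Bool, labelProb ε L * (labelSign (L i) * (Φ L - Φ (flipAt i L))) := by
  set e : (Fin m → Bool) → ℝ := fun L => ∏ k ∈ Finset.univ.erase i, if L k then ε else 1 - ε
    with he
  have hP : ∀ L : Fin m → Bool, labelProb ε L = (if L i then ε else 1 - ε) * e L := fun L =>
    (Finset.mul_prod_erase Finset.univ (fun k => if L k then ε else 1 - ε)
      (Finset.mem_univ i)).symm
  have hflip : ∀ L, e (flipAt i L) = e L := fun L => by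
    refine Finset.prod_congr rfl fun k hk => ?_
    rw [flipAt, Function.update_of_ne (Finset.ne_of_mem_erase hk)]
  have h2 : ∑ L : Fin m → Bool, labelProb ε L * (labelSign (L i) * Φ (flipAt i L))
      = ∑ L : Fin m → Bool, -((if L i then 1 - ε else ε) * e L * (labelSign (L i) * Φ L)) := by
    rw [← Equiv.sum_comp (flipAt_involutive i).toPerm]
    refine Finset.sum_congr rfl fun L _ => ?_
    rw [Function.Involutive.coe_toPerm, flipAt_involutive, hP, hflip]
    have : flipAt i L i = !(L i) := by simp [flipAt]
    rw [this]
    cases L i <;> simp [labelSign]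
  simp_rw [mul_sub, Finset.sum_sub_distrib]
  rw [h2, ← Finset.sum_sub_distrib]
  refine Finset.sum_congr rfl fun L _ => ?_
  rw [hP]
  cases L i <;> simp [labelSign] <;> ring

lemma hasDerivAt_sum_labelProb {m : ℕ} (Φ : (Fin m → Bool) → ℝ) (ε : ℝ) :
    HasDerivAt (fun ε => ∑ L : Fin m → Bool, labelProb ε L * Φ L)
      (∑ i, ∑ L : Fin m → Bool, labelProb ε L * (labelSign (L i) * (Φ L - Φ (flipAt i L)))) ε := by
  have h1 : ∀ L : Fin m → Bool, HasDerivAt (fun ε => labelProb ε L)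
      (∑ i, (∏ k ∈ Finset.univ.erase i, if L k then ε else 1 - ε) * labelSign (L i)) ε := by
    intro L
    unfold labelProb
    refine HasDerivAt.fun_finsetProd (u := Finset.univ)
      (f := fun i ε => if L i then ε else 1 - ε) (f' := fun i => labelSign (L i)) fun i _ => ?_
    cases L i
    · simpa [labelSign] using (hasDerivAt_id ε).const_sub 1
    · simp only [labelSign, if_true]
      exact hasDerivAt_id' ε
  have h2 := HasDerivAt.fun_sum (u := Finset.univ) fun (L : Fin m → Bool) _ =>
    (h1 L).mul_const (Φ L)
  refine h2.congr_deriv ?_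
  rw [Finset.sum_congr rfl fun i _ => (sum_prod_erase_labelSign ε i Φ).symm, Finset.sum_comm]
  exact Finset.sum_congr rfl fun L _ => Finset.sum_mul _ _ _

lemma continuous_labelProb {m : ℕ} (L : Fin m → Bool) : Continuous fun ε => labelProb ε L := by
  unfold labelProb
  refine continuous_finsetProd _ fun i _ => ?_
  split_ifs <;> fun_prop

end Labels

section IntegratedPinning

variable {P0 : Measure ℝ} [IsProbabilityMeasure P0] {S : Finset ℝ} {n : ℕ} {lam K : ℝ}

variable (P0 S n lam) in
/-- The mean over labels of the average squared two-point correlation. -/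
def covAverage (ε : ℝ) : ℝ :=
  ∑ L : Fin (n + 1) → Bool, labelProb ε L * qexp P0 S n fun X Z =>
    (1 / n : ℝ) ^ 2 * ∑ i, ∑ j, gcov P0 S n lam L i j X Z ^ 2

omit [IsProbabilityMeasure P0] in
lemma continuous_covAverage : Continuous (covAverage P0 S n lam) :=
  continuous_finsetSum _ fun L _ => (continuous_labelProb L).mul continuous_const

variable (hsupp : P0 ((↑S : Set ℝ)ᶜ) = 0)
include hsupp

lemma labelSign_mul_nonneg (hlam : 0 ≤ lam) (L : Fin (n + 1) → Bool) (i : Fin (n + 1))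
    (j : Fin n) : 0 ≤ labelSign (L i) * (secondMoment P0 S n lam j L
      - secondMoment P0 S n lam j (flipAt i L)) := by
  cases h : L i
  · have := secondMoment_le_update (P0 := P0) (S := S) hsupp hlam L i j
    simp only [labelSign, flipAt, h, Bool.not_false]
    simp only [Bool.false_eq_true, if_false]
    linarith
  · have := secondMoment_le_update (P0 := P0) (S := S) hsupp hlam (flipAt i L) i j
    have hL : Function.update (flipAt i L) i true = L := by
      rw [flipAt, Function.update_idem, ← h, Function.update_eq_self]
    rw [hL] at this
    simp only [labelSign, if_true]
    linarith

lemma qexp_gcov_sq_le_flip (hlam : 0 ≤ lam) (hSK : ∀ x ∈ S, |x| ≤ K) (L : Fin (n + 1) → Bool)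
    (i j : Fin n) : qexp P0 S n (fun X Z => gcov P0 S n lam L i j X Z ^ 2)
      ≤ K ^ 2 * (labelSign (L i.castSucc) * (secondMoment P0 S n lam j L
        - secondMoment P0 S n lam j (flipAt i.castSucc L))) := by
  cases h : L i.castSucc
  · refine (qexp_gcov_sq_le hsupp hlam hSK i j).trans_eq ?_
    simp only [labelSign, flipAt, h, Bool.not_false]
    simp only [Bool.false_eq_true, if_false]
    ring
  · simp_rw [gcov_eq_zero hsupp h]
    rw [← h]
    refine le_trans (le_of_eq ?_) (mul_nonneg (sq_nonneg K) (labelSign_mul_nonneg hsupp hlam L _ j))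
    rw [zero_pow two_ne_zero]
    exact qexp_const hsupp 0

lemma secondMoment_mem (hSK : ∀ x ∈ S, |x| ≤ K) (L : Fin (n + 1) → Bool) (j : Fin n) :
    0 ≤ secondMoment P0 S n lam j L ∧ secondMoment P0 S n lam j L ≤ K ^ 2 := by
  have hn := (nice_gmean (P0 := P0) (lam := lam) hsupp L j).pow 2
  constructor
  · rw [← qexp_const (n := n) hsupp 0]
    exact qexp_mono (nice_signal fun _ => 0) hn fun _ _ _ => sq_nonneg _
  · rw [← qexp_const (n := n) hsupp (K ^ 2)]
    refine qexp_mono hn (nice_signal fun _ => K ^ 2) fun X hX Z => ?_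
    have := abs_gmean_le (lam := lam) hsupp hSK L j hX Z
    exact sq_le_sq' (by linarith [neg_abs_le (gmean P0 S n lam L j X Z)])
      ((le_abs_self _).trans this)

lemma covAverage_le_deriv (hlam : 0 ≤ lam) (hSK : ∀ x ∈ S, |x| ≤ K) {ε : ℝ} (h0 : 0 ≤ ε)
    (h1 : ε ≤ 1) :
    covAverage P0 S n lam ε ≤ (1 / n : ℝ) ^ 2 * K ^ 2 * ∑ j : Fin n, ∑ i,
      ∑ L : Fin (n + 1) → Bool, labelProb ε L * (labelSign (L i) *
        (secondMoment P0 S n lam j L - secondMoment P0 S n lam j (flipAt i L))) := by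
  have hN : ∀ (L : Fin (n + 1) → Bool) (i j : Fin n),
      Nice S fun X Z => gcov P0 S n lam L i j X Z ^ 2 := fun L i j => (nice_gcov hsupp L i j).pow 2
  have e1 : covAverage P0 S n lam ε = (1 / n : ℝ) ^ 2 * ∑ j : Fin n, ∑ i : Fin n,
      ∑ L : Fin (n + 1) → Bool, labelProb ε L *
        qexp P0 S n fun X Z => gcov P0 S n lam L i j X Z ^ 2 := by
    unfold covAverage
    simp_rw [qexp_const_mul]
    have : ∀ L, qexp P0 S n (fun X Z => ∑ i, ∑ j, gcov P0 S n lam L i j X Z ^ 2)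
        = ∑ i, ∑ j, qexp P0 S n (fun X Z => gcov P0 S n lam L i j X Z ^ 2) := by
      intro L
      rw [qexp_sum fun i _ => nice_sum fun j _ => hN L i j]
      exact Finset.sum_congr rfl fun i _ => qexp_sum fun j _ => hN L i j
    simp_rw [this, Finset.mul_sum]
    rw [Finset.sum_comm, Finset.sum_congr rfl fun i _ => Finset.sum_comm, Finset.sum_comm]
    exact Finset.sum_congr rfl fun j _ => Finset.sum_congr rfl fun i _ =>
      Finset.sum_congr rfl fun L _ => mul_left_comm _ _ _
  rw [e1, mul_assoc]
  refine mul_le_mul_of_nonneg_left ?_ (by positivity)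
  rw [Finset.mul_sum]
  refine Finset.sum_le_sum fun j _ => ?_
  rw [Fin.sum_univ_castSucc, mul_add, Finset.mul_sum]
  refine le_add_of_le_of_nonneg (Finset.sum_le_sum fun i _ => ?_) ?_
  · rw [Finset.mul_sum]
    refine Finset.sum_le_sum fun L _ => ?_
    rw [mul_left_comm]
    exact mul_le_mul_of_nonneg_left (qexp_gcov_sq_le_flip hsupp hlam hSK L i j)
      (labelProb_nonneg h0 h1 L)
  · exact mul_nonneg (sq_nonneg K) (Finset.sum_nonneg fun L _ =>
      mul_nonneg (labelProb_nonneg h0 h1 L) (labelSign_mul_nonneg hsupp hlam L _ j))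

lemma integral_covAverage_le (hlam : 0 ≤ lam) (hSK : ∀ x ∈ S, |x| ≤ K) {ε₀ : ℝ} (h0 : 0 ≤ ε₀)
    (h1 : ε₀ ≤ 1) : ∫ ε in (0 : ℝ)..ε₀, covAverage P0 S n lam ε ≤ K ^ 4 / n := by
  set φ : Fin n → ℝ → ℝ := fun j ε =>
    ∑ L : Fin (n + 1) → Bool, labelProb ε L * secondMoment P0 S n lam j L with hφ
  set φ' : Fin n → ℝ → ℝ := fun j ε => ∑ i, ∑ L : Fin (n + 1) → Bool, labelProb ε L *
    (labelSign (L i) * (secondMoment P0 S n lam j L - secondMoment P0 S n lam j (flipAt i L)))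
    with hφ'
  have hc : ∀ j, Continuous (φ' j) := fun j => continuous_finsetSum _ fun i _ =>
    continuous_finsetSum _ fun L _ => (continuous_labelProb L).mul continuous_const
  have hI : ∀ j, ∫ ε in (0 : ℝ)..ε₀, φ' j ε ≤ K ^ 2 := by
    intro j
    rw [intervalIntegral.integral_eq_sub_of_hasDerivAt (f := φ j)
      (fun ε _ => hasDerivAt_sum_labelProb _ ε) ((hc j).intervalIntegrable _ _)]
    have b1 : φ j ε₀ ≤ K ^ 2 := by
      calc φ j ε₀ ≤ ∑ L : Fin (n + 1) → Bool, labelProb ε₀ L * K ^ 2 :=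
            Finset.sum_le_sum fun L _ => mul_le_mul_of_nonneg_left
              (secondMoment_mem hsupp hSK L j).2 (labelProb_nonneg h0 h1 L)
        _ = K ^ 2 := by rw [← Finset.sum_mul, sum_labelProb, one_mul]
    have b0 : 0 ≤ φ j 0 := Finset.sum_nonneg fun L _ =>
      mul_nonneg (labelProb_nonneg le_rfl zero_le_one L) (secondMoment_mem hsupp hSK L j).1
    linarith
  calc ∫ ε in (0 : ℝ)..ε₀, covAverage P0 S n lam ε
      ≤ ∫ ε in (0 : ℝ)..ε₀, (1 / n : ℝ) ^ 2 * K ^ 2 * ∑ j : Fin n, φ' j ε :=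
        intervalIntegral.integral_mono_on h0 (continuous_covAverage.intervalIntegrable _ _)
          ((continuous_const.mul (continuous_finsetSum _ fun j _ => hc j)).intervalIntegrable _ _)
          fun ε hε => covAverage_le_deriv hsupp hlam hSK hε.1 (hε.2.trans h1)
    _ = (1 / n : ℝ) ^ 2 * K ^ 2 * ∑ j : Fin n, ∫ ε in (0 : ℝ)..ε₀, φ' j ε := by
        rw [intervalIntegral.integral_const_mul,
          intervalIntegral.integral_finsetSum fun j _ => (hc j).intervalIntegrable _ _]
    _ ≤ (1 / n : ℝ) ^ 2 * K ^ 2 * ∑ j : Fin n, K ^ 2 :=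
        mul_le_mul_of_nonneg_left (Finset.sum_le_sum fun j _ => hI j) (by positivity)
    _ = K ^ 4 / n := by
        rcases Nat.eq_zero_or_pos n with h | h
        · subst h; simp
        · simp; field_simp

end IntegratedPinning

section FiniteExpectation

variable {P0 : Measure ℝ} [IsProbabilityMeasure P0] {S : Finset ℝ} {n : ℕ} {lam K : ℝ}

lemma integral_pi_eq_sum_confs (hsupp : P0 ((↑S : Set ℝ)ᶜ) = 0) (m : ℕ) (f : (Fin m → ℝ) → ℝ) :
    ∫ X, f X ∂(Measure.pi fun _ : Fin m => P0) = ∑ X ∈ confs S m, weight P0 m X * f X := by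
  rw [← Measure.restrict_eq_self_of_ae_mem (s := (confs S m : Set (Fin m → ℝ)))
    (ae_mem_confs hsupp m), setIntegral_finset _ IntegrableOn.finset]
  refine Finset.sum_congr rfl fun X _ => ?_
  rw [smul_eq_mul, Measure.real, Measure.pi_singleton, ENNReal.toReal_prod]
  rfl

lemma integral_pi_bern {ε : ℝ} (h0 : 0 ≤ ε) (h1 : ε ≤ 1) (m : ℕ) (f : (Fin m → Bool) → ℝ) :
    ∫ L, f L ∂(Measure.pi fun _ : Fin m => bern ε) = ∑ L, labelProb ε L * f L := by
  have := isProbabilityMeasure_bern h0 h1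
  rw [integral_fintype .of_finite]
  refine Finset.sum_congr rfl fun L _ => ?_
  rw [smul_eq_mul, Measure.real, Measure.pi_singleton, ENNReal.toReal_prod]
  congr 1
  refine Finset.prod_congr rfl fun i _ => ?_
  cases L i <;> simp [bern, h0, h1]

lemma integrable_cavMeas_of_bound (hsupp : P0 ((↑S : Set ℝ)ᶜ) = 0) {ε : ℝ}
    [IsProbabilityMeasure (bern ε)] {F : CavΩ n → ℝ} (hm : Measurable F) {C : ℝ}
    (hC : ∀ ω : CavΩ n, ω.1 ∈ confs S (n + 1) → |F ω| ≤ C) : Integrable F (cavMeas P0 n ε) :=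
  .of_bound hm.aestronglyMeasurable C
    ((ae_cavMeas_mem_confs hsupp).mono fun ω hω => hC ω hω)

/-- Bounded observables of `(X, Z, L)` are averaged by summing over labels and signals. -/
lemma integral_cavMeas_eq (hsupp : P0 ((↑S : Set ℝ)ᶜ) = 0) {ε : ℝ} (h0 : 0 ≤ ε) (h1 : ε ≤ 1)
    {F : CavΩ n → ℝ} (hm : Measurable F) (hF : ∀ X Z L a, F (X, Z, L, a) = F (X, Z, L, 0)) {C : ℝ}
    (hC : ∀ ω : CavΩ n, ω.1 ∈ confs S (n + 1) → |F ω| ≤ C) :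
    ∫ ω, F ω ∂cavMeas P0 n ε
      = ∑ L, labelProb ε L * qexp P0 S n fun X Z => F (X, Z, L, 0) := by
  have := isProbabilityMeasure_bern h0 h1
  have hi := integrable_cavMeas_of_bound (ε := ε) hsupp hm hC
  rw [cavMeas_eq_prod] at hi ⊢
  rw [integral_prod _ hi, integral_pi_eq_sum_confs hsupp]
  unfold qexp
  simp_rw [Finset.mul_sum]
  rw [Finset.sum_comm]
  refine Finset.sum_congr rfl fun X hX => ?_
  have hiX : Integrable (fun p => F (X, p)) (noiseMeas n ε) :=
    .of_bound (hm.comp measurable_prodMk_left).aestronglyMeasurable C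
      (ae_of_all _ fun p => hC (X, p) hX)
  have hlab : ∀ Z, ∫ p, F (X, Z, p) ∂labelMeas n ε = ∑ L, labelProb ε L * F (X, Z, L, 0) := by
    intro Z
    have hiZ : Integrable (fun p => F (X, Z, p)) (labelMeas n ε) :=
      .of_bound (hm.comp (measurable_prodMk_left.comp measurable_prodMk_left)).aestronglyMeasurable
        C (ae_of_all _ fun p => hC (X, Z, p) hX)
    unfold labelMeas at hiZ ⊢
    rw [integral_prod _ hiZ]
    simp_rw [fun L a => hF X Z L a, integral_const]
    simp only [probReal_univ, one_smul]
    exact integral_pi_bern h0 h1 _ _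
  unfold noiseMeas at hiX ⊢
  rw [integral_prod _ hiX]
  simp_rw [hlab]
  rw [integral_finsetSum, Finset.mul_sum]
  · refine Finset.sum_congr rfl fun L _ => ?_
    rw [integral_const_mul]; ring
  · intro L _
    refine Integrable.const_mul (.of_bound (Measurable.aestronglyMeasurable ?_) C
      (ae_of_all _ fun Z => hC (X, Z, L, 0) hX)) _
    fun_prop

end FiniteExpectation

section Overlap

/-- For weights on vectors, the fluctuation of the overlap of two replicas is controlled by the
truncated two-point correlations. -/
lemma sum_sq_overlap_le {α : Type*} {A : Finset α} {w : α → ℝ} (hw : ∀ a ∈ A, 0 ≤ w a)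
    (hw1 : ∑ a ∈ A, w a = 1) {n : ℕ} {v : α → Fin n → ℝ} {K : ℝ} (hK : 0 ≤ K)
    (hv : ∀ a ∈ A, ∀ i, |v a i| ≤ K) {b : Fin n → ℝ} (hb : ∀ i, b i = ∑ a ∈ A, w a * v a i)
    {η : ℝ} (hη : 0 < η) :
    ∑ a ∈ A, w a * ∑ a' ∈ A, w a' * (ndot n (v a') (v a) - ndot n b b) ^ 2
      ≤ 2 * K ^ 2 * (η + ((1 / n : ℝ) ^ 2 *
        ∑ i, ∑ j, (∑ a ∈ A, w a * (v a i * v a j) - b i * b j) ^ 2) / η) := by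
  set m : Fin n → Fin n → ℝ := fun i j => ∑ a ∈ A, w a * (v a i * v a j) with hm
  have hbK : ∀ i, |b i| ≤ K := fun i => by
    rw [hb]
    calc _ ≤ ∑ a ∈ A, |w a * v a i| := Finset.abs_sum_le_sum_abs _ _
      _ ≤ ∑ a ∈ A, w a * K := Finset.sum_le_sum fun a ha => by
          rw [abs_mul, abs_of_nonneg (hw a ha)]
          exact mul_le_mul_of_nonneg_left (hv a ha i) (hw a ha)
      _ = K := by rw [← Finset.sum_mul, hw1, one_mul]
  have hmK : ∀ i j, |m i j| ≤ K ^ 2 := fun i j => by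
    calc _ ≤ ∑ a ∈ A, |w a * (v a i * v a j)| := Finset.abs_sum_le_sum_abs _ _
      _ ≤ ∑ a ∈ A, w a * K ^ 2 := Finset.sum_le_sum fun a ha => by
          rw [abs_mul, abs_of_nonneg (hw a ha), abs_mul, sq]
          exact mul_le_mul_of_nonneg_left (mul_le_mul (hv a ha i) (hv a ha j) (abs_nonneg _) hK)
            (hw a ha)
      _ = K ^ 2 := by rw [← Finset.sum_mul, hw1, one_mul]
  have hq : ∀ u : Fin n → ℝ, ∀ u' : Fin n → ℝ, ndot n u u' ^ 2
      = (1 / n : ℝ) ^ 2 * ∑ i, ∑ j, (u i * u j) * (u' i * u' j) := by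
    intro u u'
    rw [ndot, mul_pow, sq (∑ i, u i * u' i), Finset.sum_mul_sum]
    simp only [mul_mul_mul_comm]
  have e1 : ∑ a ∈ A, w a * ∑ a' ∈ A, w a' * ndot n (v a') (v a) ^ 2
      = (1 / n : ℝ) ^ 2 * ∑ i, ∑ j, m i j * m i j := by
    have : ∀ i j, m i j * m i j
        = ∑ a ∈ A, ∑ a' ∈ A, w a * (w a' * ((v a' i * v a' j) * (v a i * v a j))) := by
      intro i j
      rw [hm]
      dsimp only
      rw [Finset.sum_mul_sum]
      exact Finset.sum_congr rfl fun a _ => Finset.sum_congr rfl fun a' _ => by ring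
    simp_rw [this, hq, Finset.mul_sum]
    rw [Finset.sum_congr rfl fun a _ => Finset.sum_comm, Finset.sum_comm]
    refine Finset.sum_congr rfl fun i _ => ?_
    rw [Finset.sum_congr rfl fun a _ => Finset.sum_comm, Finset.sum_comm]
    exact Finset.sum_congr rfl fun j _ => Finset.sum_congr rfl fun a _ =>
      Finset.sum_congr rfl fun a' _ => by ring
  have e2 : ∑ a ∈ A, w a * ∑ a' ∈ A, w a' * ndot n (v a') (v a) = ndot n b b := by
    have hlin : ∀ u, ∑ a ∈ A, w a * ndot n (v a) u = ndot n b u := by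
      intro u
      simp_rw [ndot, hb, Finset.mul_sum, Finset.sum_mul]
      rw [Finset.sum_comm]
      simp_rw [Finset.mul_sum]
      exact Finset.sum_congr rfl fun i _ => Finset.sum_congr rfl fun a _ => by ring
    have hcomm : ∀ u u', ndot n u u' = ndot n u' u := fun u u' => by
      simp only [ndot, mul_comm]
    simp_rw [hlin]
    simp_rw [hcomm b, hlin]
  have e3 : ∑ a ∈ A, w a * ∑ a' ∈ A, w a' * (ndot n (v a') (v a) - ndot n b b) ^ 2
      = (1 / n : ℝ) ^ 2 * ∑ i, ∑ j, (m i j * m i j - (b i * b j) * (b i * b j)) := by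
    have hin : ∀ a, ∑ a' ∈ A, w a' * (ndot n (v a') (v a) - ndot n b b) ^ 2
        = ∑ a' ∈ A, w a' * ndot n (v a') (v a) ^ 2
          - 2 * ndot n b b * ∑ a' ∈ A, w a' * ndot n (v a') (v a) + ndot n b b ^ 2 := by
      intro a
      rw [Finset.mul_sum, ← Finset.sum_sub_distrib, ← mul_one (ndot n b b ^ 2), ← hw1,
        Finset.mul_sum, ← Finset.sum_add_distrib]
      exact Finset.sum_congr rfl fun a' _ => by ring
    simp_rw [hin, mul_add, mul_sub, Finset.sum_add_distrib, Finset.sum_sub_distrib]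
    rw [e1, ← Finset.sum_mul, hw1]
    have : ∑ a ∈ A, w a * (2 * ndot n b b * ∑ a' ∈ A, w a' * ndot n (v a') (v a))
        = 2 * ndot n b b * ndot n b b := by
      calc _ = 2 * ndot n b b * ∑ a ∈ A, w a * ∑ a' ∈ A, w a' * ndot n (v a') (v a) := by
            rw [Finset.mul_sum]
            exact Finset.sum_congr rfl fun a _ => by ring
        _ = _ := by rw [e2]
    rw [this]
    have h2 := hq b b
    rw [mul_sub, ← h2]
    ring
  rw [e3]
  calc _ ≤ (1 / n : ℝ) ^ 2 * ∑ i : Fin n, ∑ j : Fin n,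
        (2 * K ^ 2 * η + 2 * K ^ 2 / η * (m i j - b i * b j) ^ 2) := by
        refine mul_le_mul_of_nonneg_left (Finset.sum_le_sum fun i _ =>
          Finset.sum_le_sum fun j _ => ?_) (by positivity)
        have hbb : |b i * b j| ≤ K ^ 2 := by
          rw [abs_mul, sq]; exact mul_le_mul (hbK i) (hbK j) (abs_nonneg _) hK
        set d := m i j - b i * b j with hd
        have hsum : |m i j + b i * b j| ≤ 2 * K ^ 2 := (abs_add_le _ _).trans (by linarith [hmK i j])
        have h1 : m i j * m i j - b i * b j * (b i * b j) ≤ |d| * (2 * K ^ 2) := by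
          calc _ = d * (m i j + b i * b j) := by rw [hd]; ring
            _ ≤ |d * (m i j + b i * b j)| := le_abs_self _
            _ ≤ _ := by rw [abs_mul]; exact mul_le_mul_of_nonneg_left hsum (abs_nonneg _)
        have h2 : |d| ≤ η + d ^ 2 / η := by
          rw [← sq_abs d]
          have : η + |d| ^ 2 / η - |d| = ((|d| - η / 2) ^ 2 + 3 / 4 * η ^ 2) / η := by
            field_simp; ring
          have : 0 ≤ ((|d| - η / 2) ^ 2 + 3 / 4 * η ^ 2) / η := by positivity
          linarith
        calc _ ≤ |d| * (2 * K ^ 2) := h1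
          _ ≤ (η + d ^ 2 / η) * (2 * K ^ 2) := mul_le_mul_of_nonneg_right h2 (by positivity)
          _ = _ := by ring
    _ ≤ _ := by
        simp_rw [Finset.sum_add_distrib, ← Finset.mul_sum]
        simp only [Finset.sum_const, Finset.card_univ, Fintype.card_fin, nsmul_eq_mul]
        rcases Nat.eq_zero_or_pos n with h | h
        · subst h; simp; positivity
        · apply le_of_eq
          simp only [hm]
          field_simp

variable (P0 : Measure ℝ) (S : Finset ℝ) (n : ℕ) (lam : ℝ)

/-- The fluctuation of the overlap of two replicas around `Q`. -/
def replicaVar (ω : CavΩ n) : ℝ :=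
  gibbs P0 S n lam ω fun c => gibbs P0 S n lam ω fun x =>
    (ndot n x c - Qoverlap P0 S n lam ω) ^ 2

/-- The fluctuation of the overlap of a replica with the signal around `Q`. -/
def signalVar (ω : CavΩ n) : ℝ :=
  gibbs P0 S n lam ω fun x =>
    (ndot n x (fun i => ω.1 i.castSucc) - Qoverlap P0 S n lam ω) ^ 2

variable {P0 S n lam}

lemma measurable_signalVar : Measurable (signalVar P0 S n lam) := by
  refine measurable_gibbs fun x => ?_
  have h1 := fun i => measurable_xbar_apply (n := n) x i
  have h2 := measurable_Qoverlap (P0 := P0) (S := S) (n := n) (lam := lam)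
  unfold ndot
  fun_prop

lemma measurable_replicaVar : Measurable (replicaVar P0 S n lam) := by
  refine measurable_gibbs fun c => measurable_gibbs fun x => ?_
  have h1 := fun i => measurable_xbar_apply (n := n) x i
  have h3 := fun i => measurable_xbar_apply (n := n) c i
  have h2 := measurable_Qoverlap (P0 := P0) (S := S) (n := n) (lam := lam)
  unfold ndot
  fun_prop

variable [IsProbabilityMeasure P0] (hsupp : P0 ((↑S : Set ℝ)ᶜ) = 0)
include hsupp

lemma abs_sq_ndot_sub_Qoverlap_le {K : ℝ} (hK : 0 ≤ K) (hSK : ∀ x ∈ S, |x| ≤ K) {ω : CavΩ n}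
    (hω : ω.1 ∈ confs S (n + 1)) {u v : Fin n → ℝ} (hu : ∀ i, |u i| ≤ K) (hv : ∀ i, |v i| ≤ K) :
    |(ndot n u v - Qoverlap P0 S n lam ω) ^ 2| ≤ (2 * K ^ 2) ^ 2 := by
  rw [abs_pow]
  refine pow_le_pow_left₀ (abs_nonneg _) ((abs_sub _ _).trans ?_) 2
  linarith [abs_ndot_le hK hu hv, abs_Qoverlap_le (lam := lam) hsupp hK hSK hω]

lemma abs_signalVar_le {K : ℝ} (hK : 0 ≤ K) (hSK : ∀ x ∈ S, |x| ≤ K) {ω : CavΩ n}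
    (hω : ω.1 ∈ confs S (n + 1)) : |signalVar P0 S n lam ω| ≤ (2 * K ^ 2) ^ 2 :=
  abs_gibbs_le hsupp hω fun _ hc => abs_sq_ndot_sub_Qoverlap_le hsupp hK hSK hω
    (fun i => hSK _ (mem_confs.1 hc i)) fun _ => hSK _ (mem_confs.1 hω _)

lemma abs_replicaVar_le {K : ℝ} (hK : 0 ≤ K) (hSK : ∀ x ∈ S, |x| ≤ K) {ω : CavΩ n}
    (hω : ω.1 ∈ confs S (n + 1)) : |replicaVar P0 S n lam ω| ≤ (2 * K ^ 2) ^ 2 :=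
  abs_gibbs_le hsupp hω fun _ hc => abs_gibbs_le hsupp hω fun _ hc' =>
    abs_sq_ndot_sub_Qoverlap_le hsupp hK hSK hω
      (fun i => hSK _ (mem_confs.1 hc' i)) fun i => hSK _ (mem_confs.1 hc i)

lemma integral_signalVar (hlam : 0 ≤ lam) {K : ℝ} (hK : 0 ≤ K) (hSK : ∀ x ∈ S, |x| ≤ K) {ε : ℝ}
    (h0 : 0 ≤ ε) (h1 : ε ≤ 1) :
    ∫ ω, signalVar P0 S n lam ω ∂cavMeas P0 n ε = ∫ ω, replicaVar P0 S n lam ω ∂cavMeas P0 n ε := by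
  rw [integral_cavMeas_eq hsupp h0 h1 measurable_signalVar (fun _ _ _ _ => rfl)
      fun ω hω => abs_signalVar_le hsupp hK hSK hω,
    integral_cavMeas_eq hsupp h0 h1 measurable_replicaVar (fun _ _ _ _ => rfl)
      fun ω hω => abs_replicaVar_le hsupp hK hSK hω]
  refine Finset.sum_congr rfl fun L _ => ?_
  congr 1
  have nQ : Nice S fun X Z => Qoverlap P0 S n lam (X, Z, L, 0) :=
    (nice_signal fun _ => (1 / n : ℝ)).mul (nice_sum fun i _ => (nice_gmean hsupp L i).pow 2)
  have aQ : Adapted lam L fun X Z => Qoverlap P0 S n lam (X, Z, L, 0) :=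
    (adapted_const L (1 / n : ℝ)).mul
      (adapted_sum fun i _ => (adapted_gmean hlam L i).comp fun t => t ^ 2)
  exact nishimori hsupp hlam L (Ψ := fun c X Z => gibbs P0 S n lam (X, Z, L, 0) fun x =>
      (ndot n x c - Qoverlap P0 S n lam (X, Z, L, 0)) ^ 2)
    (fun c _ => nice_gibbs hsupp L (Ψ := fun x X Z =>
      (ndot n x c - Qoverlap P0 S n lam (X, Z, L, 0)) ^ 2) fun x _ =>
        ((nice_signal fun _ => ndot n x c).sub nQ).pow 2)
    fun c => adapted_gibbs hlam L (Ψ := fun x X Z =>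
      (ndot n x c - Qoverlap P0 S n lam (X, Z, L, 0)) ^ 2) fun x =>
        ((adapted_const L (ndot n x c)).sub aQ).comp fun t => t ^ 2

lemma integral_replicaVar_le {K : ℝ} (hK : 0 ≤ K) (hSK : ∀ x ∈ S, |x| ≤ K) {ε : ℝ}
    (h0 : 0 ≤ ε) (h1 : ε ≤ 1) {η : ℝ} (hη : 0 < η) :
    ∫ ω, replicaVar P0 S n lam ω ∂cavMeas P0 n ε
      ≤ 2 * K ^ 2 * (η + covAverage P0 S n lam ε / η) := by
  rw [integral_cavMeas_eq hsupp h0 h1 measurable_replicaVar (fun _ _ _ _ => rfl)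
      fun ω hω => abs_replicaVar_le hsupp hK hSK hω]
  have hL : ∀ L, qexp P0 S n (fun X Z => replicaVar P0 S n lam (X, Z, L, 0))
      ≤ 2 * K ^ 2 * η + 2 * K ^ 2 / η * qexp P0 S n fun X Z =>
        (1 / n : ℝ) ^ 2 * ∑ i, ∑ j, gcov P0 S n lam L i j X Z ^ 2 := by
    intro L
    have nG : Nice S fun X Z => (1 / n : ℝ) ^ 2 * ∑ i, ∑ j, gcov P0 S n lam L i j X Z ^ 2 :=
      (nice_signal fun _ => (1 / n : ℝ) ^ 2).mul
        (nice_sum fun i _ => nice_sum fun j _ => (nice_gcov hsupp L i j).pow 2)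
    rw [← qexp_const (P0 := P0) (n := n) hsupp (2 * K ^ 2 * η), ← qexp_const_mul,
      ← qexp_add (nice_signal fun _ => 2 * K ^ 2 * η) ((nice_signal fun _ => 2 * K ^ 2 / η).mul nG)]
    refine qexp_mono (fun X hX => ⟨?_, (2 * K ^ 2) ^ 2, fun Z =>
      abs_replicaVar_le (ω := (X, Z, L, 0)) hsupp hK hSK hX⟩)
      ((nice_signal fun _ => 2 * K ^ 2 * η).add ((nice_signal fun _ => 2 * K ^ 2 / η).mul nG))
      fun X hX Z => ?_
    · exact measurable_replicaVar.comp (by fun_prop)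
    · have := sum_sq_overlap_le (A := confs S n)
        (w := gweight P0 S n lam (X, Z, L, 0)) (fun x _ => gweight_nonneg hsupp _ x)
        (sum_gweight hsupp _) (v := xbar n (X, Z, L, 0)) hK
        (fun x hx _ => hSK _ (mem_confs.1 (xbar_mem (ω := (X, Z, L, 0)) hX hx) _))
        (b := bcoef P0 S n lam (X, Z, L, 0)) (fun i => gibbs_eq_sum _ _) hη
      simp only [replicaVar, gcov, gmean, gibbs_eq_sum, Qoverlap_eq_ndot]
      refine this.trans_eq ?_
      ring
  calc _ ≤ ∑ L : Fin (n + 1) → Bool, labelProb ε L * (2 * K ^ 2 * η + 2 * K ^ 2 / η *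
        qexp P0 S n fun X Z => (1 / n : ℝ) ^ 2 * ∑ i, ∑ j, gcov P0 S n lam L i j X Z ^ 2) :=
        Finset.sum_le_sum fun L _ => mul_le_mul_of_nonneg_left (hL L) (labelProb_nonneg h0 h1 L)
    _ = 2 * K ^ 2 * η * ∑ L : Fin (n + 1) → Bool, labelProb ε L
        + 2 * K ^ 2 / η * covAverage P0 S n lam ε := by
        rw [covAverage, Finset.mul_sum, Finset.mul_sum, ← Finset.sum_add_distrib]
        exact Finset.sum_congr rfl fun L _ => by ring
    _ = _ := by rw [sum_labelProb]; ring

end Overlap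

section Subfamily

variable {E ι κ : Type*} [MeasurableSpace E] [Fintype ι] [Fintype κ]

lemma IsStdGaussFam.subfamily {γ : Measure E} {g : ι → E → ℝ} (hg : IsStdGaussFam γ g)
    {f : κ → ι} (hf : Function.Injective f) : IsStdGaussFam γ fun k => g (f k) := by
  have h : ∀ (t : κ → ℝ) (φ : ι → ℝ), (∀ k, φ (f k) = t k) → (∀ i ∉ Set.range f, φ i = 0) →
      ∀ r : ι → ℝ, ∑ k, t k * r (f k) = ∑ i, φ i * r i := fun t φ h1 h2 r =>
    Fintype.sum_of_injective f hf _ _ (fun i hi => by rw [h2 i hi, zero_mul])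
      fun k => by rw [h1 k]
  have hext : ∀ t : κ → ℝ, (∀ k, Function.extend f t 0 (f k) = t k) ∧
      ∀ i ∉ Set.range f, Function.extend f t 0 i = 0 := fun t =>
    ⟨fun k => hf.extend_apply t 0 k, fun i hi => Function.extend_apply' _ _ _ hi⟩
  refine ⟨fun k => hg.measurable (f k), fun t => ?_, fun t => ?_⟩
  · simp_rw [fun e => h t _ (hext t).1 (hext t).2 fun i => g i e]
    exact hg.integrable _
  · simp_rw [fun e => h t _ (hext t).1 (hext t).2 fun i => g i e]
    rw [hg.integral]
    have := h t _ (hext t).1 (hext t).2 (Function.extend f t 0)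
    simp only [(hext t).1] at this
    rw [this]

end Subfamily

section CavityFamilies

variable (P0 : Measure ℝ) [IsProbabilityMeasure P0] (n : ℕ) (ε : ℝ) [IsProbabilityMeasure (bern ε)]

/-- The Gaussians `Z′_i`. -/
def columnNoise (n : ℕ) (i : Fin n) (ω : CavΩ n) : ℝ := ω.2.1 (i.castSucc, Fin.last n)

/-- The Gaussians `Z″_i` and `Z̃_{i,j}`. -/
def auxNoise (n : ℕ) (k : Fin n ⊕ Fin n × Fin n) (ω : CavΩ n) : ℝ :=
  Sum.elim (fun i => ω.2.2.2.1 i.castSucc) (fun p => ω.2.2.2.2 (p.1.castSucc, p.2.castSucc)) k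

lemma isStdGaussFam_columnNoise : IsStdGaussFam (cavMeas P0 n ε) (columnNoise n) := by
  have h := (isStdGaussFam_pi (Fin (n + 1) × Fin (n + 1))).subfamily
    (f := fun i : Fin n => (i.castSucc, Fin.last n)) fun i j h => by simpa using h
  exact h.comp (f := fun ω : CavΩ n => ω.2.1) (measurePreserving_fst.comp measurePreserving_snd :
    MeasurePreserving _ ((Measure.pi fun _ : Fin (n + 1) => P0).prod (noiseMeas n ε)) _)

lemma isStdGaussFam_auxNoise : IsStdGaussFam (cavMeas P0 n ε) (auxNoise n) := by
  have h1 := (isStdGaussFam_pi (Fin (n + 1))).subfamily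
    (f := fun i : Fin n => i.castSucc) fun i j h => by simpa using h
  have h2 := (isStdGaussFam_pi (Fin (n + 1) × Fin (n + 1))).subfamily
    (f := fun p : Fin n × Fin n => (p.1.castSucc, p.2.castSucc)) fun i j h => by
      simpa [Prod.ext_iff] using h
  have := (h1.prod h2).comp (f := fun ω : CavΩ n => ω.2.2.2)
    ((measurePreserving_snd.comp (measurePreserving_snd.comp measurePreserving_snd)) :
      MeasurePreserving _ ((Measure.pi fun _ : Fin (n + 1) => P0).prod
        ((Measure.pi fun _ => stdGauss).prod ((Measure.pi fun _ => bern ε).prod (auxMeas n)))) _)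
  refine (congrArg (IsStdGaussFam (cavMeas P0 n ε)) ?_).mp this
  funext k ω
  rcases k with i | p <;> rfl

end CavityFamilies

section CavityVectors

variable {n : ℕ} {lam : ℝ}

/-- The coefficients of `σ z(u)` in the Gaussians `Z′`. -/
def columnVec (n : ℕ) (lam s : ℝ) (u : Fin n → ℝ) : Fin n → ℝ := fun i => s * √(lam / n) * u i

/-- The coefficients of `y(u)` in the Gaussians `Z″`, `Z̃`. -/
def auxVec (n : ℕ) (lam : ℝ) (u : Fin n → ℝ) : Fin n ⊕ Fin n × Fin n → ℝ :=
  Sum.elim (fun i => √lam / (√2 * n) * u i ^ 2)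
    (fun p => if p.1 < p.2 then √lam / n * (u p.1 * u p.2) else 0)

lemma dotp_columnVec (hlam : 0 ≤ lam) (s s' : ℝ) (u u' : Fin n → ℝ) :
    dotp (columnVec n lam s u) (columnVec n lam s' u') = lam * (s * s') * ndot n u u' := by
  have h := Real.mul_self_sqrt (div_nonneg hlam n.cast_nonneg : (0 : ℝ) ≤ lam / n)
  unfold dotp columnVec ndot
  calc _ = ∑ i, (√(lam / n) * √(lam / n)) * (s * s' * (u i * u' i)) :=
        Finset.sum_congr rfl fun i _ => by ring
    _ = _ := by rw [h, ← Finset.mul_sum, ← Finset.mul_sum]; ring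

lemma sum_mul_self_eq_pairs (f : Fin n → ℝ) :
    (∑ i, f i) ^ 2 = ∑ i, f i ^ 2 + 2 * ∑ p ∈ pairs n, f p.1 * f p.2 := by
  have h1 : (∑ i, f i) ^ 2 = ∑ p : Fin n × Fin n, f p.1 * f p.2 := by
    rw [sq, Finset.sum_mul_sum, Fintype.sum_prod_type]
  have h2 : ∀ p : Fin n × Fin n, f p.1 * f p.2 = (if p.1 = p.2 then f p.1 * f p.2 else 0)
      + (if p.1 < p.2 then f p.1 * f p.2 else 0) + (if p.2 < p.1 then f p.1 * f p.2 else 0) := by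
    intro p
    rcases lt_trichotomy p.1 p.2 with h | h | h
    · simp [h, h.ne, h.not_gt]
    · simp [h]
    · simp [h, h.ne', h.not_gt]
  rw [h1, Finset.sum_congr rfl fun p _ => h2 p, Finset.sum_add_distrib, Finset.sum_add_distrib]
  have h3 : ∑ p : Fin n × Fin n, (if p.2 < p.1 then f p.1 * f p.2 else 0)
      = ∑ p : Fin n × Fin n, (if p.1 < p.2 then f p.1 * f p.2 else 0) := by
    rw [← Equiv.sum_comp (Equiv.prodComm (Fin n) (Fin n))]
    exact Finset.sum_congr rfl fun p _ => by simp [mul_comm]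
  have h4 : ∑ p : Fin n × Fin n, (if p.1 = p.2 then f p.1 * f p.2 else 0) = ∑ i, f i ^ 2 := by
    rw [Fintype.sum_prod_type]
    exact Finset.sum_congr rfl fun i _ => by simp [sq]
  rw [h3, h4, pairs, Finset.sum_filter]
  ring

lemma dotp_auxVec (hlam : 0 ≤ lam) (u u' : Fin n → ℝ) :
    dotp (auxVec n lam u) (auxVec n lam u') = lam / 2 * ndot n u u' ^ 2 := by
  have h := Real.mul_self_sqrt hlam
  have h2 := Real.mul_self_sqrt (zero_le_two : (0 : ℝ) ≤ 2)
  have e1 : √lam / (√2 * n) * (√lam / (√2 * n)) = lam / 2 * (1 / n) ^ 2 := by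
    rw [div_mul_div_comm, h, mul_mul_mul_comm, h2, div_pow, one_pow]
    ring
  have e2 : √lam / n * (√lam / n) = lam * (1 / n : ℝ) ^ 2 := by
    rw [div_mul_div_comm, h, div_pow, one_pow]
    ring
  unfold dotp auxVec ndot
  rw [Fintype.sum_sum_type, mul_pow, sum_mul_self_eq_pairs, pairs, Finset.sum_filter]
  simp only [Sum.elim_inl, Sum.elim_inr]
  have f1 : ∀ i, √lam / (√2 * n) * u i ^ 2 * (√lam / (√2 * n) * u' i ^ 2)
      = lam / 2 * (1 / n) ^ 2 * (u i * u' i) ^ 2 := fun i => by rw [← e1]; ring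
  have f2 : ∀ p : Fin n × Fin n, ((if p.1 < p.2 then √lam / n * (u p.1 * u p.2) else 0)
      * if p.1 < p.2 then √lam / n * (u' p.1 * u' p.2) else 0)
      = lam * (1 / n) ^ 2 * if p.1 < p.2 then u p.1 * u' p.1 * (u p.2 * u' p.2) else 0 := by
    intro p
    split_ifs
    · rw [← e2]; ring
    · simp
  simp_rw [f1, f2, ← Finset.mul_sum]
  ring

lemma sum_columnVec (s : ℝ) (u : Fin n → ℝ) (ω : CavΩ n) :
    ∑ i, columnVec n lam s u i * columnNoise n i ω
      = s * √(lam / n) * ∑ i : Fin n, u i * ω.2.1 (i.castSucc, Fin.last n) := by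
  rw [Finset.mul_sum]
  exact Finset.sum_congr rfl fun i _ => by simp only [columnVec, columnNoise]; ring

lemma sum_auxVec (u : Fin n → ℝ) (ω : CavΩ n) :
    ∑ k, auxVec n lam u k * auxNoise n k ω
      = √lam / (√2 * n) * ∑ i : Fin n, ω.2.2.2.1 i.castSucc * u i ^ 2
        + √lam / n * ∑ p ∈ pairs n, u p.1 * u p.2 * ω.2.2.2.2 (p.1.castSucc, p.2.castSucc) := by
  rw [Fintype.sum_sum_type, pairs, Finset.sum_filter, Finset.mul_sum, Finset.mul_sum]
  simp only [auxVec, auxNoise, Sum.elim_inl, Sum.elim_inr]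
  congr 1
  · exact Finset.sum_congr rfl fun i _ => by ring
  · exact Finset.sum_congr rfl fun p _ => by split_ifs <;> ring

variable {P0 : Measure ℝ} {S : Finset ℝ}

/-- The signal restricted to the first `n` coordinates. -/
def bulkSignal (n : ℕ) (ω : CavΩ n) : Fin n → ℝ := fun i => ω.1 i.castSucc

lemma exp_cavity_field (hlam : 0 ≤ lam) (s : ℝ) (u : Fin n → ℝ) (ω : CavΩ n) :
    rexp (s * zfield n lam ω u + s ^ 2 * sfield n lam u)
      = gexp (columnNoise n) (columnVec n lam s u)
        (lam * ω.1 (Fin.last n) * s * ndot n u (bulkSignal n ω)) ω := by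
  rw [gexp, sum_columnVec, dotp_columnVec hlam, zfield, sfield]
  congr 1
  unfold bulkSignal
  ring

lemma exp_yfield (hlam : 0 ≤ lam) (u : Fin n → ℝ) (ω : CavΩ n) :
    rexp (yfield n lam ω u)
      = gexp (auxNoise n) (auxVec n lam u) (lam / 2 * ndot n u (bulkSignal n ω) ^ 2) ω := by
  rw [gexp, sum_auxVec, dotp_auxVec hlam, yfield]
  congr 1
  unfold bulkSignal
  ring

lemma Ucav_eq (hlam : 0 ≤ lam) (ω : CavΩ n) :
    Ucav P0 S n lam ω = ∑ σ ∈ S, (P0 {σ}).toReal * ∑ x ∈ confs S n, gweight P0 S n lam ω x *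
      gexp (columnNoise n) (columnVec n lam (sigbar n ω σ) (xbar n ω x))
        (lam * ω.1 (Fin.last n) * sigbar n ω σ * ndot n (xbar n ω x) (bulkSignal n ω)) ω := by
  unfold Ucav fzs
  simp_rw [gibbs_eq_sum, exp_cavity_field hlam, Finset.mul_sum]
  rw [Finset.sum_comm]
  exact Finset.sum_congr rfl fun _ _ => Finset.sum_congr rfl fun _ _ => by ring

lemma Vcav_eq (hlam : 0 ≤ lam) (ω : CavΩ n) :
    Vcav P0 S n lam ω = ∑ σ ∈ S, (P0 {σ}).toReal *
      gexp (columnNoise n) (columnVec n lam (sigbar n ω σ) (bcoef P0 S n lam ω))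
        (lam * ω.1 (Fin.last n) * sigbar n ω σ * Qoverlap P0 S n lam ω) ω := by
  unfold Vcav
  refine Finset.sum_congr rfl fun σ _ => ?_
  rw [gexp, sum_columnVec, dotp_columnVec hlam, ← Qoverlap_eq_ndot]
  congr 2
  ring

lemma gibbs_exp_yfield_eq (hlam : 0 ≤ lam) (ω : CavΩ n) :
    gibbs P0 S n lam ω (fun x => rexp (yfield n lam ω x))
      = ∑ x ∈ confs S n, gweight P0 S n lam ω x * gexp (auxNoise n) (auxVec n lam (xbar n ω x))
        (lam / 2 * ndot n (xbar n ω x) (bulkSignal n ω) ^ 2) ω := by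
  simp_rw [gibbs_eq_sum, exp_yfield hlam]

end CavityVectors

section Averaging

variable {E : Type*} [MeasurableSpace E] {μ : Measure E} [IsProbabilityMeasure μ] {m : E × E → E}

lemma integrable_of_merge (hm : MeasurePreserving m (μ.prod μ) μ) {F : E → ℝ} (hF : Measurable F)
    {C : ℝ} (h : ∀ᵐ ω ∂μ, Integrable (fun ω' => |F (m (ω, ω'))|) μ ∧
      ∫ ω', |F (m (ω, ω'))| ∂μ ≤ C) : Integrable F μ := by
  have hFm : Measurable fun p => F (m p) := hF.comp hm.measurable
  refine (hm.integrable_comp hF.aestronglyMeasurable).1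
    ((integrable_prod_iff hFm.aestronglyMeasurable).2 ⟨?_, ?_⟩)
  · filter_upwards [h] with ω hω
    exact (integrable_norm_iff (hFm.comp measurable_prodMk_left).aestronglyMeasurable).1 hω.1
  · refine .of_bound (hFm.norm.stronglyMeasurable.integral_prod_right).aestronglyMeasurable C ?_
    filter_upwards [h] with ω hω
    rw [Real.norm_of_nonneg (integral_nonneg fun _ => norm_nonneg _)]
    exact hω.2

lemma integral_merge (hm : MeasurePreserving m (μ.prod μ) μ) {F : E → ℝ} (hF : Integrable F μ) :
    Integrable (fun ω => ∫ ω', F (m (ω, ω')) ∂μ) μ ∧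
      ∫ ω, F ω ∂μ = ∫ ω, ∫ ω', F (m (ω, ω')) ∂μ ∂μ := by
  have hi := hm.integrable_comp_of_integrable hF
  refine ⟨hi.integral_prod_left, ?_⟩
  refine Eq.trans ?_ (integral_prod _ hi)
  conv_lhs => rw [← hm.map_eq]
  rw [integral_map hm.aemeasurable (by rw [hm.map_eq]; exact hF.aestronglyMeasurable)]
  rfl

end Averaging

section Bulk

variable {P0 : Measure ℝ} {S : Finset ℝ} {n : ℕ} {lam : ℝ}

/-- Two sample points with the same signal, noise and labels away from the cavity coordinate. -/
def SameBulk (ω₁ ω₂ : CavΩ n) : Prop :=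
  (∀ i : Fin n, ω₁.1 i.castSucc = ω₂.1 i.castSucc) ∧
  (∀ i j : Fin n, ω₁.2.1 (i.castSucc, j.castSucc) = ω₂.2.1 (i.castSucc, j.castSucc)) ∧
  ∀ i : Fin n, ω₁.2.2.1 i.castSucc = ω₂.2.2.1 i.castSucc

variable {ω₁ ω₂ : CavΩ n}

lemma SameBulk.xbar_eq (h : SameBulk ω₁ ω₂) : xbar n ω₁ = xbar n ω₂ := by
  funext x i
  simp only [xbar, h.1, h.2.2]

lemma SameBulk.bulkSignal_eq (h : SameBulk ω₁ ω₂) : bulkSignal n ω₁ = bulkSignal n ω₂ :=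
  funext h.1

lemma SameBulk.gweight_eq (h : SameBulk ω₁ ω₂) :
    gweight P0 S n lam ω₁ = gweight P0 S n lam ω₂ := by
  have hH : Hcav n lam ω₁ = Hcav n lam ω₂ := by
    funext x
    simp only [Hcav, h.1, h.2.1]
  funext x
  simp only [gweight, gpart, hH, h.xbar_eq]

lemma SameBulk.bcoef_eq (h : SameBulk ω₁ ω₂) : bcoef P0 S n lam ω₁ = bcoef P0 S n lam ω₂ := by
  funext i
  simp only [bcoef, gibbs_eq_sum, h.gweight_eq, h.xbar_eq]

lemma SameBulk.Qoverlap_eq (h : SameBulk ω₁ ω₂) :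
    Qoverlap P0 S n lam ω₁ = Qoverlap P0 S n lam ω₂ := by
  simp only [Qoverlap, h.bcoef_eq]

/-- Replace the cavity column of the noise and the auxiliary Gaussians. -/
def mergeNoise (n : ℕ) : CavΩ n × CavΩ n → CavΩ n :=
  prodMerge Prod.fst (prodMerge (piMerge fun p => p.2 = Fin.last n)
    (prodMerge Prod.fst (prodMerge Prod.snd Prod.snd)))

/-- Replace everything attached to the cavity coordinate. -/
def mergeCavity (n : ℕ) : CavΩ n × CavΩ n → CavΩ n :=
  prodMerge (piMerge fun i => i = Fin.last n) (prodMerge (piMerge fun p => p.2 = Fin.last n)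
    (prodMerge (piMerge fun i => i = Fin.last n) (prodMerge Prod.snd Prod.snd)))

lemma measurePreserving_mergeNoise (P0 : Measure ℝ) [IsProbabilityMeasure P0] (n : ℕ) (ε : ℝ)
    [IsProbabilityMeasure (bern ε)] : MeasurePreserving (mergeNoise n)
      ((cavMeas P0 n ε).prod (cavMeas P0 n ε)) (cavMeas P0 n ε) :=
  measurePreserving_prodMerge measurePreserving_fst <|
    measurePreserving_prodMerge (measurePreserving_piMerge _ _) <|
      measurePreserving_prodMerge measurePreserving_fst <|
        measurePreserving_prodMerge measurePreserving_snd measurePreserving_snd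

lemma measurePreserving_mergeCavity (P0 : Measure ℝ) [IsProbabilityMeasure P0] (n : ℕ) (ε : ℝ)
    [IsProbabilityMeasure (bern ε)] : MeasurePreserving (mergeCavity n)
      ((cavMeas P0 n ε).prod (cavMeas P0 n ε)) (cavMeas P0 n ε) :=
  measurePreserving_prodMerge (measurePreserving_piMerge _ _) <|
    measurePreserving_prodMerge (measurePreserving_piMerge _ _) <|
      measurePreserving_prodMerge (measurePreserving_piMerge _ _) <|
        measurePreserving_prodMerge measurePreserving_snd measurePreserving_snd

lemma sameBulk_mergeNoise (ω ω' : CavΩ n) : SameBulk (mergeNoise n (ω, ω')) ω := by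
  refine ⟨fun i => rfl, fun i j => ?_, fun i => rfl⟩
  simp [mergeNoise, prodMerge, piMerge, (Fin.castSucc_lt_last j).ne]

lemma sameBulk_mergeCavity (ω ω' : CavΩ n) : SameBulk (mergeCavity n (ω, ω')) ω := by
  refine ⟨fun i => ?_, fun i j => ?_, fun i => ?_⟩ <;>
  simp [mergeCavity, prodMerge, piMerge, (Fin.castSucc_lt_last _).ne]

lemma sigbar_mergeNoise (ω ω' : CavΩ n) : sigbar n (mergeNoise n (ω, ω')) = sigbar n ω := rfl

lemma gexp_columnNoise_mergeNoise (t : Fin n → ℝ) (h : ℝ) (ω ω' : CavΩ n) :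
    gexp (columnNoise n) t h (mergeNoise n (ω, ω')) = gexp (columnNoise n) t h ω' := by
  simp [gexp, columnNoise, mergeNoise, prodMerge, piMerge]

lemma gexp_auxNoise_mergeNoise (t : Fin n ⊕ Fin n × Fin n → ℝ) (h : ℝ) (ω ω' : CavΩ n) :
    gexp (auxNoise n) t h (mergeNoise n (ω, ω')) = gexp (auxNoise n) t h ω' := rfl

end Bulk

section OverlapBound

variable {P0 : Measure ℝ} [IsProbabilityMeasure P0] {S : Finset ℝ} {n : ℕ} {lam : ℝ}

lemma ndot_comm (u v : Fin n → ℝ) : ndot n u v = ndot n v u := by simp only [ndot, mul_comm]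

variable (P0 S n lam) in
/-- A bound on the mean absolute fluctuations of the overlaps. -/
def overlapBound (η : ℝ) (ω : CavΩ n) : ℝ :=
  7 * η + (3 * replicaVar P0 S n lam ω + 4 * signalVar P0 S n lam ω) / η

lemma abs_le_add_sq_div {η : ℝ} (hη : 0 < η) (d : ℝ) : |d| ≤ η + d ^ 2 / η := by
  rw [← sq_abs d]
  have h1 : η + |d| ^ 2 / η - |d| = ((|d| - η / 2) ^ 2 + 3 / 4 * η ^ 2) / η := by
    field_simp; ring
  have h2 : 0 ≤ ((|d| - η / 2) ^ 2 + 3 / 4 * η ^ 2) / η := by positivity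
  linarith

variable (hsupp : P0 ((↑S : Set ℝ)ᶜ) = 0)
include hsupp

omit [IsProbabilityMeasure P0] hsupp in
lemma sum_gweight_mul_ndot (ω : CavΩ n) (u : Fin n → ℝ) :
    ∑ x ∈ confs S n, gweight P0 S n lam ω x * ndot n u (xbar n ω x)
      = ndot n u (bcoef P0 S n lam ω) := by
  simp_rw [ndot, bcoef, gibbs_eq_sum, Finset.mul_sum]
  rw [Finset.sum_comm]
  exact Finset.sum_congr rfl fun i _ => Finset.sum_congr rfl fun x _ => by ring

/-- Summing a pairwise distance controlled by overlap fluctuations. -/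
lemma sum_overlap_fluctuations_le {η : ℝ} (hη : 0 < η) (ω : CavΩ n) {c : ℝ} (hc : 0 ≤ c)
    {f : (Fin n → ℝ) → (Fin n → ℝ) → ℝ}
    (hf : ∀ x ∈ confs S n, ∀ x' ∈ confs S n, f x x' ≤ c *
      (|ndot n (xbar n ω x) (xbar n ω x') - Qoverlap P0 S n lam ω|
        + |ndot n (xbar n ω x) (bcoef P0 S n lam ω) - Qoverlap P0 S n lam ω|
        + |ndot n (xbar n ω x') (bcoef P0 S n lam ω) - Qoverlap P0 S n lam ω|
        + 2 * |ndot n (xbar n ω x) (bulkSignal n ω) - Qoverlap P0 S n lam ω|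
        + 2 * |ndot n (xbar n ω x') (bulkSignal n ω) - Qoverlap P0 S n lam ω|)) :
    ∑ x ∈ confs S n, ∑ x' ∈ confs S n, gweight P0 S n lam ω x * gweight P0 S n lam ω x' * f x x'
      ≤ c * overlapBound P0 S n lam η ω := by
  set w := gweight P0 S n lam ω with hwdef
  set q := Qoverlap P0 S n lam ω with hq
  set b := bcoef P0 S n lam ω with hb
  set A := confs S n with hA
  have hw : ∀ x ∈ A, 0 ≤ w x := fun x _ => gweight_nonneg hsupp ω x
  have hw1 : ∑ x ∈ A, w x = 1 := sum_gweight hsupp ω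
  set r : (Fin n → ℝ) → (Fin n → ℝ) → ℝ := fun x x' => (ndot n (xbar n ω x) (xbar n ω x') - q) ^ 2
    with hr
  set t : (Fin n → ℝ) → ℝ := fun x => (ndot n (xbar n ω x) b - q) ^ 2 with ht
  set s : (Fin n → ℝ) → ℝ := fun x => (ndot n (xbar n ω x) (bulkSignal n ω) - q) ^ 2 with hs
  have hR : replicaVar P0 S n lam ω = ∑ x ∈ A, w x * ∑ x' ∈ A, w x' * r x x' := by
    simp only [replicaVar, gibbs_eq_sum, hr]
    simp_rw [ndot_comm (xbar n ω _) (xbar n ω _)]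
    exact Finset.sum_congr rfl fun x _ => congrArg _ <| Finset.sum_congr rfl fun x' _ => by
      rw [ndot_comm]
  have hS : signalVar P0 S n lam ω = ∑ x ∈ A, w x * s x := by
    simp only [signalVar, gibbs_eq_sum, hs]; rfl
  have hT : ∑ x ∈ A, w x * t x ≤ replicaVar P0 S n lam ω := by
    rw [hR]
    refine Finset.sum_le_sum fun x hx => mul_le_mul_of_nonneg_left ?_ (hw x hx)
    have := sum_sq_le_of_weights hw hw1 (f := fun x' => ndot n (xbar n ω x) (xbar n ω x') - q)
    refine le_trans (le_of_eq ?_) this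
    simp only [mul_sub, Finset.sum_sub_distrib, ← Finset.sum_mul, hw1, one_mul, ht]
    rw [sum_gweight_mul_ndot]
  have step : ∀ x ∈ A, ∀ x' ∈ A, f x x'
      ≤ c * (7 * η + (r x x' + t x + t x' + 2 * s x + 2 * s x') / η) := by
    intro x hx x' hx'
    refine (hf x hx x' hx').trans (mul_le_mul_of_nonneg_left ?_ hc)
    have a1 := abs_le_add_sq_div hη (ndot n (xbar n ω x) (xbar n ω x') - q)
    have a2 := abs_le_add_sq_div hη (ndot n (xbar n ω x) b - q)
    have a3 := abs_le_add_sq_div hη (ndot n (xbar n ω x') b - q)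
    have a4 := abs_le_add_sq_div hη (ndot n (xbar n ω x) (bulkSignal n ω) - q)
    have a5 := abs_le_add_sq_div hη (ndot n (xbar n ω x') (bulkSignal n ω) - q)
    simp only [add_div, mul_div_assoc, hr, ht, hs]
    linarith
  have e1 : ∀ g : (Fin n → ℝ) → ℝ, ∑ x ∈ A, ∑ x' ∈ A, w x * w x' * g x = ∑ x ∈ A, w x * g x := by
    intro g
    refine Finset.sum_congr rfl fun x _ => ?_
    rw [← Finset.sum_mul, ← Finset.mul_sum, hw1, mul_one]
  have e2 : ∀ g : (Fin n → ℝ) → ℝ, ∑ x ∈ A, ∑ x' ∈ A, w x * w x' * g x' = ∑ x ∈ A, w x * g x := by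
    intro g
    rw [Finset.sum_comm]
    refine Finset.sum_congr rfl fun x _ => ?_
    rw [← Finset.sum_mul, ← Finset.sum_mul, hw1, one_mul]
  calc _ ≤ ∑ x ∈ A, ∑ x' ∈ A, w x * w x' *
        (c * (7 * η + (r x x' + t x + t x' + 2 * s x + 2 * s x') / η)) :=
        Finset.sum_le_sum fun x hx => Finset.sum_le_sum fun x' hx' =>
          mul_le_mul_of_nonneg_left (step x hx x' hx') (mul_nonneg (hw x hx) (hw x' hx'))
    _ = ∑ x ∈ A, ∑ x' ∈ A, (c * (7 * η) * (w x * w x' * 1) + c / η * (w x * (w x' * r x x')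
        + w x * w x' * t x + w x * w x' * t x' + 2 * (w x * w x' * s x)
        + 2 * (w x * w x' * s x'))) :=
        Finset.sum_congr rfl fun x _ => Finset.sum_congr rfl fun x' _ => by ring
    _ = c * (7 * η) + c / η * (replicaVar P0 S n lam ω + 2 * ∑ x ∈ A, w x * t x
        + 4 * signalVar P0 S n lam ω) := by
        simp only [Finset.sum_add_distrib, ← Finset.mul_sum]
        rw [e1 t, e2 t, e1 s, e2 s, ← hR, hS]
        have := e1 fun _ => 1
        simp only [mul_one] at this ⊢
        simp only [← Finset.mul_sum, hw1, mul_one]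
        ring
    _ ≤ c * (7 * η) + c / η * (replicaVar P0 S n lam ω + 2 * replicaVar P0 S n lam ω
        + 4 * signalVar P0 S n lam ω) := by gcongr
    _ = _ := by unfold overlapBound; ring

lemma integral_overlapBound_le (hlam : 0 ≤ lam) {K : ℝ} (hK : 0 ≤ K) (hSK : ∀ x ∈ S, |x| ≤ K)
    {ε : ℝ} (h0 : 0 ≤ ε) (h1 : ε ≤ 1) {η η' : ℝ} (hη : 0 < η) (hη' : 0 < η') :
    Integrable (overlapBound P0 S n lam η) (cavMeas P0 n ε) ∧
    ∫ ω, overlapBound P0 S n lam η ω ∂cavMeas P0 n ε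
      ≤ 7 * η + 14 * K ^ 2 * (η' + covAverage P0 S n lam ε / η') / η := by
  have := isProbabilityMeasure_bern h0 h1
  have iR := integrable_cavMeas_of_bound (ε := ε) hsupp
    (measurable_replicaVar (P0 := P0) (S := S) (n := n) (lam := lam))
    fun ω hω => abs_replicaVar_le hsupp hK hSK hω
  have iS := integrable_cavMeas_of_bound (ε := ε) hsupp
    (measurable_signalVar (P0 := P0) (S := S) (n := n) (lam := lam))
    fun ω hω => abs_signalVar_le hsupp hK hSK hω
  have iB : Integrable (fun ω => (3 * replicaVar P0 S n lam ω + 4 * signalVar P0 S n lam ω) / η)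
      (cavMeas P0 n ε) := ((iR.const_mul 3).add (iS.const_mul 4)).div_const η
  refine ⟨(integrable_const (7 * η)).add iB, ?_⟩
  have hE := integral_replicaVar_le (n := n) (lam := lam) hsupp hK hSK h0 h1 hη'
  have e : ∫ ω, overlapBound P0 S n lam η ω ∂cavMeas P0 n ε
      = 7 * η + 7 * (∫ ω, replicaVar P0 S n lam ω ∂cavMeas P0 n ε) / η := by
    unfold overlapBound
    rw [integral_add (integrable_const _) iB, integral_const, integral_div,
      integral_add (iR.const_mul 3) (iS.const_mul 4), integral_const_mul, integral_const_mul,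
      integral_signalVar hsupp hlam hK hSK h0 h1]
    simp only [probReal_univ, one_smul]
    ring
  rw [e]
  have : 7 * (∫ ω, replicaVar P0 S n lam ω ∂cavMeas P0 n ε)
      ≤ 14 * K ^ 2 * (η' + covAverage P0 S n lam ε / η') := by linarith
  gcongr

end OverlapBound

section Averaging

variable {E : Type*} [MeasurableSpace E] {μ : Measure E} [IsProbabilityMeasure μ] {m : E × E → E}

/-- Averaging a conditional comparison of log-partition functions. -/
lemma log_compare_average (hm : MeasurePreserving m (μ.prod μ) μ) {U V B : E → ℝ}
    (hU : Measurable U) (hV : Measurable V) (hB : Integrable B μ) {a b C : ℝ}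
    (h : ∀ᵐ ω ∂μ, (Integrable (fun ω' => |Real.log (U (m (ω, ω')))|) μ ∧
        ∫ ω', |Real.log (U (m (ω, ω')))| ∂μ ≤ C) ∧
      (Integrable (fun ω' => |Real.log (V (m (ω, ω')))|) μ ∧
        ∫ ω', |Real.log (V (m (ω, ω')))| ∂μ ≤ C) ∧
      ∀ δ : ℝ, 0 < δ → ∫ ω', |Real.log (U (m (ω, ω'))) - Real.log (V (m (ω, ω')))| ∂μ
        ≤ a * B ω / (2 * δ) + 2 * δ * b) :
    Integrable (fun ω => Real.log (U ω)) μ ∧ Integrable (fun ω => Real.log (V ω)) μ ∧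
      ∀ δ : ℝ, 0 < δ → |∫ ω, Real.log (U ω) ∂μ - ∫ ω, Real.log (V ω) ∂μ|
        ≤ a * (∫ ω, B ω ∂μ) / (2 * δ) + 2 * δ * b := by
  have iU : Integrable (fun ω => Real.log (U ω)) μ :=
    integrable_of_merge hm hU.log (h.mono fun _ hω => hω.1)
  have iV : Integrable (fun ω => Real.log (V ω)) μ :=
    integrable_of_merge hm hV.log (h.mono fun _ hω => hω.2.1)
  refine ⟨iU, iV, fun δ hδ => ?_⟩
  obtain ⟨hi, he⟩ := integral_merge hm (iU.sub iV).abs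
  rw [← integral_sub iU iV]
  calc _ ≤ ∫ ω, |Real.log (U ω) - Real.log (V ω)| ∂μ := abs_integral_le_integral_abs
    _ = ∫ ω, ∫ ω', |Real.log (U (m (ω, ω'))) - Real.log (V (m (ω, ω')))| ∂μ ∂μ := he
    _ ≤ ∫ ω, (a * B ω / (2 * δ) + 2 * δ * b) ∂μ :=
        integral_mono_ae hi (((hB.const_mul a).div_const _).add (integrable_const _))
          (h.mono fun ω hω => hω.2.2 δ hδ)
    _ = _ := by
        rw [integral_add ((hB.const_mul a).div_const _) (integrable_const _), integral_div,
          integral_const_mul, integral_const]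
        simp

end Averaging

section Comparison

variable {P0 : Measure ℝ} {S : Finset ℝ} {n : ℕ} {lam : ℝ}

lemma abs_sq_sub_sq_le {x y R : ℝ} (hx : |x| ≤ R) (hy : |y| ≤ R) :
    |x ^ 2 - y ^ 2| ≤ 2 * R * |x - y| := by
  rw [sq_sub_sq, abs_mul]
  refine mul_le_mul_of_nonneg_right ((abs_add_le _ _).trans ?_) (abs_nonneg _)
  linarith

lemma measurable_sigbar (σ : ℝ) : Measurable fun ω : CavΩ n => sigbar n ω σ := by
  have h : Measurable fun ω : CavΩ n => ω.2.2.1 (Fin.last n) := by fun_prop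
  exact Measurable.ite (h (measurableSet_singleton true)) (by fun_prop) measurable_const

lemma measurable_Ucav : Measurable (Ucav P0 S n lam) := by
  refine measurable_gibbs fun x => ?_
  have h1 := fun i => measurable_xbar_apply (n := n) x i
  have h2 := fun σ => measurable_sigbar (n := n) σ
  unfold fzs zfield sfield ndot
  fun_prop

lemma measurable_Vcav : Measurable (Vcav P0 S n lam) := by
  have h1 := fun i => measurable_bcoef (P0 := P0) (S := S) (n := n) (lam := lam) i
  have h2 := fun σ => measurable_sigbar (n := n) σ
  have h3 := measurable_Qoverlap (P0 := P0) (S := S) (n := n) (lam := lam)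
  unfold Vcav
  fun_prop

lemma measurable_gibbs_exp_yfield :
    Measurable fun ω : CavΩ n => gibbs P0 S n lam ω fun x => rexp (yfield n lam ω x) := by
  refine measurable_gibbs (f := fun ω x => rexp (yfield n lam ω x)) fun x => ?_
  have h1 := fun i => measurable_xbar_apply (n := n) x i
  unfold yfield ndot
  fun_prop

variable (P0 S n lam) in
/-- The mean-field version of `⟨exp(y(x))⟩`. -/
def Ycav (ω : CavΩ n) : ℝ :=
  gexp (auxNoise n) (auxVec n lam (bcoef P0 S n lam ω)) (lam / 2 * Qoverlap P0 S n lam ω ^ 2) ω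

lemma log_Ycav (hlam : 0 ≤ lam) (ω : CavΩ n) : Real.log (Ycav P0 S n lam ω)
    = ∑ k, auxVec n lam (bcoef P0 S n lam ω) k * auxNoise n k ω
      + lam / 4 * Qoverlap P0 S n lam ω ^ 2 := by
  rw [Ycav, gexp, Real.log_exp, dotp_auxVec hlam, ← Qoverlap_eq_ndot]
  ring

lemma measurable_Ycav (hlam : 0 ≤ lam) : Measurable (Ycav P0 S n lam) := by
  have h1 := fun i => measurable_bcoef (P0 := P0) (S := S) (n := n) (lam := lam) i
  have h3 := measurable_Qoverlap (P0 := P0) (S := S) (n := n) (lam := lam)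
  unfold Ycav gexp
  simp_rw [sum_auxVec, dotp_auxVec hlam, ← Qoverlap_eq_ndot]
  fun_prop

lemma sigbar_mem {ω : CavΩ n} (hω : ω.1 ∈ confs S (n + 1)) {σ : ℝ} (hσ : σ ∈ S) :
    sigbar n ω σ ∈ S := by
  unfold sigbar
  split_ifs
  · exact mem_confs.1 hω _
  · exact hσ

variable [IsProbabilityMeasure P0] (hsupp : P0 ((↑S : Set ℝ)ᶜ) = 0) (hlam : 0 ≤ lam) {K : ℝ}
  (hK : 0 ≤ K) (hSK : ∀ x ∈ S, |x| ≤ K) {ε : ℝ}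
include hsupp hlam hK hSK

lemma cavity_log_compare (h0 : 0 ≤ ε) (h1 : ε ≤ 1) {η : ℝ} (hη : 0 < η)
    (hB : Integrable (overlapBound P0 S n lam η) (cavMeas P0 n ε)) :
    Integrable (fun ω => Real.log (Ucav P0 S n lam ω)) (cavMeas P0 n ε) ∧
    Integrable (fun ω => Real.log (Vcav P0 S n lam ω)) (cavMeas P0 n ε) ∧
      ∀ δ : ℝ, 0 < δ → |∫ ω, Real.log (Ucav P0 S n lam ω) ∂cavMeas P0 n ε
          - ∫ ω, Real.log (Vcav P0 S n lam ω) ∂cavMeas P0 n ε|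
        ≤ rexp (3 * (lam * K ^ 4)) * (lam * K ^ 2)
          * (∫ ω, overlapBound P0 S n lam η ω ∂cavMeas P0 n ε) / (2 * δ)
          + 2 * δ * rexp (5 * (lam * K ^ 4)) := by
  have := isProbabilityMeasure_bern h0 h1
  refine log_compare_average (measurePreserving_mergeNoise P0 n ε) measurable_Ucav measurable_Vcav
    hB (C := rexp (3 * (lam * K ^ 4)) + rexp (5 * (lam * K ^ 4))) ?_
  filter_upwards [ae_cavMeas_mem_confs hsupp] with ω hω
  have hs : ∀ σ ∈ S, |sigbar n ω σ| ≤ K := fun σ hσ => hSK _ (sigbar_mem hω hσ)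
  have hx : ∀ x ∈ confs S n, ∀ i, |xbar n ω x i| ≤ K := fun x hx i =>
    hSK _ (mem_confs.1 (xbar_mem hω hx) i)
  have hX : ∀ i, |bulkSignal n ω i| ≤ K := fun i => hSK _ (mem_confs.1 hω _)
  have hXl : |ω.1 (Fin.last n)| ≤ K := hSK _ (mem_confs.1 hω _)
  have hQ := abs_Qoverlap_le (lam := lam) hsupp hK hSK hω
  have hss : ∀ σ ∈ S, |sigbar n ω σ * sigbar n ω σ| ≤ K ^ 2 := fun σ hσ => by
    rw [abs_mul, sq]; exact mul_le_mul (hs σ hσ) (hs σ hσ) (abs_nonneg _) hK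
  have hXs : ∀ σ ∈ S, |ω.1 (Fin.last n) * sigbar n ω σ| ≤ K ^ 2 := fun σ hσ => by
    rw [abs_mul, sq]; exact mul_le_mul hXl (hs σ hσ) (abs_nonneg _) hK
  have hM : ∀ {a r : ℝ}, |a| ≤ K ^ 2 → |r| ≤ K ^ 2 → |lam * a * r| ≤ lam * K ^ 4 := by
    intro a r ha hr
    rw [abs_mul, abs_mul, abs_of_nonneg hlam, mul_assoc]
    refine mul_le_mul_of_nonneg_left ?_ hlam
    calc _ ≤ K ^ 2 * K ^ 2 := mul_le_mul ha hr (abs_nonneg _) (by positivity)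
      _ = K ^ 4 := by ring
  have key := (isStdGaussFam_columnNoise P0 n ε).log_compare
    (C := S) (p := fun σ => (P0 {σ}).toReal) (fun _ _ => ENNReal.toReal_nonneg)
    (sum_prob_singleton hsupp) (A := confs S n) (w := gweight P0 S n lam ω)
    (fun x _ => gweight_nonneg hsupp ω x) (sum_gweight hsupp ω)
    (v := fun σ x => columnVec n lam (sigbar n ω σ) (xbar n ω x))
    (h := fun σ x => lam * ω.1 (Fin.last n) * sigbar n ω σ * ndot n (xbar n ω x) (bulkSignal n ω))
    (u := fun σ => columnVec n lam (sigbar n ω σ) (bcoef P0 S n lam ω))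
    (h₀ := fun σ => lam * ω.1 (Fin.last n) * sigbar n ω σ * Qoverlap P0 S n lam ω)
    (M := lam * K ^ 4)
    (U := fun ω' => Ucav P0 S n lam (mergeNoise n (ω, ω')))
    (V := fun ω' => Vcav P0 S n lam (mergeNoise n (ω, ω')))
    (fun σ hσ x hx' => by
      rw [dotp_columnVec hlam]
      exact (le_abs_self _).trans (hM (hss σ hσ) (abs_ndot_le hK (hx x hx') (hx x hx'))))
    (fun σ hσ x hx' => by
      rw [mul_assoc lam]
      exact hM (hXs σ hσ) (abs_ndot_le hK (hx x hx') hX))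
    (fun σ hσ => by
      rw [dotp_columnVec hlam, ← Qoverlap_eq_ndot]
      exact (le_abs_self _).trans (hM (hss σ hσ) hQ))
    (fun σ hσ => by
      rw [mul_assoc lam]
      exact hM (hXs σ hσ) hQ)
    (fun ω' => by
      have hb := sameBulk_mergeNoise ω ω'
      rw [Ucav_eq hlam, hb.gweight_eq, hb.xbar_eq, hb.bulkSignal_eq, sigbar_mergeNoise]
      simp only [gexp_columnNoise_mergeNoise]
      rfl)
    (fun ω' => by
      have hb := sameBulk_mergeNoise ω ω'
      rw [Vcav_eq hlam, hb.bcoef_eq, hb.Qoverlap_eq, sigbar_mergeNoise]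
      simp only [gexp_columnNoise_mergeNoise]
      rfl)
  refine ⟨key.1, key.2.1, fun δ hδ => ?_⟩
  rw [mul_assoc (rexp _)]
  refine key.2.2 _ (fun σ hσ => ?_) δ hδ
  refine sum_overlap_fluctuations_le hsupp hη ω (by positivity) fun x _ x' _ => ?_
  simp only [gdist, dotp_columnVec hlam, ← Qoverlap_eq_ndot, ← mul_sub, abs_mul]
  set d1 := |ndot n (xbar n ω x) (xbar n ω x') - Qoverlap P0 S n lam ω|
  set d2 := |ndot n (xbar n ω x) (bcoef P0 S n lam ω) - Qoverlap P0 S n lam ω|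
  set d3 := |ndot n (xbar n ω x') (bcoef P0 S n lam ω) - Qoverlap P0 S n lam ω|
  set d4 := |ndot n (xbar n ω x) (bulkSignal n ω) - Qoverlap P0 S n lam ω|
  set d5 := |ndot n (xbar n ω x') (bulkSignal n ω) - Qoverlap P0 S n lam ω|
  have hss' := hss σ hσ
  have hXs' := hXs σ hσ
  rw [abs_mul] at hss' hXs'
  have e1 : lam * (|sigbar n ω σ| * |sigbar n ω σ|) * (d1 + d2 + d3)
      ≤ lam * K ^ 2 * (d1 + d2 + d3) := by gcongr
  have e2 : lam * (|ω.1 (Fin.last n)| * |sigbar n ω σ|) * (2 * d4 + 2 * d5)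
      ≤ lam * K ^ 2 * (2 * d4 + 2 * d5) := by gcongr
  rw [abs_of_nonneg hlam]
  linarith

lemma yfield_log_compare (h0 : 0 ≤ ε) (h1 : ε ≤ 1) {η : ℝ} (hη : 0 < η)
    (hB : Integrable (overlapBound P0 S n lam η) (cavMeas P0 n ε)) :
    Integrable (fun ω => Real.log (gibbs P0 S n lam ω fun x => rexp (yfield n lam ω x)))
      (cavMeas P0 n ε) ∧
    Integrable (fun ω => Real.log (Ycav P0 S n lam ω)) (cavMeas P0 n ε) ∧
      ∀ δ : ℝ, 0 < δ →
        |∫ ω, Real.log (gibbs P0 S n lam ω fun x => rexp (yfield n lam ω x)) ∂cavMeas P0 n ε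
          - ∫ ω, Real.log (Ycav P0 S n lam ω) ∂cavMeas P0 n ε|
        ≤ rexp (3 * (lam * K ^ 4)) * (lam * K ^ 2)
          * (∫ ω, overlapBound P0 S n lam η ω ∂cavMeas P0 n ε) / (2 * δ)
          + 2 * δ * rexp (5 * (lam * K ^ 4)) := by
  have := isProbabilityMeasure_bern h0 h1
  refine log_compare_average (measurePreserving_mergeNoise P0 n ε) measurable_gibbs_exp_yfield
    (measurable_Ycav hlam) hB (C := rexp (3 * (lam * K ^ 4)) + rexp (5 * (lam * K ^ 4))) ?_
  filter_upwards [ae_cavMeas_mem_confs hsupp] with ω hω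
  have hx : ∀ x ∈ confs S n, ∀ i, |xbar n ω x i| ≤ K := fun x hx i =>
    hSK _ (mem_confs.1 (xbar_mem hω hx) i)
  have hX : ∀ i, |bulkSignal n ω i| ≤ K := fun i => hSK _ (mem_confs.1 hω _)
  have hbK := abs_bcoef_le (lam := lam) hsupp hSK hω
  have hQ := abs_Qoverlap_le (lam := lam) hsupp hK hSK hω
  have hM : ∀ {r : ℝ}, |r| ≤ K ^ 2 → |lam / 2 * r ^ 2| ≤ lam * K ^ 4 := by
    intro r hr
    have h2 : r ^ 2 ≤ K ^ 4 := by
      rw [← sq_abs]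
      calc _ ≤ (K ^ 2) ^ 2 := pow_le_pow_left₀ (abs_nonneg _) hr 2
        _ = K ^ 4 := by ring
    rw [abs_of_nonneg (by positivity)]
    exact mul_le_mul (by linarith) h2 (sq_nonneg r) hlam
  have key := (isStdGaussFam_auxNoise P0 n ε).log_compare
    (C := {()}) (p := fun _ => 1) (fun _ _ => zero_le_one) (by simp)
    (A := confs S n) (w := gweight P0 S n lam ω)
    (fun x _ => gweight_nonneg hsupp ω x) (sum_gweight hsupp ω)
    (v := fun _ x => auxVec n lam (xbar n ω x))
    (h := fun _ x => lam / 2 * ndot n (xbar n ω x) (bulkSignal n ω) ^ 2)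
    (u := fun _ => auxVec n lam (bcoef P0 S n lam ω))
    (h₀ := fun _ => lam / 2 * Qoverlap P0 S n lam ω ^ 2)
    (M := lam * K ^ 4)
    (U := fun ω' => gibbs P0 S n lam (mergeNoise n (ω, ω')) fun x =>
      rexp (yfield n lam (mergeNoise n (ω, ω')) x))
    (V := fun ω' => Ycav P0 S n lam (mergeNoise n (ω, ω')))
    (fun _ _ x hx' => by
      rw [dotp_auxVec hlam]
      exact (le_abs_self _).trans (hM (abs_ndot_le hK (hx x hx') (hx x hx'))))
    (fun _ _ x hx' => hM (abs_ndot_le hK (hx x hx') hX))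
    (fun _ _ => by
      rw [dotp_auxVec hlam]
      exact (le_abs_self _).trans (hM (abs_ndot_le hK hbK hbK)))
    (fun _ _ => hM hQ)
    (fun ω' => by
      have hb := sameBulk_mergeNoise ω ω'
      rw [gibbs_exp_yfield_eq hlam, hb.gweight_eq, hb.xbar_eq, hb.bulkSignal_eq]
      simp only [gexp_auxNoise_mergeNoise, Finset.sum_singleton, one_mul])
    (fun ω' => by
      have hb := sameBulk_mergeNoise ω ω'
      rw [Ycav, hb.bcoef_eq, hb.Qoverlap_eq]
      simp only [gexp_auxNoise_mergeNoise, Finset.sum_singleton, one_mul])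
  refine ⟨key.1, key.2.1, fun δ hδ => ?_⟩
  rw [mul_assoc (rexp _)]
  refine key.2.2 _ (fun _ _ => ?_) δ hδ
  refine sum_overlap_fluctuations_le hsupp hη ω (by positivity) fun x hx' x' hx'' => ?_
  simp only [gdist, dotp_auxVec hlam, ← Qoverlap_eq_ndot, ← mul_sub, abs_mul]
  have a1 := abs_sq_sub_sq_le (abs_ndot_le hK (hx x hx') (hx x' hx'')) hQ
  have a2 := abs_sq_sub_sq_le (abs_ndot_le hK (hx x hx') hbK) hQ
  have a3 := abs_sq_sub_sq_le (abs_ndot_le hK (hx x' hx'') hbK) hQ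
  have a4 := abs_sq_sub_sq_le (abs_ndot_le hK (hx x hx') hX) hQ
  have a5 := abs_sq_sub_sq_le (abs_ndot_le hK (hx x' hx'') hX) hQ
  rw [abs_of_nonneg (by positivity : 0 ≤ lam / 2)]
  have b := mul_le_mul_of_nonneg_left
    (add_le_add (add_le_add (add_le_add (add_le_add a1 a2) a3)
      (mul_le_mul_of_nonneg_left a4 zero_le_two)) (mul_le_mul_of_nonneg_left a5 zero_le_two))
    (by positivity : 0 ≤ lam / 2)
  linarith

end Comparison

lemma IsStdGaussFam.integral_linear {E ι : Type*} [MeasurableSpace E] [Fintype ι] {γ : Measure E}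
    [IsProbabilityMeasure γ] {g : ι → E → ℝ} (hg : IsStdGaussFam γ g) (t : ι → ℝ) :
    Integrable (fun e => ∑ i, t i * g i e) γ ∧ ∫ e, ∑ i, t i * g i e ∂γ = 0 := by
  have := hg.measurable
  have hm : Measurable fun e => ∑ i, t i * g i e := by fun_prop
  have hp : MeasurePreserving (fun e => ∑ i, t i * g i e) γ _ := ⟨hm, hg.map_eq t⟩
  have hi : Integrable (fun x : ℝ => x) (gaussianReal 0 (∑ i, t i * t i).toNNReal) :=
    (memLp_id_gaussianReal 1).integrable le_rfl
  refine ⟨hp.integrable_comp_of_integrable hi, ?_⟩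
  have := integral_map (μ := γ) hm.aemeasurable (f := fun x : ℝ => x)
    measurable_id.aestronglyMeasurable
  rw [hg.map_eq, integral_id_gaussianReal] at this
  exact this.symm

lemma integral_bern {ε : ℝ} (h0 : 0 ≤ ε) (h1 : ε ≤ 1) (f : Bool → ℝ) :
    ∫ l, f l ∂bern ε = ε * f true + (1 - ε) * f false := by
  rw [bern, integral_add_measure, integral_smul_measure, integral_smul_measure, integral_dirac,
    integral_dirac, ENNReal.toReal_ofReal h0, ENNReal.toReal_ofReal (by linarith)]
  · simp
  all_goals exact (integrable_dirac (by simp)).smul_measure ENNReal.ofReal_ne_top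

lemma map_stdGauss_sqrt_mul {v : ℝ} (hv : 0 ≤ v) :
    stdGauss.map (√v * ·) = gaussianReal 0 v.toNNReal := by
  rw [stdGauss, gaussianReal_map_const_mul, mul_zero, mul_one]
  congr 1
  ext
  simp [Real.sq_sqrt hv, hv]

section CavityIntegrals

variable {P0 : Measure ℝ} {S : Finset ℝ} {n : ℕ} {lam : ℝ}

variable (P0 S lam) in
/-- The scalar-channel log-partition function with overlap `q`, as a function of the signal, the
Gaussian field and the label. -/
def scalarLog (q : ℝ) (r : ℝ × ℝ × Bool) : ℝ :=
  Real.log (∑ σ ∈ S, (P0 {σ}).toReal * rexp ((if r.2.2 then r.1 else σ) * r.2.1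
    + lam * q * r.1 * (if r.2.2 then r.1 else σ) - lam * q / 2 * (if r.2.2 then r.1 else σ) ^ 2))

lemma measurable_scalarLog (q : ℝ) : Measurable (scalarLog P0 S lam q) := by
  have h (σ : ℝ) : Measurable fun r : ℝ × ℝ × Bool => if r.2.2 then r.1 else σ := by
    have h : Measurable fun r : ℝ × ℝ × Bool => r.2.2 := by fun_prop
    exact Measurable.ite (h (measurableSet_singleton true)) (by fun_prop) measurable_const
  unfold scalarLog
  fun_prop

/-- The cavity signal, Gaussian field and label. -/
def cavityData (n : ℕ) (t : Fin n → ℝ) (ω : CavΩ n) : ℝ × ℝ × Bool :=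
  (ω.1 (Fin.last n), ∑ i, t i * columnNoise n i ω, ω.2.2.1 (Fin.last n))

lemma log_Vcav_mergeCavity (ω ω' : CavΩ n) : Real.log (Vcav P0 S n lam (mergeCavity n (ω, ω')))
    = scalarLog P0 S lam (Qoverlap P0 S n lam ω)
      (cavityData n (columnVec n lam 1 (bcoef P0 S n lam ω)) ω') := by
  have hb := sameBulk_mergeCavity ω ω'
  unfold Vcav scalarLog cavityData
  rw [hb.bcoef_eq, hb.Qoverlap_eq]
  simp only [sum_columnVec, one_mul, sigbar]
  simp only [mergeCavity, prodMerge, piMerge, if_true, mul_assoc]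

variable [IsProbabilityMeasure P0]

lemma measurePreserving_cavityData (t : Fin n → ℝ) (ε : ℝ) [IsProbabilityMeasure (bern ε)] :
    MeasurePreserving (cavityData n t) (cavMeas P0 n ε)
      (P0.prod ((gaussianReal 0 (dotp t t).toNNReal).prod (bern ε))) := by
  have hg := (isStdGaussFam_pi (Fin (n + 1) × Fin (n + 1))).subfamily
    (f := fun i : Fin n => (i.castSucc, Fin.last n)) fun i j h => by simpa using h
  have hm := hg.measurable
  have hN : MeasurePreserving _ _ _ := ⟨by fun_prop, hg.map_eq t⟩
  have hX := measurePreserving_eval (fun _ : Fin (n + 1) => P0) (Fin.last n)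
  have hL := measurePreserving_eval (fun _ : Fin (n + 1) => bern ε) (Fin.last n)
  exact hX.prod (hN.prod (hL.comp
    (measurePreserving_fst (μ := Measure.pi fun _ : Fin (n + 1) => bern ε) (ν := auxMeas n))))

variable (hsupp : P0 ((↑S : Set ℝ)ᶜ) = 0)
include hsupp

lemma scalarLog_true (q x N : ℝ) : scalarLog P0 S lam q (x, N, true)
    = x * N + lam * q / 2 * x ^ 2 := by
  simp only [scalarLog, if_true]
  rw [← Finset.sum_mul, sum_prob_singleton hsupp, one_mul, Real.log_exp]
  ring

lemma integral_scalarLog {q ε : ℝ} (hq : 0 ≤ lam * q) (h0 : 0 ≤ ε) (h1 : ε ≤ 1)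
    (hi : Integrable (scalarLog P0 S lam q)
      (P0.prod ((gaussianReal 0 (lam * q).toNNReal).prod (bern ε)))) :
    ∫ r, scalarLog P0 S lam q r ∂P0.prod ((gaussianReal 0 (lam * q).toNNReal).prod (bern ε))
      = Fpert P0 S lam ε q + lam / 4 * q ^ 2 := by
  have := isProbabilityMeasure_bern h0 h1
  have hrow : ∀ᵐ x ∂P0, ∫ y, scalarLog P0 S lam q (x, y)
        ∂(gaussianReal 0 (lam * q).toNNReal).prod (bern ε)
      = ε * (lam * q / 2) * x ^ 2 + (1 - ε) * ∫ N, scalarLog P0 S lam q (x, N, false)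
        ∂gaussianReal 0 (lam * q).toNNReal := by
    filter_upwards [hi.prod_right_ae] with x hx
    have iN : Integrable (fun N : ℝ => N) (gaussianReal 0 (lam * q).toNNReal) :=
      (memLp_id_gaussianReal 1).integrable le_rfl
    have it : Integrable (fun N => ε * scalarLog P0 S lam q (x, N, true))
        (gaussianReal 0 (lam * q).toNNReal) := by
      simp_rw [scalarLog_true hsupp]
      exact ((iN.const_mul x).add (integrable_const _)).const_mul ε
    have hs := hx.integral_prod_left
    rw [integral_prod _ hx]
    simp_rw [integral_bern h0 h1] at hs ⊢
    have i2 : Integrable (fun N => (1 - ε) * scalarLog P0 S lam q (x, N, false))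
        (gaussianReal 0 (lam * q).toNNReal) :=
      (hs.sub it).congr (.of_forall fun N => by simp)
    rw [integral_add it i2, integral_const_mul, integral_const_mul]
    simp_rw [scalarLog_true hsupp]
    rw [integral_add (iN.const_mul x) (integrable_const _), integral_const_mul,
      integral_id_gaussianReal, integral_const]
    simp
    ring
  have hs := hi.integral_prod_left
  have ix : Integrable (fun x : ℝ => x ^ 2) P0 := by
    obtain ⟨C, hC⟩ : ∃ C : ℝ, ∀ x ∈ S, ‖x ^ 2‖ ≤ C := by
      obtain ⟨C, hC⟩ := (S.image fun x : ℝ => ‖x ^ 2‖).bddAbove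
      exact ⟨C, fun x hx => hC (Finset.mem_coe.2 (Finset.mem_image_of_mem _ hx))⟩
    have h : ∀ᵐ x ∂P0, x ∈ S := hsupp
    exact .of_bound (by fun_prop) C (h.mono hC)
  have hs' := hs.congr hrow
  have i2 : Integrable (fun x => (1 - ε) * ∫ N, scalarLog P0 S lam q (x, N, false)
      ∂gaussianReal 0 (lam * q).toNNReal) P0 :=
    (hs'.sub (ix.const_mul (ε * (lam * q / 2)))).congr (.of_forall fun x => by simp)
  have hfield : ∀ x : ℝ, ∫ N, scalarLog P0 S lam q (x, N, false)
      ∂gaussianReal 0 (lam * q).toNNReal = ∫ z, Real.log (∑ σ ∈ S, (P0 {σ}).toReal *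
        rexp (√(lam * q) * z * σ + lam * q * σ * x - lam / 2 * q * σ ^ 2)) ∂stdGauss := by
    intro x
    have hms : Measurable fun N : ℝ => scalarLog P0 S lam q (x, N, false) :=
      (measurable_scalarLog q).comp (by fun_prop)
    rw [← map_stdGauss_sqrt_mul hq, integral_map (by fun_prop) hms.aestronglyMeasurable]
    refine integral_congr_ae (.of_forall fun z => ?_)
    simp only [scalarLog, Bool.false_eq_true, if_false]
    refine congrArg _ (Finset.sum_congr rfl fun σ _ => ?_)
    congr 2
    ring
  rw [integral_prod _ hi, integral_congr_ae hrow, integral_add (ix.const_mul _) i2,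
    integral_const_mul, integral_const_mul]
  simp_rw [hfield]
  unfold Fpert
  ring

variable (hlam : 0 ≤ lam) {K : ℝ} (hK : 0 ≤ K) (hSK : ∀ x ∈ S, |x| ≤ K) {ε : ℝ} (h0 : 0 ≤ ε)
  (h1 : ε ≤ 1)
include hlam hK hSK h0 h1

omit hlam in
lemma integrable_Qoverlap_sq :
    Integrable (fun ω => Qoverlap P0 S n lam ω ^ 2) (cavMeas P0 n ε) := by
  have := isProbabilityMeasure_bern h0 h1
  refine integrable_cavMeas_of_bound hsupp (measurable_Qoverlap.pow_const 2) (C := (K ^ 2) ^ 2)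
    fun ω hω => ?_
  rw [abs_pow]
  exact pow_le_pow_left₀ (abs_nonneg _) (abs_Qoverlap_le hsupp hK hSK hω) 2

omit hsupp hK hSK in
lemma integral_log_Ycav
    (hi : Integrable (fun ω => Real.log (Ycav P0 S n lam ω)) (cavMeas P0 n ε)) :
    ∫ ω, Real.log (Ycav P0 S n lam ω) ∂cavMeas P0 n ε
      = lam / 4 * ∫ ω, Qoverlap P0 S n lam ω ^ 2 ∂cavMeas P0 n ε := by
  have := isProbabilityMeasure_bern h0 h1
  rw [(integral_merge (measurePreserving_mergeNoise P0 n ε) hi).2, ← integral_const_mul]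
  refine integral_congr_ae (.of_forall fun ω => ?_)
  have hl := (isStdGaussFam_auxNoise P0 n ε).integral_linear
    (auxVec n lam (bcoef P0 S n lam ω))
  have e : ∀ ω', Real.log (Ycav P0 S n lam (mergeNoise n (ω, ω')))
      = ∑ k, auxVec n lam (bcoef P0 S n lam ω) k * auxNoise n k ω'
        + lam / 4 * Qoverlap P0 S n lam ω ^ 2 := by
    intro ω'
    have hb := sameBulk_mergeNoise ω ω'
    rw [log_Ycav hlam, hb.bcoef_eq, hb.Qoverlap_eq]
    rfl
  simp only [e]
  rw [integral_add hl.1 (integrable_const _), hl.2, integral_const]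
  simp

lemma integral_log_Vcav
    (hi : Integrable (fun ω => Real.log (Vcav P0 S n lam ω)) (cavMeas P0 n ε)) :
    ∫ ω, Real.log (Vcav P0 S n lam ω) ∂cavMeas P0 n ε
      = ∫ ω, Fpert P0 S lam ε (Qoverlap P0 S n lam ω) ∂cavMeas P0 n ε
        + lam / 4 * ∫ ω, Qoverlap P0 S n lam ω ^ 2 ∂cavMeas P0 n ε := by
  have := isProbabilityMeasure_bern h0 h1
  have hm := measurePreserving_mergeCavity P0 n ε
  obtain ⟨hin, he⟩ := integral_merge hm hi
  have hae : ∀ᵐ ω ∂cavMeas P0 n ε,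
      ∫ ω', Real.log (Vcav P0 S n lam (mergeCavity n (ω, ω'))) ∂cavMeas P0 n ε
        = Fpert P0 S lam ε (Qoverlap P0 S n lam ω) + lam / 4 * Qoverlap P0 S n lam ω ^ 2 := by
    filter_upwards [(hm.integrable_comp_of_integrable hi).prod_right_ae] with ω hω
    have hp := measurePreserving_cavityData (P0 := P0)
      (columnVec n lam 1 (bcoef P0 S n lam ω)) ε
    rw [dotp_columnVec hlam, ← Qoverlap_eq_ndot, mul_one, mul_one] at hp
    simp only [Function.comp_def, log_Vcav_mergeCavity] at hω ⊢
    have hms := (measurable_scalarLog (P0 := P0) (S := S) (lam := lam)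
      (Qoverlap P0 S n lam ω)).aestronglyMeasurable
        (μ := P0.prod ((gaussianReal 0 (lam * Qoverlap P0 S n lam ω).toNNReal).prod (bern ε)))
    rw [← integral_scalarLog hsupp (mul_nonneg hlam (Qoverlap_nonneg ω)) h0 h1
      ((hp.integrable_comp hms).1 hω), ← hp.map_eq, integral_map hp.aemeasurable]
    rwa [hp.map_eq]
  have iQ := (integrable_Qoverlap_sq (n := n) (lam := lam) hsupp hK hSK h0 h1).const_mul (lam / 4)
  have iF : Integrable (fun ω => Fpert P0 S lam ε (Qoverlap P0 S n lam ω)) (cavMeas P0 n ε) :=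
    ((hin.congr hae).sub iQ).congr (.of_forall fun ω => by simp)
  rw [he, integral_congr_ae hae, integral_add iF iQ, integral_const_mul]

/-- The cavity estimate at fixed `ε`. -/
lemma abs_Acav_sub_integral_Fpert_le {δ η η' : ℝ} (hδ : 0 < δ) (hη : 0 < η) (hη' : 0 < η') :
    |Acav P0 S n lam ε - ∫ ω, Fpert P0 S lam ε (Qoverlap P0 S n lam ω) ∂cavMeas P0 n ε|
      ≤ 2 * (rexp (3 * (lam * K ^ 4)) * (lam * K ^ 2)
          * (7 * η + 14 * K ^ 2 * (η' + covAverage P0 S n lam ε / η') / η) / (2 * δ)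
          + 2 * δ * rexp (5 * (lam * K ^ 4))) := by
  obtain ⟨hB, hB'⟩ := integral_overlapBound_le (n := n) hsupp hlam hK hSK h0 h1 hη hη'
  obtain ⟨-, iV, hUV⟩ := cavity_log_compare hsupp hlam hK hSK h0 h1 hη hB
  obtain ⟨-, iY, hGY⟩ := yfield_log_compare hsupp hlam hK hSK h0 h1 hη hB
  have eV := integral_log_Vcav hsupp hlam hK hSK h0 h1 iV
  have eY := integral_log_Ycav hlam h0 h1 iY
  have hle : rexp (3 * (lam * K ^ 4)) * (lam * K ^ 2)
        * (∫ ω, overlapBound P0 S n lam η ω ∂cavMeas P0 n ε) / (2 * δ)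
      ≤ rexp (3 * (lam * K ^ 4)) * (lam * K ^ 2)
        * (7 * η + 14 * K ^ 2 * (η' + covAverage P0 S n lam ε / η') / η) / (2 * δ) := by gcongr
  have b1 := abs_le.1 (hUV δ hδ)
  have b2 := abs_le.1 (hGY δ hδ)
  unfold Acav
  rw [abs_le]
  constructor <;> linarith [b1.1, b1.2, b2.1, b2.2]

end CavityIntegrals

lemma tendsto_zero_of_forall_le {u : ℕ → ℝ} {D G : ℝ} (hD : 0 ≤ D)
    (h : ∀ τ : ℝ, 0 < τ → ∀ n : ℕ, |u n| ≤ D * τ + G / τ ^ 7 / n) :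
    Tendsto u atTop (nhds 0) := by
  rw [Metric.tendsto_nhds]
  intro e he
  have hτ : 0 < e / (D + 1) := by positivity
  have hlt : D * (e / (D + 1)) < e := by
    rw [mul_div_assoc', div_lt_iff₀ (by positivity)]
    nlinarith
  have ht : Tendsto (fun n : ℕ => D * (e / (D + 1)) + G / (e / (D + 1)) ^ 7 / n) atTop
      (nhds (D * (e / (D + 1)) + 0)) :=
    tendsto_const_nhds.add (tendsto_const_div_atTop_nhds_zero_nat _)
  rw [add_zero] at ht
  filter_upwards [ht.eventually_lt_const hlt] with n hn
  rw [Real.dist_eq, sub_zero]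
  exact (h _ hτ n).trans_lt hn

end Cavity

/-- **Main cavity estimate**: `∫_0^{ε₀} (A_{n,ε} − E[𝓕_ε(λ,Q)]) dε → 0` as `n → ∞`. -/
theorem main_cavity_estimate (P0 : Measure ℝ) [IsProbabilityMeasure P0]
    (S : Finset ℝ) (K : ℝ) (hK : 0 < K) (hSK : ∀ x ∈ S, x ∈ Set.Icc (-K) K)
    (hsupp : P0 ((↑S : Set ℝ)ᶜ) = 0) (lam : ℝ) (hlam : 0 < lam)
    (ε₀ : ℝ) (hε₀ : ε₀ ∈ Set.Ioc (0 : ℝ) 1) :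
    Tendsto (fun n => ∫ ε in (0 : ℝ)..ε₀,
        (Acav P0 S n lam ε
          - ∫ ω, Fpert P0 S lam ε (Qoverlap P0 S n lam ω) ∂cavMeas P0 n ε))
      atTop (nhds 0) := by
  have hSK' : ∀ x ∈ S, |x| ≤ K := fun x hx => abs_le.2 (hSK x hx)
  set A := rexp (3 * (lam * K ^ 4)) * (lam * K ^ 2) with hA
  set B := rexp (5 * (lam * K ^ 4)) with hB
  have hA0 : 0 ≤ A := by positivity
  have hB0 : 0 ≤ B := by positivity
  refine Cavity.tendsto_zero_of_forall_le (D := 7 * A + 14 * K ^ 2 * A + 4 * B)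
    (G := 14 * K ^ 2 * A * K ^ 4) (by positivity) fun τ hτ n => ?_
  set c := Cavity.covAverage P0 S n lam with hc
  have hci : IntervalIntegrable c volume 0 ε₀ := Cavity.continuous_covAverage.intervalIntegrable _ _
  have hbound : ∀ ε ∈ Set.Ioc (0 : ℝ) ε₀, ‖Acav P0 S n lam ε
      - ∫ ω, Fpert P0 S lam ε (Qoverlap P0 S n lam ω) ∂cavMeas P0 n ε‖
      ≤ (7 * A + 14 * K ^ 2 * A + 4 * B) * τ + 14 * K ^ 2 * A / τ ^ 7 * c ε := by
    intro ε hε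
    refine (Cavity.abs_Acav_sub_integral_Fpert_le hsupp hlam.le hK.le hSK' hε.1.le
      (hε.2.trans hε₀.2) hτ (pow_pos hτ 2) (pow_pos hτ 4)).trans (le_of_eq ?_)
    rw [← hA, ← hB, ← hc]
    field_simp
    ring
  calc _ ≤ ∫ ε in (0 : ℝ)..ε₀,
        ((7 * A + 14 * K ^ 2 * A + 4 * B) * τ + 14 * K ^ 2 * A / τ ^ 7 * c ε) :=
        intervalIntegral.norm_integral_le_of_norm_le hε₀.1.le (.of_forall hbound)
          (intervalIntegrable_const.add (hci.const_mul _))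
    _ = ε₀ * ((7 * A + 14 * K ^ 2 * A + 4 * B) * τ)
        + 14 * K ^ 2 * A / τ ^ 7 * ∫ ε in (0 : ℝ)..ε₀, c ε := by
        rw [intervalIntegral.integral_add intervalIntegrable_const (hci.const_mul _),
          intervalIntegral.integral_const, intervalIntegral.integral_const_mul]
        simp
    _ ≤ 1 * ((7 * A + 14 * K ^ 2 * A + 4 * B) * τ)
        + 14 * K ^ 2 * A / τ ^ 7 * (K ^ 4 / n) := by
        gcongr
        · exact hε₀.2
        · exact Cavity.integral_covAverage_le hsupp hlam.le hSK' hε₀.1.le hε₀.2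
    _ = _ := by ring

end
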